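/- arXiv:math/0404079 — 5 statements merged into one kernel-verified Lean document; each statement's English description precedes it below -/
import Mathlib

section
/- For every integer n ≥ 4 and every d ≥ 0, the dimension over the field ℂ(t) of the space J_{n,d} equals the number of admissible partitions λ ∈ π_{n,d}. -/
open MvPolynomial Finset

/-- A partition with `n` (possibly zero) parts, encoded as a weakly decreasing function
`ℕ → ℕ` (0-indexed) vanishing from index `n` on. -/
def PartitionN (n : ℕ) (l : ℕ → ℕ) : Prop :=
  Antitone l ∧ ∀ j, n ≤ j → l j = 0

/-- A multiset of exponents of the form `{i, i}` (i.e. `e_i²`) or `{i, i+1}` (i.e. `e_i e_{i+1}`). -/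
def GoodPair (P : Multiset ℕ) : Prop := ∃ i : ℕ, P = {i, i} ∨ P = {i, i + 1}

/-- Non-admissibility of a partition, via multiset containment of exponent multisets. -/
def NonAdmissible (n : ℕ) (l : ℕ → ℕ) : Prop :=
  (∃ P Q : Multiset ℕ, GoodPair P ∧ GoodPair Q ∧ P + Q ≤ (Finset.range n).val.map l) ∨
  (∃ i : ℕ, ({i, i, i, i + 2} : Multiset ℕ) ≤ (Finset.range n).val.map l)

def Admissible (n : ℕ) (l : ℕ → ℕ) : Prop := ¬ NonAdmissible n l

/-- The number of admissible partitions in `π_{n,d}`. -/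
noncomputable def admCount (n d : ℕ) : ℕ :=
  Set.ncard {l : ℕ → ℕ | PartitionN n l ∧ (∑ j ∈ Finset.range n, l j) = d ∧ Admissible n l}

/-- The field `ℂ(t)` of rational functions. -/
abbrev K : Type := RatFunc ℂ

/-- The space `J_{n,d}`: symmetric polynomials in `n` variables over `ℂ(t)`, vanishing
under the substitution `x₂ := t·x₁`, `x₄ := t·x₃`, homogeneous of degree `d`. -/
noncomputable def JComponent (n : ℕ) (hn : 4 ≤ n) (d : ℕ) :
    Submodule K (MvPolynomial (Fin n) K) :=
  (Subalgebra.toSubmodule (MvPolynomial.symmetricSubalgebra (Fin n) K) :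
      Submodule K (MvPolynomial (Fin n) K)) ⊓
  LinearMap.ker (MvPolynomial.aeval (R := K)
      (fun i : Fin n =>
        if (i : ℕ) = 1 then C (RatFunc.X : K) * X (⟨0, by omega⟩ : Fin n)
        else if (i : ℕ) = 3 then C (RatFunc.X : K) * X (⟨2, by omega⟩ : Fin n)
        else (X i : MvPolynomial (Fin n) K))).toLinearMap ⊓
  MvPolynomial.homogeneousSubmodule (Fin n) K d


section Substitution

variable {R σ τ : Type*} [CommRing R] [DecidableEq τ]

lemma coeff_aeval_C_mul_X [Fintype σ] (c : σ → R) (r : σ → τ) (f : MvPolynomial σ R) (u : τ →₀ ℕ) :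
    coeff u (aeval (fun i => C (c i) * (X (r i) : MvPolynomial τ R)) f) =
      ∑ m ∈ f.support with Finsupp.mapDomain r m = u, coeff m f * ∏ i, c i ^ m i := by
  have h : ∀ m : σ →₀ ℕ, ∀ a : R,
      aeval (fun i => C (c i) * (X (r i) : MvPolynomial τ R)) (monomial m a) =
        monomial (Finsupp.mapDomain r m) (a * ∏ i, c i ^ m i) := by
    intro m a
    have h1 : (monomial (Finsupp.mapDomain r m) (1 : R)) = ∏ i, X (r i) ^ m i := by
      rw [← rename_monomial, monomial_eq, Finsupp.prod_fintype _ _ (by simp)]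
      simp
    rw [aeval_monomial, Finsupp.prod_fintype _ _ (by simp), algebraMap_eq]
    simp only [mul_pow, Finset.prod_mul_distrib]
    rw [← h1, ← mul_assoc]
    simp only [← map_pow, ← map_prod, ← map_mul]
    rw [C_mul_monomial, mul_one]
  conv_lhs => rw [f.as_sum, map_sum]
  simp only [h, coeff_sum, coeff_monomial]
  rw [Finset.sum_filter]

lemma coeff_rename_perm (e : Equiv.Perm σ) (f : MvPolynomial σ R) (m : σ →₀ ℕ) :
    coeff m (rename e f) = coeff (m.mapDomain e.symm) f := by
  have : m = (m.mapDomain e.symm).mapDomain e := by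
    rw [← Finsupp.mapDomain_comp]; simp
  conv_lhs => rw [this]
  rw [coeff_rename_mapDomain _ e.injective]

lemma coeff_eq_of_multiset_eq {n : ℕ} {f : MvPolynomial (Fin n) R} (hf : f.IsSymmetric)
    {m m' : Fin n →₀ ℕ} (h : univ.val.map m = univ.val.map m') : coeff m f = coeff m' f := by
  have hl : (List.ofFn m).Perm (List.ofFn m') := by
    rw [← Multiset.coe_eq_coe, ← Fin.univ_val_map, ← Fin.univ_val_map, h]
  have key : m ∘ Tuple.sort m = m' ∘ Tuple.sort m' := by
    apply List.ofFn_injective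
    refine List.Perm.eq_of_pairwise' (r := (· ≤ ·)) ?_ ?_ ?_
    · exact List.sortedLE_iff_pairwise.1 (List.sortedLE_ofFn_iff.2 (Tuple.monotone_sort m))
    · exact List.sortedLE_iff_pairwise.1 (List.sortedLE_ofFn_iff.2 (Tuple.monotone_sort m'))
    · exact ((Equiv.Perm.ofFn_comp_perm _ _).trans hl).trans (Equiv.Perm.ofFn_comp_perm _ _).symm
  set e := (Tuple.sort m).symm.trans (Tuple.sort m')
  have hm : m = m'.mapDomain e.symm := by
    ext i
    rw [← Finsupp.equivMapDomain_eq_mapDomain, Finsupp.equivMapDomain_apply]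
    have := congrFun key ((Tuple.sort m).symm i)
    simpa [e] using this
  rw [hm, ← coeff_rename_perm, hf e]

end Substitution

section MultisetOrder

lemma toLex_toFinsupp_lt_of_min {A B : Multiset ℕ} (x : ℕ) (hx : x ∈ A) (hA : ∀ y ∈ A, x ≤ y)
    (hB : ∀ y ∈ B, x < y) : toLex (Multiset.toFinsupp B) < toLex (Multiset.toFinsupp A) := by
  rw [Finsupp.Lex.lt_iff]
  refine ⟨x, fun y hy => ?_, ?_⟩
  · simp only [ofLex_toLex, Multiset.toFinsupp_apply]
    rw [Multiset.count_eq_zero.2 fun h => ?_, Multiset.count_eq_zero.2 fun h => ?_]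
    · have := hA y h; omega
    · have := hB y h; omega
  · simp only [ofLex_toLex, Multiset.toFinsupp_apply]
    rw [Multiset.count_eq_zero.2 fun h => (hB x h).false]
    exact Multiset.count_pos.2 hx

lemma eq_or_lt_of_goodPair_sum {i a b ε : ℕ} (hε : ε ≤ 1) (h : a + b = 2 * i + ε) :
    ({a, b} : Multiset ℕ) = {i, i + ε} ∨
      toLex (Multiset.toFinsupp ({i, i + ε} : Multiset ℕ)) <
        toLex (Multiset.toFinsupp ({a, b} : Multiset ℕ)) := by
  rcases lt_or_ge (min a b) i with hlt | hge
  · right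
    apply toLex_toFinsupp_lt_of_min (min a b)
    · rcases min_choice a b with h | h <;> simp [h]
    · simp
    · simp only [Multiset.insert_eq_cons, Multiset.mem_cons, Multiset.mem_singleton]; omega
  · left
    obtain ⟨rfl, rfl⟩ | ⟨rfl, rfl⟩ : (a = i ∧ b = i + ε) ∨ (a = i + ε ∧ b = i) := by omega
    · rfl
    · exact Multiset.pair_comm _ _

end MultisetOrder

section UpperBound

lemma sum_ratFunc_X_pow_ne_zero {ι : Type*} {s : Finset ι} (hs : s.Nonempty) (g : ι → ℕ) :
    ∑ i ∈ s, (RatFunc.X : K) ^ g i ≠ 0 := by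
  have h : ∑ i ∈ s, (RatFunc.X : K) ^ g i =
      algebraMap (Polynomial ℂ) K (∑ i ∈ s, Polynomial.X ^ g i) := by
    simp [map_sum]
  rw [h]
  intro h0
  have h1 := (map_eq_zero_iff _ (RatFunc.algebraMap_injective ℂ)).1 h0
  have h2 := congrArg (Polynomial.eval 1) h1
  simp [Polynomial.eval_finsetSum, hs.ne_empty] at h2

lemma ratFunc_X_pow_injective : Function.Injective fun a : ℕ => (RatFunc.X : K) ^ a := by
  intro a b h
  have h1 : algebraMap (Polynomial ℂ) K (Polynomial.X ^ a) =
      algebraMap (Polynomial ℂ) K (Polynomial.X ^ b) := by simpa using h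
  have h2 := congrArg Polynomial.natDegree (RatFunc.algebraMap_injective ℂ h1)
  simpa using h2

/-- The scalar by which the variable `i` is multiplied under `x₂ := t·x₁`, `x₄ := t·x₃`. -/
noncomputable def pairCoef (k : ℕ) (i : Fin (k + 4)) : K :=
  if (i : ℕ) = 1 ∨ (i : ℕ) = 3 then RatFunc.X else 1

/-- The variable replacing the variable `i` under `x₂ := t·x₁`, `x₄ := t·x₃`. -/
def pairIdx (k : ℕ) (i : Fin (k + 4)) : Fin (k + 4) :=
  if (i : ℕ) = 1 then 0 else if (i : ℕ) = 3 then 2 else i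

/-- The substitution `x₂ := t·x₁`, `x₄ := t·x₃`. -/
noncomputable def pairSubst (k : ℕ) :
    MvPolynomial (Fin (k + 4)) K →ₐ[K] MvPolynomial (Fin (k + 4)) K :=
  aeval fun i => C (pairCoef k i) * X (pairIdx k i)

lemma mem_JComponent_iff {k : ℕ} {hn : 4 ≤ k + 4} {d : ℕ} {f : MvPolynomial (Fin (k + 4)) K} :
    f ∈ JComponent (k + 4) hn d ↔ f.IsSymmetric ∧ pairSubst k f = 0 ∧ f.IsHomogeneous d := by
  have h : (fun i : Fin (k + 4) =>
        if (i : ℕ) = 1 then C (RatFunc.X : K) * X (⟨0, by omega⟩ : Fin (k + 4))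
        else if (i : ℕ) = 3 then C (RatFunc.X : K) * X (⟨2, by omega⟩ : Fin (k + 4))
        else (X i : MvPolynomial (Fin (k + 4)) K)) =
      fun i => C (pairCoef k i) * X (pairIdx k i) := by
    funext i
    unfold pairCoef pairIdx
    by_cases h1 : (i : ℕ) = 1
    · simp only [h1]; rfl
    · by_cases h3 : (i : ℕ) = 3
      · simp only [h3]; rfl
      · simp [h1, h3]
  unfold JComponent pairSubst
  rw [h, Submodule.mem_inf, Submodule.mem_inf, and_assoc]
  rfl

lemma val_pairIdx {k : ℕ} (i : Fin (k + 4)) : (pairIdx k i : ℕ) =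
    if (i : ℕ) = 1 then (0 : ℕ) else if (i : ℕ) = 3 then (2 : ℕ) else (i : ℕ) := by
  unfold pairIdx
  split_ifs <;> rfl

lemma mapDomain_pairIdx_apply {k : ℕ} (m : Fin (k + 4) →₀ ℕ) (j : Fin (k + 4)) :
    m.mapDomain (pairIdx k) j = ∑ i with pairIdx k i = j, m i := by
  rw [Finsupp.mapDomain, Finsupp.sum_fintype _ _ (by simp), Finsupp.finsetSum_apply,
    Finset.sum_filter]
  simp [Finsupp.single_apply]

lemma mapDomain_pairIdx_eq {k : ℕ} {m m' : Fin (k + 4) →₀ ℕ}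
    (h : m.mapDomain (pairIdx k) = m'.mapDomain (pairIdx k)) :
    m 0 + m 1 = m' 0 + m' 1 ∧ m 2 + m 3 = m' 2 + m' 3 ∧
      ∀ i : Fin k, m i.succ.succ.succ.succ = m' i.succ.succ.succ.succ := by
  have key : ∀ j, ∑ i with pairIdx k i = j, m i = ∑ i with pairIdx k i = j, m' i := by
    intro j
    rw [← mapDomain_pairIdx_apply, h, mapDomain_pairIdx_apply]
  have h23 : (2 : Fin (k + 4)) ≠ 3 := fun h => absurd (congrArg Fin.val h) (by decide : (2 : ℕ) ≠ 3)
  have h0 : ({i | pairIdx k i = 0} : Finset (Fin (k + 4))) = {0, 1} := by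
    ext i
    simp only [Finset.mem_filter, Finset.mem_univ, true_and, Finset.mem_insert,
      Finset.mem_singleton, Fin.ext_iff, val_pairIdx]
    change _ = 0 ↔ (i : ℕ) = 0 ∨ (i : ℕ) = 1
    split_ifs <;> grind
  have h2 : ({i | pairIdx k i = 2} : Finset (Fin (k + 4))) = {2, 3} := by
    ext i
    simp only [Finset.mem_filter, Finset.mem_univ, true_and, Finset.mem_insert,
      Finset.mem_singleton, Fin.ext_iff, val_pairIdx]
    change _ = 2 ↔ (i : ℕ) = 2 ∨ (i : ℕ) = 3
    split_ifs <;> grind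
  have h4 : ∀ i : Fin k, ({j | pairIdx k j = i.succ.succ.succ.succ} : Finset (Fin (k + 4))) =
      {i.succ.succ.succ.succ} := by
    intro i
    ext j
    simp only [Finset.mem_filter, Finset.mem_univ, true_and,
      Finset.mem_singleton, Fin.ext_iff, val_pairIdx, Fin.val_succ]
    split_ifs <;> grind
  refine ⟨?_, ?_, fun i => ?_⟩
  · have := key 0
    rw [h0, Finset.sum_pair (by simp), Finset.sum_pair (by simp)] at this
    exact this
  · have := key 2
    rw [h2, Finset.sum_pair h23, Finset.sum_pair h23] at this
    exact this
  · have := key i.succ.succ.succ.succ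
    rwa [h4, Finset.sum_singleton, Finset.sum_singleton] at this

lemma coeff_eq_zero_of_collapse {k : ℕ} {f : MvPolynomial (Fin (k + 4)) K} (hf : f.IsSymmetric)
    (h0 : pairSubst k f = 0) (m' : Fin (k + 4) →₀ ℕ)
    (h : ∀ m ∈ f.support, m.mapDomain (pairIdx k) = m'.mapDomain (pairIdx k) →
      univ.val.map m = univ.val.map m') : coeff m' f = 0 := by
  by_contra hne
  have h1 := coeff_aeval_C_mul_X (pairCoef k) (pairIdx k) f (m'.mapDomain (pairIdx k))
  have hpow : ∀ m : Fin (k + 4) →₀ ℕ, ∏ i, pairCoef k i ^ m i =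
      RatFunc.X ^ ∑ i : Fin (k + 4), if (i : ℕ) = 1 ∨ (i : ℕ) = 3 then m i else 0 := by
    intro m
    rw [← Finset.prod_pow_eq_pow_sum]
    refine Finset.prod_congr rfl fun i _ => ?_
    unfold pairCoef
    split_ifs <;> simp
  rw [show aeval (fun i => C (pairCoef k i) * X (pairIdx k i)) f = 0 from h0, coeff_zero] at h1
  have h2 : ∀ m ∈ f.support.filter fun m => m.mapDomain (pairIdx k) = m'.mapDomain (pairIdx k),
      coeff m f * ∏ i, pairCoef k i ^ m i = coeff m' f * RatFunc.X ^
        ∑ i : Fin (k + 4), if (i : ℕ) = 1 ∨ (i : ℕ) = 3 then m i else 0 := by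
    intro m hm
    rw [Finset.mem_filter] at hm
    rw [coeff_eq_of_multiset_eq hf (h m hm.1 hm.2), hpow]
  rw [Finset.sum_congr rfl h2, ← Finset.mul_sum] at h1
  refine mul_ne_zero hne (sum_ratFunc_X_pow_ne_zero ⟨m', ?_⟩ _) h1.symm
  simp [hne]

lemma univ_val_map_eq_pairs {k : ℕ} (m : Fin (k + 4) → ℕ) :
    univ.val.map m = {m 0, m 1} + {m 2, m 3} +
      (List.ofFn fun i : Fin k => m i.succ.succ.succ.succ : Multiset ℕ) := by
  rw [Fin.univ_val_map, List.ofFn_succ, List.ofFn_succ, List.ofFn_succ, List.ofFn_succ]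
  rfl

lemma exists_arrangement {k : ℕ} {a b c d : ℕ} {m : Fin (k + 4) → ℕ}
    (h : ({a, b} + {c, d} : Multiset ℕ) ≤ univ.val.map m) :
    ∃ m' : Fin (k + 4) →₀ ℕ, m' 0 = a ∧ m' 1 = b ∧ m' 2 = c ∧ m' 3 = d ∧
      univ.val.map m' = univ.val.map m := by
  obtain ⟨S, hS⟩ := Multiset.le_iff_exists_add.1 h
  have hcard := congrArg Multiset.card hS
  simp only [Multiset.card_map, Finset.card_val, Finset.card_univ, Fintype.card_fin,
    Multiset.card_add, Multiset.card_pair] at hcard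
  have hlen : S.toList.length = k := by rw [Multiset.length_toList]; omega
  subst hlen
  refine ⟨Finsupp.equivFunOnFinite.symm
    (Fin.cons a (Fin.cons b (Fin.cons c (Fin.cons d S.toList.get)))), rfl, rfl, rfl, rfl, ?_⟩
  rw [univ_val_map_eq_pairs, hS]
  congr 1
  have : (List.ofFn S.toList.get : Multiset ℕ) = S := by
    rw [List.ofFn_get, Multiset.coe_toList]
  conv_rhs => rw [← this]
  rfl

lemma eq_zero_of_coeff_admissible {k d : ℕ} {f : MvPolynomial (Fin (k + 4)) K}
    (hf : f.IsSymmetric) (h0 : pairSubst k f = 0) (hd : f.IsHomogeneous d)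
    (hadm : ∀ l : ℕ → ℕ, PartitionN (k + 4) l → ∑ j ∈ Finset.range (k + 4), l j = d →
      Admissible (k + 4) l →
        coeff (Finsupp.equivFunOnFinite.symm fun i : Fin (k + 4) => l i) f = 0) : f = 0 := by
  by_contra hne
  obtain ⟨m, hm, hmax⟩ := Finset.exists_max_image f.support
    (fun m => toLex (Multiset.toFinsupp (univ.val.map m))) (support_nonempty.2 hne)
  -- the decreasing rearrangement of the maximal exponent
  set l : ℕ → ℕ := fun j =>
    if h : j < k + 4 then m (Tuple.sort m (Fin.rev ⟨j, h⟩)) else 0 with hl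
  have hpart : PartitionN (k + 4) l := by
    refine ⟨fun a b hab => ?_, fun j hj => by simp [hl, hj]⟩
    simp only [hl]
    split_ifs with h1 h2
    · refine Tuple.monotone_sort m (Fin.rev_le_rev.2 ?_)
      exact hab
    · omega
    · exact Nat.zero_le _
    · exact le_rfl
  have hlm : (Finset.range (k + 4)).val.map l = univ.val.map m := by
    have h1 : (Finset.range (k + 4)).val.map l = univ.val.map fun i : Fin (k + 4) => l i := by
      rw [Fin.univ_val_map, List.ofFn_eq_map]
      change Multiset.map l (List.range (k + 4) : Multiset ℕ) = _
      rw [← List.map_coe_finRange_eq_range, Multiset.map_coe, List.map_map]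
      rfl
    have h2 : (fun i : Fin (k + 4) => l i) = m ∘ (Fin.revPerm.trans (Tuple.sort m)) := by
      funext i
      simp [hl]
    rw [h1, h2, ← Multiset.map_map]
    congr 1
    exact congrArg Finset.val (Finset.map_univ_equiv (Fin.revPerm.trans (Tuple.sort m)))
  set L : Fin (k + 4) →₀ ℕ := Finsupp.equivFunOnFinite.symm fun i : Fin (k + 4) => l i with hL
  have hLm : univ.val.map L = univ.val.map m := by
    rw [← hlm, Fin.univ_val_map, List.ofFn_eq_map]
    change _ = Multiset.map l (List.range (k + 4) : Multiset ℕ)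
    rw [← List.map_coe_finRange_eq_range, Multiset.map_coe, List.map_map]
    rfl
  have hcm : coeff m f ≠ 0 := mem_support_iff.1 hm
  have hsum : ∑ j ∈ Finset.range (k + 4), l j = d := by
    have h1 : m.degree = d := by
      by_contra hdeg
      exact hcm (hd.coeff_eq_zero hdeg)
    rw [← h1, Finsupp.degree_eq_sum]
    exact congrArg Multiset.sum hlm
  have hnon : NonAdmissible (k + 4) l := by
    by_contra hA
    exact hcm ((coeff_eq_of_multiset_eq hf hLm).symm.trans (hadm l hpart hsum hA))
  -- comparison with exponents having the same image under the substitution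
  have htail : ∀ {m₁ m₂ : Fin (k + 4) →₀ ℕ},
      m₁.mapDomain (pairIdx k) = m₂.mapDomain (pairIdx k) → ∃ T : Multiset ℕ,
        univ.val.map m₁ = {m₁ 0, m₁ 1} + {m₁ 2, m₁ 3} + T ∧
        univ.val.map m₂ = {m₂ 0, m₂ 1} + {m₂ 2, m₂ 3} + T := by
    intro m₁ m₂ h
    refine ⟨_, univ_val_map_eq_pairs m₁, ?_⟩
    simp only [(mapDomain_pairIdx_eq h).2.2]
    exact univ_val_map_eq_pairs m₂
  have hlt : ∀ {A B T : Multiset ℕ} {m₁ : Fin (k + 4) →₀ ℕ}, m₁ ∈ f.support →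
      univ.val.map m₁ = A + T → univ.val.map m = B + T →
      ¬ toLex (Multiset.toFinsupp B) < toLex (Multiset.toFinsupp A) := by
    intro A B T m₁ h₁ hA hB hlt
    have h2 := hmax m₁ h₁
    simp only [hA, hB, map_add, toLex_add] at h2
    exact absurd h2 (not_le.2 (by gcongr))
  unfold NonAdmissible at hnon
  rw [hlm] at hnon
  rcases hnon with ⟨P, Q, hP, hQ, hPQ⟩ | ⟨i, hi⟩
  · have hgood : ∀ {P}, GoodPair P → ∃ i ε : ℕ, ε ≤ 1 ∧ P = {i, i + ε} := by
      rintro P ⟨i, h | h⟩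
      · exact ⟨i, 0, by omega, h⟩
      · exact ⟨i, 1, by omega, h⟩
    obtain ⟨i, ε, hε, rfl⟩ := hgood hP
    obtain ⟨j, η, hη, rfl⟩ := hgood hQ
    obtain ⟨m', e0, e1, e2, e3, hm'⟩ := exists_arrangement hPQ
    refine hcm ((coeff_eq_of_multiset_eq hf hm').symm.trans
      (coeff_eq_zero_of_collapse hf h0 m' fun m₁ h₁ hc => ?_))
    obtain ⟨c1, c2, -⟩ := mapDomain_pairIdx_eq hc
    obtain ⟨T, hT1, hT2⟩ := htail hc
    rw [e0, e1] at c1 hT2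
    rw [e2, e3] at c2 hT2
    have hnot := hlt h₁ hT1 (hm'.symm.trans hT2)
    rw [map_add Multiset.toFinsupp, map_add Multiset.toFinsupp, toLex_add, toLex_add] at hnot
    rcases eq_or_lt_of_goodPair_sum hε (show m₁ 0 + m₁ 1 = 2 * i + ε by omega) with ha | ha <;>
    rcases eq_or_lt_of_goodPair_sum hη (show m₁ 2 + m₁ 3 = 2 * j + η by omega) with hb | hb
    · rw [hT1, hT2, ha, hb]
    · exact absurd (by rw [ha]; gcongr) hnot
    · exact absurd (by rw [hb]; gcongr) hnot
    · exact absurd (add_lt_add ha hb) hnot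
  · have hi' : ({i, i} + {i, i + 2} : Multiset ℕ) ≤ univ.val.map m := hi
    obtain ⟨m', e0, e1, e2, e3, hm'⟩ := exists_arrangement hi'
    -- entries below `i` are excluded by maximality
    have hge : ∀ {a b c e : ℕ} {T : Multiset ℕ} {m₁ : Fin (k + 4) →₀ ℕ}, m₁ ∈ f.support →
        univ.val.map m₁ = {a, b} + {c, e} + T → univ.val.map m = {i, i} + {i, i + 2} + T →
        i ≤ a ∧ i ≤ b ∧ i ≤ c ∧ i ≤ e := by
      intro a b c e T m₁ h₁ hA hB
      by_contra hcon
      refine hlt h₁ hA hB (toLex_toFinsupp_lt_of_min (min (min a b) (min c e)) ?_ ?_ ?_)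
      · simp only [Multiset.insert_eq_cons, Multiset.mem_cons, Multiset.mem_singleton,
          Multiset.mem_add]
        omega
      · simp only [Multiset.insert_eq_cons, Multiset.mem_cons, Multiset.mem_singleton,
          Multiset.mem_add]
        omega
      · simp only [Multiset.insert_eq_cons, Multiset.mem_cons, Multiset.mem_singleton,
          Multiset.mem_add]
        omega
    set T : Multiset ℕ := (List.ofFn fun i : Fin k => m' i.succ.succ.succ.succ : Multiset ℕ)
    have hmT : univ.val.map m = {i, i} + {i, i + 2} + T := by
      rw [← hm', univ_val_map_eq_pairs, e0, e1, e2, e3]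
    have hzero : ∀ m₁ : Fin (k + 4) →₀ ℕ,
        univ.val.map m₁ = {i, i + 1} + {i, i + 1} + T → coeff m₁ f = 0 := by
      intro m₁ h₁
      obtain ⟨m₂, g0, g1, g2, g3, hm₂⟩ := exists_arrangement
        (h₁ ▸ Multiset.le_add_right _ _ :
          ({i, i + 1} + {i, i + 1} : Multiset ℕ) ≤ univ.val.map m₁)
      rw [← coeff_eq_of_multiset_eq hf hm₂]
      refine coeff_eq_zero_of_collapse hf h0 m₂ fun m₃ h₃ hc => ?_
      obtain ⟨c1, c2, -⟩ := mapDomain_pairIdx_eq hc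
      obtain ⟨T', hT1, hT2⟩ := htail hc
      rw [g0, g1] at c1 hT2
      rw [g2, g3] at c2 hT2
      obtain rfl : T' = T := by
        rw [hm₂, h₁] at hT2
        exact (add_left_cancel hT2).symm
      obtain ⟨i0, i1, i2, i3⟩ := hge h₃ hT1 hmT
      rw [hT1, hT2]
      rcases eq_or_lt_of_goodPair_sum le_rfl (show m₃ 0 + m₃ 1 = 2 * i + 1 by omega) with ha | ha
      · rcases eq_or_lt_of_goodPair_sum le_rfl (show m₃ 2 + m₃ 3 = 2 * i + 1 by omega)
          with hb | hb
        · rw [ha, hb]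
        · obtain h | h : (m₃ 2 = i ∧ m₃ 3 = i + 1) ∨ (m₃ 2 = i + 1 ∧ m₃ 3 = i) := by omega
          · rw [ha, h.1, h.2]
          · rw [ha, h.1, h.2, Multiset.pair_comm (i + 1) i]
      · obtain h | h : (m₃ 0 = i ∧ m₃ 1 = i + 1) ∨ (m₃ 0 = i + 1 ∧ m₃ 1 = i) := by omega
        · rw [h.1, h.2] at ha
          exact absurd ha (lt_irrefl _)
        · rw [h.1, h.2, Multiset.pair_comm (i + 1) i] at ha
          exact absurd ha (lt_irrefl _)
    refine hcm ((coeff_eq_of_multiset_eq hf hm').symm.trans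
      (coeff_eq_zero_of_collapse hf h0 m' fun m₁ h₁ hc => ?_))
    obtain ⟨c1, c2, -⟩ := mapDomain_pairIdx_eq hc
    obtain ⟨T', hT1, hT2⟩ := htail hc
    rw [e0, e1] at c1 hT2
    rw [e2, e3] at c2 hT2
    obtain rfl : T' = T := by
      rw [hm', hmT] at hT2
      exact (add_left_cancel hT2).symm
    obtain ⟨i0, i1, i2, i3⟩ := hge h₁ hT1 hmT
    have a0 : m₁ 0 = i := by omega
    have a1 : m₁ 1 = i := by omega
    rw [a0, a1] at hT1
    rw [hT1, hT2]
    obtain h | h | h : (m₁ 2 = i ∧ m₁ 3 = i + 2) ∨ (m₁ 2 = i + 1 ∧ m₁ 3 = i + 1) ∨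
        (m₁ 2 = i + 2 ∧ m₁ 3 = i) := by omega
    · rw [h.1, h.2]
    · refine absurd (hzero m₁ ?_) (mem_support_iff.1 h₁)
      rw [hT1, h.1, h.2]
      congr 1
      simp only [Multiset.insert_eq_cons, ← Multiset.singleton_add]
      abel
    · rw [h.1, h.2, Multiset.pair_comm (i + 2) i]

end UpperBound

section Alternating

variable {n : ℕ} {F : Type*} [Field F]

/-- Antisymmetric polynomials: permuting the variables multiplies by the signature. -/
def IsAlternating (p : MvPolynomial (Fin n) F) : Prop :=
  ∀ e : Equiv.Perm (Fin n), rename e p = ((Equiv.Perm.sign e : ℤ) : MvPolynomial (Fin n) F) * p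

/-- The Vandermonde polynomial `∏_{i < j} (X j - X i)`. -/
noncomputable def vandermondePoly (n : ℕ) (F : Type*) [Field F] : MvPolynomial (Fin n) F :=
  ∏ i : Fin n, ∏ j ∈ Ioi i, (X j - X i)

lemma isAlternating_vandermondePoly : IsAlternating (vandermondePoly n F) := by
  intro e
  have h : vandermondePoly n F =
      (Matrix.vandermonde (X : Fin n → MvPolynomial (Fin n) F)).det :=
    (Matrix.det_vandermonde _).symm
  rw [h, ← Matrix.det_permute, ← AlgHom.coe_toRingHom, RingHom.map_det]
  congr 1
  ext1 i j
  simp [Matrix.vandermonde_apply]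

lemma X_sub_X_irreducible {i j : Fin n} (h : i ≠ j) :
    Irreducible (X j - X i : MvPolynomial (Fin n) F) := by
  have h2 : Finsupp.single i 1 ≠ Finsupp.single j 1 := fun hh =>
    h (Finsupp.single_left_injective one_ne_zero hh)
  apply irreducible_of_totalDegree_eq_one
  · apply le_antisymm
    · exact (totalDegree_sub _ _).trans (by simp [totalDegree_X])
    · rw [← not_lt, Nat.lt_one_iff, totalDegree_eq_zero_iff_eq_C]
      intro h0
      have h1 := congrArg (coeff (Finsupp.single j 1)) h0
      rw [coeff_C, if_neg (by simp [eq_comm])] at h1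
      simp [coeff_X, h2] at h1
  · intro x hx
    have h1 := hx (Finsupp.single j 1)
    rw [coeff_sub, coeff_X, coeff_X, if_pos rfl, if_neg h2, sub_zero] at h1
    exact isUnit_of_dvd_one h1

lemma not_X_sub_X_dvd {i j k l : Fin n} (hij : i < j) (hkl : k < l) (h : (i, j) ≠ (k, l)) :
    ¬ (X j - X i : MvPolynomial (Fin n) F) ∣ X l - X k := by
  rintro ⟨q, hq⟩
  let φ : MvPolynomial (Fin n) F →ₐ[F] MvPolynomial (Fin n) F :=
    aeval fun m => if m = i then X j else X m
  have h1 := congrArg φ hq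
  rw [map_mul] at h1
  have h2 : φ (X j - X i) = 0 := by simp [φ]
  rw [h2, zero_mul, map_sub, sub_eq_zero] at h1
  simp only [φ, aeval_X] at h1
  have : ¬ (i = k ∧ j = l) := fun hh => h (Prod.ext hh.1 hh.2)
  split_ifs at h1 with h3 h4 h4
  · omega
  · have := X_injective h1; omega
  · have := X_injective h1; omega
  · have := X_injective h1; omega

lemma IsAlternating.X_sub_X_dvd [CharZero F] {a : MvPolynomial (Fin n) F} (ha : IsAlternating a)
    {i j : Fin n} (h : i ≠ j) : X j - X i ∣ a := by
  let φ : MvPolynomial (Fin n) F →ₐ[F] MvPolynomial (Fin n) F :=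
    aeval fun m => if m = i then X j else X m
  have h0 : φ a = 0 := by
    have h1 : φ (rename (Equiv.swap i j) a) = φ a := by
      simp only [φ, aeval_rename]
      congr 2
      funext m
      simp only [Function.comp_apply]
      rcases eq_or_ne m i with rfl | hi
      · simp
      · rcases eq_or_ne m j with rfl | hj
        · simp [hi]
        · rw [Equiv.swap_apply_of_ne_of_ne hi hj]
    rw [ha, Equiv.Perm.sign_swap h] at h1
    simp only [Units.val_neg, Units.val_one, Int.cast_neg, Int.cast_one, neg_mul, one_mul,
      map_neg] at h1
    exact self_eq_neg.1 h1.symm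
  rw [← Ideal.mem_span_singleton, ← Ideal.Quotient.eq_zero_iff_mem]
  set I := Ideal.span {(X j - X i : MvPolynomial (Fin n) F)}
  have h2 : (Ideal.Quotient.mkₐ F I).comp φ = Ideal.Quotient.mkₐ F I := by
    apply algHom_ext
    intro m
    simp only [φ, AlgHom.comp_apply, aeval_X]
    split_ifs with hm
    · subst hm
      exact Ideal.Quotient.eq.2 (Ideal.mem_span_singleton_self _)
    · rfl
  have h3 := DFunLike.congr_fun h2 a
  rw [AlgHom.comp_apply, h0, map_zero] at h3
  exact h3.symm

lemma IsAlternating.vandermondePoly_dvd [CharZero F] {a : MvPolynomial (Fin n) F}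
    (ha : IsAlternating a) : vandermondePoly n F ∣ a := by
  rw [vandermondePoly, Finset.prod_sigma']
  refine Finset.prod_dvd_of_isRelPrime ?_ ?_
  · rintro ⟨i, j⟩ hij ⟨k, l⟩ hkl h
    simp only [Finset.coe_sigma, Set.mem_sigma_iff, Finset.mem_coe, Finset.mem_Ioi] at hij hkl
    refine (X_sub_X_irreducible hij.2.ne).isRelPrime_iff_not_dvd.2
      (not_X_sub_X_dvd hij.2 hkl.2 fun hh => h ?_)
    rw [Prod.mk.injEq] at hh
    rw [hh.1, hh.2]
  · rintro ⟨i, j⟩ hij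
    simp only [Finset.mem_sigma, Finset.mem_Ioi] at hij
    exact ha.X_sub_X_dvd hij.2.ne

lemma vandermondePoly_ne_zero : vandermondePoly n F ≠ 0 := by
  refine Finset.prod_ne_zero_iff.2 fun i _ => Finset.prod_ne_zero_iff.2 fun j hj => ?_
  exact sub_ne_zero.2 fun h => (Finset.mem_Ioi.1 hj).ne' (X_injective h)

lemma isHomogeneous_vandermondePoly :
    (vandermondePoly n F).IsHomogeneous (∑ i : Fin n, (i : ℕ)) := by
  have h : ∑ i : Fin n, (i : ℕ) = ∑ i : Fin n, ∑ j ∈ Ioi i, 1 := by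
    rw [Finset.sum_comm' (s' := fun j => Iio j) (t' := univ) (by simp)]
    simp
  rw [h, vandermondePoly]
  exact IsHomogeneous.prod _ _ _ fun i _ => IsHomogeneous.prod _ _ _ fun j _ =>
    (isHomogeneous_X _ _).sub (isHomogeneous_X _ _)

end Alternating

section Quotient

lemma homogeneousComponent_add_mul {σ R : Type*} [CommSemiring R] {p q : MvPolynomial σ R} {D : ℕ}
    (hq : q.IsHomogeneous D) (d : ℕ) :
    homogeneousComponent (d + D) (p * q) = homogeneousComponent d p * q := by
  conv_lhs => rw [← sum_homogeneousComponent p, Finset.sum_mul, map_sum]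
  have h : ∀ i, homogeneousComponent (d + D) (homogeneousComponent i p * q) =
      if i = d then homogeneousComponent d p * q else 0 := by
    intro i
    rw [homogeneousComponent_of_mem ((homogeneousComponent_isHomogeneous i p).mul hq)]
    by_cases hi : i = d
    · subst hi; simp
    · rw [if_neg hi, if_neg (by omega)]
  simp only [h, Finset.sum_ite_eq', Finset.mem_range]
  split_ifs with hd
  · rfl
  · rw [homogeneousComponent_eq_zero _ _ (by omega), zero_mul]

lemma IsAlternating.isSymmetric_of_mul {n : ℕ} {F : Type*} [Field F] {f v : MvPolynomial (Fin n) F}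
    (hfv : IsAlternating (f * v)) (hv : IsAlternating v) (h0 : v ≠ 0) : f.IsSymmetric := by
  intro e
  have h1 := hfv e
  rw [map_mul, hv e, mul_left_comm] at h1
  have h2 : ((Equiv.Perm.sign e : ℤ) : MvPolynomial (Fin n) F) ≠ 0 := by
    rcases Int.units_eq_one_or (Equiv.Perm.sign e) with h | h <;> simp [h]
  exact mul_right_cancel₀ h0 (mul_left_cancel₀ h2 h1)

lemma ratFunc_X_ne_one : (RatFunc.X : K) ≠ 1 := fun h =>
  one_ne_zero (ratFunc_X_pow_injective (a₁ := 1) (a₂ := 0) (by simpa using h))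

lemma pairSubst_vandermondePoly_ne_zero (k : ℕ) :
    pairSubst k (vandermondePoly (k + 4) K) ≠ 0 := by
  simp only [vandermondePoly, map_prod]
  refine Finset.prod_ne_zero_iff.2 fun i _ => Finset.prod_ne_zero_iff.2 fun j hj h0 => ?_
  have hij : i < j := Finset.mem_Ioi.1 hj
  rw [Fin.lt_def] at hij
  simp only [map_sub, pairSubst, aeval_X, sub_eq_zero] at h0
  have h1 : ∀ l, (C (pairCoef k l) * X (pairIdx k l) : MvPolynomial (Fin (k + 4)) K) =
      monomial (Finsupp.single (pairIdx k l) 1) (pairCoef k l) := by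
    intro l
    rw [C_mul_X_eq_monomial]
  rw [h1, h1, monomial_eq_monomial_iff] at h0
  have hc : ∀ l, pairCoef k l ≠ 0 := by
    intro l
    unfold pairCoef
    split_ifs
    · exact RatFunc.X_ne_zero
    · exact one_ne_zero
  obtain ⟨h2, h3⟩ : pairIdx k j = pairIdx k i ∧ pairCoef k j = pairCoef k i := by
    rcases h0 with h | h
    · exact ⟨Finsupp.single_left_injective one_ne_zero h.1, h.2⟩
    · exact absurd h.1 (hc _)
  have hX := ratFunc_X_ne_one
  rw [Fin.ext_iff, val_pairIdx, val_pairIdx] at h2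
  unfold pairCoef at h3
  split_ifs at h2 h3 <;> first | omega | exact hX h3

/-- Dividing an alternating polynomial by the Vandermonde polynomial. -/
lemma IsAlternating.exists_mem_JComponent {k d : ℕ} (hn : 4 ≤ k + 4)
    {a : MvPolynomial (Fin (k + 4)) K} (ha : IsAlternating a) (h0 : pairSubst k a = 0)
    (hd : a.IsHomogeneous (d + ∑ i : Fin (k + 4), (i : ℕ))) :
    ∃ f ∈ JComponent (k + 4) hn d, f * vandermondePoly (k + 4) K = a := by
  obtain ⟨g, hg⟩ := ha.vandermondePoly_dvd
  rw [mul_comm] at hg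
  have hf : homogeneousComponent d g * vandermondePoly (k + 4) K = a := by
    rw [← homogeneousComponent_add_mul isHomogeneous_vandermondePoly, ← hg,
      homogeneousComponent_eq_self hd]
  refine ⟨homogeneousComponent d g, mem_JComponent_iff.2 ⟨?_, ?_, ?_⟩, hf⟩
  · exact IsAlternating.isSymmetric_of_mul (hf ▸ ha) isAlternating_vandermondePoly
      vandermondePoly_ne_zero
  · rw [← hf, map_mul] at h0
    exact (mul_eq_zero.1 h0).resolve_right (pairSubst_vandermondePoly_ne_zero k)
  · exact homogeneousComponent_isHomogeneous d g

end Quotient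

section Dominance

variable {n : ℕ} {F : Type*} [Field F]

/-- The signed sum over all permutations of the variables. -/
noncomputable def altize (p : MvPolynomial (Fin n) F) : MvPolynomial (Fin n) F :=
  ∑ e : Equiv.Perm (Fin n), ((Equiv.Perm.sign e : ℤ) : MvPolynomial (Fin n) F) * rename e p

lemma isAlternating_altize (p : MvPolynomial (Fin n) F) : IsAlternating (altize p) := by
  intro e
  simp only [altize, map_sum, Finset.mul_sum]
  refine Fintype.sum_equiv (Equiv.mulLeft e) _ _ fun s => ?_
  rw [map_mul, rename_rename, map_intCast]
  simp only [Equiv.coe_mulLeft, Equiv.Perm.sign_mul, Units.val_mul, Int.cast_mul, ← mul_assoc]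
  rw [← Int.cast_mul, ← Units.val_mul, Int.units_mul_self]
  simp

lemma coeff_altize (p : MvPolynomial (Fin n) F) (M : Fin n →₀ ℕ) :
    coeff M (altize p) = ∑ e : Equiv.Perm (Fin n), ((Equiv.Perm.sign e : ℤ) : F) *
      coeff (Finsupp.equivFunOnFinite.symm (M ∘ e)) p := by
  simp only [altize, coeff_sum]
  refine Finset.sum_congr rfl fun e _ => ?_
  rw [← map_intCast (C : F →+* MvPolynomial (Fin n) F), coeff_C_mul, coeff_rename_perm]
  congr 2
  ext i
  rw [← Finsupp.equivMapDomain_eq_mapDomain, Finsupp.equivMapDomain_apply]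
  simp

lemma IsAlternating.coeff_comp_perm {p : MvPolynomial (Fin n) F} (hp : IsAlternating p)
    (M : Fin n →₀ ℕ) (e : Equiv.Perm (Fin n)) :
    coeff (Finsupp.equivFunOnFinite.symm (M ∘ e)) p = ((Equiv.Perm.sign e : ℤ) : F) * coeff M p := by
  have h := congrArg (coeff M) (hp e)
  rw [← map_intCast (C : F →+* MvPolynomial (Fin n) F), coeff_C_mul, coeff_rename_perm] at h
  rw [← h]
  congr 1
  ext i
  rw [← Finsupp.equivMapDomain_eq_mapDomain, Finsupp.equivMapDomain_apply]
  simp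

/-- The sum of the entries of index at most `j`. -/
def partialSum (M : Fin n →₀ ℕ) (j : Fin n) : ℕ := ∑ i ∈ Iic j, M i

lemma partialSum_add (M N : Fin n →₀ ℕ) (j : Fin n) :
    partialSum (M + N) j = partialSum M j + partialSum N j := Finset.sum_add_distrib

lemma partialSum_eq (M : Fin n →₀ ℕ) (j : Fin n) :
    partialSum M j = ∑ i ∈ Iio j, M i + M j := by
  rw [partialSum, ← Finset.Iio_insert, Finset.sum_insert (by simp), add_comm]

lemma partialSum_injective : Function.Injective (partialSum : (Fin n →₀ ℕ) → Fin n → ℕ) := by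
  intro M N h
  ext j
  induction j using WellFoundedLT.induction with
  | ind j ih =>
    have hj := congrFun h j
    rw [partialSum_eq, partialSum_eq, Finset.sum_congr rfl fun i hi => ih i (Finset.mem_Iio.1 hi)]
      at hj
    exact Nat.add_left_cancel hj

/-- `M` is an exponent of `p` all of whose partial sums are minimal. -/
def DomLead (p : MvPolynomial (Fin n) F) (M : Fin n →₀ ℕ) : Prop :=
  coeff M p ≠ 0 ∧ ∀ M' ∈ p.support, ∀ j, partialSum M j ≤ partialSum M' j

lemma DomLead.mul {p q : MvPolynomial (Fin n) F} {M N : Fin n →₀ ℕ} (hp : DomLead p M)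
    (hq : DomLead q N) : DomLead (p * q) (M + N) := by
  constructor
  · rw [coeff_mul, Finset.sum_eq_single (M, N)]
    · exact mul_ne_zero hp.1 hq.1
    · rintro ⟨A, B⟩ hAB hne
      by_contra h
      rw [Finset.HasAntidiagonal.mem_antidiagonal] at hAB
      simp only at hAB
      have hA := hp.2 A (mem_support_iff.2 (left_ne_zero_of_mul h))
      have hB := hq.2 B (mem_support_iff.2 (right_ne_zero_of_mul h))
      have hs : ∀ j, partialSum A j + partialSum B j = partialSum M j + partialSum N j := by
        intro j
        rw [← partialSum_add, hAB, partialSum_add]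
      obtain rfl : A = M := partialSum_injective (funext fun j => by grind)
      exact hne (by rw [add_left_cancel hAB])
    · simp
  · intro M' hM' j
    obtain ⟨A, hA, B, hB, rfl⟩ := Finset.mem_add.1 (support_mul p q hM')
    rw [partialSum_add, partialSum_add]
    exact add_le_add (hp.2 A hA j) (hq.2 B hB j)

lemma DomLead.one : DomLead (1 : MvPolynomial (Fin n) F) 0 := by
  refine ⟨by simp, fun M' _ j => by simp [partialSum]⟩

lemma DomLead.prod {ι : Type*} {s : Finset ι} {p : ι → MvPolynomial (Fin n) F}
    {M : ι → Fin n →₀ ℕ} (h : ∀ i ∈ s, DomLead (p i) (M i)) :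
    DomLead (∏ i ∈ s, p i) (∑ i ∈ s, M i) := by
  classical
  induction s using Finset.induction_on with
  | empty => simpa using DomLead.one
  | insert a s ha ih =>
    rw [Finset.prod_insert ha, Finset.sum_insert ha]
    exact (h a (Finset.mem_insert_self a s)).mul
      (ih fun i hi => h i (Finset.mem_insert_of_mem hi))

lemma DomLead.coeff_eq_zero {p : MvPolynomial (Fin n) F} {M M' : Fin n →₀ ℕ} (hp : DomLead p M)
    {j : Fin n} (hlt : partialSum M' j < partialSum M j) : coeff M' p = 0 := by
  by_contra h
  exact absurd (hp.2 M' (mem_support_iff.2 h) j) (not_le.2 hlt)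

lemma partialSum_lt_of_lex {M M' : Fin n →₀ ℕ} {j : Fin n} (h : ∀ i < j, M' i = M i)
    (hj : M' j < M j) : partialSum M' j < partialSum M j := by
  rw [partialSum_eq, partialSum_eq, Finset.sum_congr rfl fun i hi => h i (Finset.mem_Iio.1 hi)]
  exact Nat.add_lt_add_left hj _

lemma domLead_linear {c : F} (hc : c ≠ 0) {a b : Fin n} (hab : a ≠ b) :
    DomLead (X b - C c * X a) (Finsupp.single (max a b) 1) := by
  have hne : Finsupp.single a 1 ≠ Finsupp.single b 1 := fun h =>
    hab (Finsupp.single_left_injective one_ne_zero h)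
  have hcoeff : ∀ M, coeff M (X b - C c * X a) =
      (if Finsupp.single b 1 = M then 1 else 0) - c * if Finsupp.single a 1 = M then 1 else 0 := by
    intro M
    rw [coeff_sub, coeff_C_mul, coeff_X, coeff_X]
  have hps : ∀ l j : Fin n, partialSum (Finsupp.single l 1) j = if l ≤ j then 1 else 0 := by
    intro l j
    simp [partialSum, Finsupp.single_apply]
  constructor
  · rw [hcoeff]
    rcases max_choice a b with h | h <;> rw [h]
    · simp [hne.symm, hc]
    · simp [hne]
  · intro M hM j
    rw [mem_support_iff, hcoeff] at hM
    have h : M = Finsupp.single a 1 ∨ M = Finsupp.single b 1 := by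
      by_contra! h
      simp [h.1.symm, h.2.symm] at hM
    rcases h with rfl | rfl <;> rw [hps, hps] <;> split_ifs <;> simp_all

lemma domLead_altize_monomial {N : Fin n →₀ ℕ} (hN : StrictMono N) :
    DomLead (altize (monomial N (1 : F))) N := by
  have hcoeff : ∀ M, coeff M (altize (monomial N (1 : F))) =
      ∑ e : Equiv.Perm (Fin n), ((Equiv.Perm.sign e : ℤ) : F) *
        if N = Finsupp.equivFunOnFinite.symm (M ∘ e) then 1 else 0 := by
    intro M
    rw [coeff_altize]
    simp only [coeff_monomial]
  constructor
  · rw [hcoeff, Finset.sum_eq_single 1]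
    · have : N = Finsupp.equivFunOnFinite.symm (N ∘ (1 : Equiv.Perm (Fin n))) := by ext; simp
      rw [if_pos this]
      simp
    · intro e _ he
      rw [if_neg, mul_zero]
      intro h
      apply he
      ext1 i
      exact hN.injective (DFunLike.congr_fun h i).symm
    · simp
  · intro M hM j
    rw [mem_support_iff, hcoeff] at hM
    obtain ⟨e, -, he⟩ := Finset.exists_ne_zero_of_sum_ne_zero hM
    have h : N = Finsupp.equivFunOnFinite.symm (M ∘ e) := by
      by_contra h
      simp [h] at he
    have hM' : ∀ i, M i = N (e.symm i) := by
      intro i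
      rw [h]; simp
    have hanti : Antivary N fun i => if i ≤ j then 1 else 0 := by
      refine hN.monotone.antivary fun a b hab => ?_
      split_ifs <;> omega
    have := hanti.sum_mul_le_sum_comp_perm_mul (σ := e.symm)
    have hf : ({i | i ≤ j} : Finset (Fin n)) = Iic j := by ext; simp
    simpa [partialSum, hM', ← Finset.sum_filter, hf] using this

end Dominance

section Blocks

variable {m : ℕ}

/-- The product of all `X b - t X a` with `a ≠ b`. -/
noncomputable def deltaPoly (m : ℕ) : MvPolynomial (Fin m) K :=
  ∏ x ∈ (univ : Finset (Fin m)).offDiag, (X x.2 - C RatFunc.X * X x.1)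

lemma rename_deltaPoly (e : Equiv.Perm (Fin m)) : rename e (deltaPoly m) = deltaPoly m := by
  simp only [deltaPoly, map_prod, map_sub, map_mul, rename_X, rename_C]
  refine Finset.prod_equiv (e.prodCongr e) (fun x => ?_) fun x _ => rfl
  simp [Finset.mem_offDiag]

lemma map_deltaPoly_eq_zero {A : Type*} [CommRing A] [Algebra K A]
    (φ : MvPolynomial (Fin m) K →ₐ[K] A) {a b : Fin m} (hab : a ≠ b)
    (h : φ (X b) = algebraMap K A RatFunc.X * φ (X a)) : φ (deltaPoly m) = 0 := by
  rw [deltaPoly, map_prod]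
  refine Finset.prod_eq_zero (i := (a, b)) (by simpa using hab) ?_
  rw [map_sub, map_mul, h, ← algebraMap_eq, AlgHom.commutes, sub_self]

lemma domLead_deltaPoly :
    DomLead (deltaPoly m) (Finsupp.equivFunOnFinite.symm fun i : Fin m => 2 * (i : ℕ)) := by
  have h : (Finsupp.equivFunOnFinite.symm fun i : Fin m => 2 * (i : ℕ)) =
      ∑ x ∈ (univ : Finset (Fin m)).offDiag, Finsupp.single (max x.1 x.2) 1 := by
    ext i
    have hs : ({x ∈ (univ : Finset (Fin m)).offDiag | max x.1 x.2 = i} : Finset _) =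
        (Iio i ×ˢ {i}) ∪ ({i} ×ˢ Iio i) := by
      ext ⟨a, b⟩
      simp only [Finset.mem_filter, Finset.mem_offDiag, Finset.mem_union, Finset.mem_product,
        Finset.mem_Iio, Finset.mem_singleton, Finset.mem_univ, true_and]
      grind
    have hd : Disjoint (Iio i ×ˢ {i}) ({i} ×ˢ Iio i) := by
      rw [Finset.disjoint_left]
      rintro ⟨a, b⟩ h1 h2
      simp only [Finset.mem_product, Finset.mem_Iio, Finset.mem_singleton] at h1 h2
      exact absurd h1.1 (by rw [h2.1]; exact lt_irrefl i)
    rw [Finsupp.finsetSum_apply]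
    simp only [Finsupp.single_apply, Finset.sum_boole, hs, Finset.card_union_of_disjoint hd,
      Finset.card_product, Fin.card_Iio, Finset.card_singleton]
    simp [two_mul]
  rw [h]
  exact DomLead.prod fun x hx => domLead_linear RatFunc.X_ne_zero (Finset.mem_offDiag.1 hx).2.2

lemma isHomogeneous_deltaPoly : ∃ e, (deltaPoly m).IsHomogeneous e :=
  ⟨_, IsHomogeneous.prod _ _ (fun _ => 1) fun _ _ =>
    (isHomogeneous_X _ _).sub (isHomogeneous_C_mul_X _ _)⟩

lemma isHomogeneous_altize {n : ℕ} {F : Type*} [Field F] {p : MvPolynomial (Fin n) F} {e : ℕ}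
    (hp : p.IsHomogeneous e) : (altize p).IsHomogeneous e := by
  refine IsHomogeneous.sum _ _ _ fun s _ => ?_
  rw [← map_intCast (C : F →+* MvPolynomial (Fin n) F)]
  exact (hp.rename_isHomogeneous).C_mul _

/-- A multiple of `deltaPoly` with prescribed dominant exponent. -/
lemma exists_domLead_block (F : Fin m →₀ ℕ) (hF : ∀ i j, i < j → F i + 3 ≤ F j) :
    ∃ q, IsAlternating (deltaPoly m * q) ∧ (deltaPoly m * q).IsHomogeneous F.degree ∧
      DomLead (deltaPoly m * q) F := by
  have hgap : ∀ i j : Fin m, i < j → F i + 3 * (j - i : ℕ) ≤ F j := by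
    intro i j
    obtain ⟨j, hj⟩ := j
    induction j with
    | zero => intro h; exact absurd h (by simp [Fin.lt_def])
    | succ j ih =>
      intro h
      rw [Fin.lt_def] at h
      have h1 := hF ⟨j, by omega⟩ ⟨j + 1, hj⟩ (by simp [Fin.lt_def])
      rcases Nat.lt_or_ge i j with h2 | h2
      · have := ih (by omega) h2
        simp only at this h ⊢
        omega
      · have hi : i = ⟨j, by omega⟩ := Fin.ext (by simp only at h ⊢; omega)
        rw [← hi] at h1
        simp only at h ⊢
        omega
  set N : Fin m →₀ ℕ := Finsupp.equivFunOnFinite.symm fun i => F i - 2 * (i : ℕ) with hN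
  have hge : ∀ i : Fin m, 2 * (i : ℕ) ≤ F i := by
    intro i
    rcases Nat.eq_zero_or_pos (i : ℕ) with h | h
    · omega
    · have := hgap ⟨0, by omega⟩ i h
      simp only at this
      omega
  have hmono : StrictMono N := by
    intro i j hij
    have h1 := hgap i j hij
    have h2 := hge i
    rw [Fin.lt_def] at hij
    simp only [hN, Finsupp.equivFunOnFinite_symm_apply_apply]
    omega
  have hlead : DomLead (deltaPoly m * altize (monomial N 1)) F := by
    have h := domLead_deltaPoly.mul (domLead_altize_monomial (F := K) hmono)
    convert h using 1
    ext i
    have := hge i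
    simp only [hN, Finsupp.add_apply, Finsupp.equivFunOnFinite_symm_apply_apply]
    omega
  refine ⟨altize (monomial N 1), fun e => ?_, ?_, hlead⟩
  · rw [map_mul, rename_deltaPoly, isAlternating_altize, mul_left_comm]
  · obtain ⟨e, he⟩ := isHomogeneous_deltaPoly (m := m)
    have h := he.mul (isHomogeneous_altize (isHomogeneous_monomial (1 : K) (rfl : N.degree = _)))
    have hdeg : F.degree = e + N.degree := by
      by_contra hne
      exact hlead.1 (h.coeff_eq_zero hne)
    rwa [hdeg]

end Blocks

section Wedge

variable {m : ℕ} {F : Type*} [Field F]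

/-- The exponent with the entry of index `q` removed. -/
noncomputable def removeAt (E : Fin (m + 1) →₀ ℕ) (q : Fin (m + 1)) : Fin m →₀ ℕ :=
  Finsupp.equivFunOnFinite.symm fun i => E (q.succAbove i)

@[simp] lemma removeAt_apply (E : Fin (m + 1) →₀ ℕ) (q : Fin (m + 1)) (i : Fin m) :
    removeAt E q i = E (q.succAbove i) := rfl

lemma coeff_X_zero_pow_mul_rename (c : ℕ) (B : MvPolynomial (Fin m) F) (M : Fin (m + 1) →₀ ℕ) :
    coeff M (X 0 ^ c * rename Fin.succ B) = if M 0 = c then coeff (removeAt M 0) B else 0 := by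
  have h0 : finSuccEquiv F m (X 0 ^ c * rename Fin.succ B) = Polynomial.X ^ c * Polynomial.C B := by
    have h : finSuccEquiv F m (rename Fin.succ B) = Polynomial.C B := by
      induction B using MvPolynomial.induction_on with
      | C a =>
        rw [rename_C, ← algebraMap_eq, AlgEquiv.commutes]
        rfl
      | add p q hp hq => rw [map_add, map_add, hp, hq, map_add]
      | mul_X p i hp => rw [map_mul, map_mul, hp, rename_X, finSuccEquiv_X_succ, map_mul]
    rw [map_mul, map_pow, finSuccEquiv_X_zero, h]
  have h1 : M = (removeAt M 0).cons (M 0) := by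
    ext i
    refine Fin.cases ?_ (fun i => ?_) i <;> simp
  conv_lhs => rw [h1, ← finSuccEquiv_coeff_coeff, h0, mul_comm, Polynomial.coeff_C_mul_X_pow]
  split_ifs <;> simp

/-- The antisymmetrization of `X_0 ^ c` times `B` in the remaining variables. -/
noncomputable def wedge (c : ℕ) (B : MvPolynomial (Fin m) F) : MvPolynomial (Fin (m + 1)) F :=
  altize (X 0 ^ c * rename Fin.succ B)

lemma rename_X_zero_pow_mul_rename {B : MvPolynomial (Fin m) F} (hB : IsAlternating B) (c : ℕ)
    {e : Equiv.Perm (Fin (m + 1))} (he : e 0 = 0) :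
    rename e (X 0 ^ c * rename Fin.succ B) =
      ((Equiv.Perm.sign e : ℤ) : MvPolynomial (Fin (m + 1)) F) * (X 0 ^ c * rename Fin.succ B) := by
  obtain ⟨⟨p, s⟩, rfl⟩ := Equiv.Perm.decomposeFin.symm.surjective e
  rw [Equiv.Perm.decomposeFin_symm_apply_zero] at he
  subst he
  have h : (Equiv.Perm.decomposeFin.symm (0, s) : Fin (m + 1) → Fin (m + 1)) ∘ Fin.succ =
      Fin.succ ∘ s := by
    funext i
    simp
  rw [map_mul, map_pow, rename_X, rename_rename, h, ← rename_rename, hB s]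
  simp only [Equiv.Perm.decomposeFin_symm_apply_zero, map_mul, map_intCast,
    Equiv.Perm.decomposeFin.symm_sign, if_true, one_mul]
  ring

lemma coeff_wedge_term {B : MvPolynomial (Fin m) F} (hB : IsAlternating B) (c : ℕ)
    (E : Fin (m + 1) →₀ ℕ) (e : Equiv.Perm (Fin (m + 1))) :
    ((Equiv.Perm.sign e : ℤ) : F) *
        coeff (Finsupp.equivFunOnFinite.symm (E ∘ e)) (X 0 ^ c * rename Fin.succ B) =
      if E (e 0) = c then
        ((Equiv.Perm.sign (e 0).cycleRange : ℤ) : F) * coeff (removeAt E (e 0)) B else 0 := by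
  set P : MvPolynomial (Fin (m + 1)) F := X 0 ^ c * rename Fin.succ B with hP
  set s := (e 0).cycleRange.symm with hs
  have hs0 : s 0 = e 0 := Fin.cycleRange_symm_zero _
  set r := s⁻¹ * e with hr
  have hr0 : r 0 = 0 := by
    rw [hr, Equiv.Perm.mul_apply, ← hs0]
    exact s.symm_apply_apply 0
  have he : e = s * r := by rw [hr, mul_inv_cancel_left]
  have h1 : coeff (Finsupp.equivFunOnFinite.symm (E ∘ e)) P = ((Equiv.Perm.sign r : ℤ) : F) *
      coeff (Finsupp.equivFunOnFinite.symm (E ∘ s)) P := by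
    have h := congrArg (coeff (Finsupp.equivFunOnFinite.symm (E ∘ s)))
      (rename_X_zero_pow_mul_rename hB c hr0)
    rw [← map_intCast (C : F →+* MvPolynomial (Fin (m + 1)) F), coeff_C_mul,
      coeff_rename_perm] at h
    rw [← h]
    congr 1
    ext i
    rw [← Finsupp.equivMapDomain_eq_mapDomain, Finsupp.equivMapDomain_apply, he]
    simp
  have h2 : removeAt (Finsupp.equivFunOnFinite.symm (E ∘ s)) 0 = removeAt E (e 0) := by
    ext i
    simp [hs, Fin.cycleRange_symm_succ]
  have h3 : ((Equiv.Perm.sign e : ℤ) : F) * ((Equiv.Perm.sign r : ℤ) : F) =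
      ((Equiv.Perm.sign (e 0).cycleRange : ℤ) : F) := by
    rw [← Int.cast_mul, ← Units.val_mul]
    congr 2
    rw [he, Equiv.Perm.sign_mul, mul_assoc, Int.units_mul_self, mul_one, ← he, hs,
      Equiv.Perm.sign_symm]
  rw [h1, ← mul_assoc, h3, hP, coeff_X_zero_pow_mul_rename, h2, mul_ite, mul_zero]
  simp [hs0]

lemma coeff_wedge_eq_zero {B : MvPolynomial (Fin m) F} (hB : IsAlternating B) {c : ℕ}
    {E : Fin (m + 1) →₀ ℕ} (h : ∀ q, E q = c → coeff (removeAt E q) B = 0) :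
    coeff E (wedge c B) = 0 := by
  rw [wedge, coeff_altize]
  refine Finset.sum_eq_zero fun e _ => ?_
  rw [coeff_wedge_term hB]
  split_ifs with he
  · rw [h _ he, mul_zero]
  · rfl

lemma coeff_wedge_ne_zero [CharZero F] {B : MvPolynomial (Fin m) F} (hB : IsAlternating B)
    {E : Fin (m + 1) →₀ ℕ} (hE : Function.Injective E) {q : Fin (m + 1)}
    (h : coeff (removeAt E q) B ≠ 0) : coeff E (wedge (E q) B) ≠ 0 := by
  rw [wedge, coeff_altize]
  simp only [coeff_wedge_term hB]
  have h1 : ∀ e : Equiv.Perm (Fin (m + 1)), (if E (e 0) = E q then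
      ((Equiv.Perm.sign (e 0).cycleRange : ℤ) : F) * coeff (removeAt E (e 0)) B else 0) =
      if e 0 = q then ((Equiv.Perm.sign q.cycleRange : ℤ) : F) * coeff (removeAt E q) B else 0 := by
    intro e
    by_cases he : e 0 = q
    · rw [he, if_pos rfl, if_pos rfl]
    · rw [if_neg he, if_neg fun hh => he (hE hh)]
  simp only [h1]
  rw [← Finset.sum_filter, Finset.sum_const, nsmul_eq_mul]
  refine mul_ne_zero (Nat.cast_ne_zero.2 (Finset.card_ne_zero.2 ⟨Equiv.swap 0 q, by simp⟩))
    (mul_ne_zero ?_ h)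
  rcases Int.units_eq_one_or (Equiv.Perm.sign q.cycleRange) with h | h <;> simp [h]

lemma isHomogeneous_wedge {B : MvPolynomial (Fin m) F} {e : ℕ} (hB : B.IsHomogeneous e) (c : ℕ) :
    (wedge c B).IsHomogeneous (c + e) :=
  isHomogeneous_altize ((isHomogeneous_X_pow 0 c).mul hB.rename_isHomogeneous)

lemma pairSubst_wedge_deltaPoly_mul (k c : ℕ) (q : MvPolynomial (Fin (k + 3)) K) :
    pairSubst k (wedge c (deltaPoly (k + 3) * q)) = 0 := by
  rw [wedge, altize, map_sum]
  refine Finset.sum_eq_zero fun e _ => ?_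
  have key : pairSubst k (rename e (rename Fin.succ (deltaPoly (k + 3)))) = 0 := by
    have h : ∀ a b : Fin (k + 4), a ≠ b → e 0 ≠ a → e 0 ≠ b →
        pairSubst k (X b) = C RatFunc.X * pairSubst k (X a) →
        pairSubst k (rename e (rename Fin.succ (deltaPoly (k + 3)))) = 0 := by
      intro a b hab ha hb h
      have hsucc : ∀ x, e 0 ≠ x → ∃ y : Fin (k + 3), e y.succ = x := by
        intro x hx
        obtain ⟨y, hy⟩ := Fin.exists_succ_eq.2 (show e.symm x ≠ 0 by
          rw [ne_eq, Equiv.symm_apply_eq]; exact hx.symm)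
        exact ⟨y, by rw [hy, Equiv.apply_symm_apply]⟩
      obtain ⟨a, rfl⟩ := hsucc a ha
      obtain ⟨b, rfl⟩ := hsucc b hb
      refine map_deltaPoly_eq_zero ((pairSubst k).comp ((rename e).comp (rename Fin.succ)))
        (a := a) (b := b) (fun hh => hab (by rw [hh])) ?_
      simpa using h
    have h01 : pairSubst k (X 1) = C RatFunc.X * pairSubst k (X 0) := by
      simp only [pairSubst, aeval_X]
      have e1 : pairIdx k 1 = 0 := rfl
      have e0 : pairIdx k 0 = 0 := rfl
      simp [e1, e0, pairCoef]
    have h23 : pairSubst k (X 3) = C RatFunc.X * pairSubst k (X 2) := by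
      simp only [pairSubst, aeval_X]
      have e1 : pairIdx k 3 = 2 := rfl
      have e0 : pairIdx k 2 = 2 := rfl
      have c1 : pairCoef k 3 = RatFunc.X := if_pos (Or.inr rfl)
      have c0 : pairCoef k 2 = 1 := if_neg (show ¬ ((2 : ℕ) = 1 ∨ (2 : ℕ) = 3) by omega)
      simp [e1, e0, c1, c0]
    by_cases he : e 0 = 0 ∨ e 0 = 1
    · refine h 2 3 (fun hh => ?_) (fun hh => ?_) (fun hh => ?_) h23
      · exact absurd (congrArg Fin.val hh) (show (2 : ℕ) ≠ 3 by omega)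
      · rcases he with he | he <;> rw [he] at hh
        · exact absurd (congrArg Fin.val hh) (show (0 : ℕ) ≠ 2 by omega)
        · exact absurd (congrArg Fin.val hh) (show (1 : ℕ) ≠ 2 by omega)
      · rcases he with he | he <;> rw [he] at hh
        · exact absurd (congrArg Fin.val hh) (show (0 : ℕ) ≠ 3 by omega)
        · exact absurd (congrArg Fin.val hh) (show (1 : ℕ) ≠ 3 by omega)
    · exact h 0 1 (by simp) (fun hh => he (Or.inl hh)) (fun hh => he (Or.inr hh)) h01
  simp only [map_mul, key, zero_mul, mul_zero]

end Wedge

section Removal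

variable {m : ℕ}

lemma removeAt_of_lt (E : Fin (m + 1) →₀ ℕ) {q : Fin (m + 1)} {i : Fin m} (h : (i : ℕ) < q) :
    removeAt E q i = E i.castSucc := by
  rw [removeAt_apply, Fin.succAbove_of_castSucc_lt _ _ h]

lemma removeAt_of_le (E : Fin (m + 1) →₀ ℕ) {q : Fin (m + 1)} {i : Fin m} (h : (q : ℕ) ≤ i) :
    removeAt E q i = E i.succ := by
  rw [removeAt_apply, Fin.succAbove_of_le_castSucc _ _ h]

lemma strictMono_removeAt {E : Fin (m + 1) →₀ ℕ} (hE : StrictMono E) (q : Fin (m + 1)) :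
    StrictMono (removeAt E q) :=
  fun _ _ h => hE (Fin.strictMono_succAbove q h)

/-- Removing a common value from two strictly increasing sequences preserves their
lexicographic order. -/
lemma removeAt_lex {E E' : Fin (m + 1) →₀ ℕ} (hE : StrictMono E) (hE' : StrictMono E')
    {p : Fin (m + 1)} (hp : ∀ i < p, E' i = E i) (hlt : E' p < E p) {q q' : Fin (m + 1)}
    (hq : E' q' = E q) :
    ∃ r : Fin m, (∀ i < r, removeAt E' q' i = removeAt E q i) ∧
      removeAt E' q' r < removeAt E q r := by
  rcases lt_trichotomy q' p with h | rfl | h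
  · obtain rfl : q' = q := hE.injective ((hp q' h).symm.trans hq)
    obtain ⟨r, rfl⟩ := Fin.exists_succ_eq.2 (Fin.ne_zero_of_lt h)
    have hqr : (q' : ℕ) ≤ r := Nat.lt_succ_iff.1 h
    refine ⟨r, fun i hi => ?_, ?_⟩
    · have hi' : (i : ℕ) < r := hi
      rcases lt_or_ge (i : ℕ) q' with h1 | h1
      · rw [removeAt_of_lt _ h1, removeAt_of_lt _ h1]
        exact hp _ (Fin.lt_def.2 (by simp; omega))
      · rw [removeAt_of_le _ h1, removeAt_of_le _ h1]
        exact hp _ (Fin.lt_def.2 (by simpa))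
    · rwa [removeAt_of_le _ hqr, removeAt_of_le _ hqr]
  · rw [hq] at hlt
    have h := hE.lt_iff_lt.1 hlt
    exact absurd (hE'.injective ((hp q h).trans hq.symm)) h.ne
  · have hpm : (p : ℕ) < m := by
      have := q'.isLt
      rw [Fin.lt_def] at h
      omega
    have hqp : p ≤ q := by
      by_contra! hlt'
      have h1 := hp q hlt'
      rw [← hq] at h1
      exact absurd (hE'.injective h1) (by omega)
    refine ⟨⟨p, hpm⟩, fun i hi => ?_, ?_⟩
    · have hi' : (i : ℕ) < p := hi
      rw [removeAt_of_lt _ (hi'.trans h), removeAt_of_lt _ (lt_of_lt_of_le hi' hqp)]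
      exact hp _ hi'
    · rw [removeAt_of_lt _ h]
      rcases eq_or_lt_of_le hqp with rfl | hlt'
      · rw [removeAt_of_le _ le_rfl]
        exact hlt.trans (hE (Fin.lt_def.2 (by simp)))
      · rw [removeAt_of_lt _ hlt']
        exact hlt

/-- Alternating polynomials in the kernel of the substitution with prescribed
lexicographically smallest strictly increasing exponent. -/
def IsLeading (k : ℕ) (a : MvPolynomial (Fin (k + 4)) K) (E : Fin (k + 4) →₀ ℕ) : Prop :=
  IsAlternating a ∧ pairSubst k a = 0 ∧ a.IsHomogeneous E.degree ∧ coeff E a ≠ 0 ∧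
    ∀ E' : Fin (k + 4) →₀ ℕ, StrictMono E' → toLex E' < toLex E → coeff E' a = 0

lemma degree_removeAt (E : Fin (m + 1) →₀ ℕ) (q : Fin (m + 1)) :
    E q + (removeAt E q).degree = E.degree := by
  rw [Finsupp.degree_eq_sum, Finsupp.degree_eq_sum, Fin.sum_univ_succAbove _ q]
  rfl

lemma exists_isLeading_of_gaps {k : ℕ} {E : Fin (k + 4) →₀ ℕ} (hE : StrictMono E)
    (q : Fin (k + 4)) (hF : ∀ i j, i < j → removeAt E q i + 3 ≤ removeAt E q j) :
    ∃ a, IsLeading k a E := by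
  obtain ⟨B, hB, hdeg, hlead⟩ := exists_domLead_block _ hF
  refine ⟨wedge (E q) (deltaPoly (k + 3) * B), isAlternating_altize _,
    pairSubst_wedge_deltaPoly_mul _ _ _, ?_, coeff_wedge_ne_zero hB hE.injective hlead.1, ?_⟩
  · rw [← degree_removeAt E q]
    exact isHomogeneous_wedge hdeg _
  · intro E' hE' hlt
    obtain ⟨p, hp, hlt⟩ := Finsupp.Lex.lt_iff.1 hlt
    refine coeff_wedge_eq_zero hB fun q' hq' => ?_
    obtain ⟨r, hr, hr'⟩ := removeAt_lex hE hE' hp hlt hq'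
    exact hlead.coeff_eq_zero (partialSum_lt_of_lex hr hr')

lemma coeff_ne_zero_of_domLead {Q : MvPolynomial (Fin m) K} (hB : IsAlternating (deltaPoly m * Q))
    {F F1 : Fin m →₀ ℕ} (hlead : DomLead (deltaPoly m * Q) F) {a b : Fin m}
    (hab : (b : ℕ) = a + 1) {j : ℕ} (ha : F a = j) (hb : F b = j + 3) (ha1 : F1 a = j + 1)
    (hb1 : F1 b = j + 2) (h1 : ∀ i, i ≠ a → i ≠ b → F1 i = F i) :
    coeff F1 (deltaPoly m * Q) ≠ 0 := by
  intro hzero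
  set B := deltaPoly m * Q
  have hne : a ≠ b := fun h => by rw [h] at hab; omega
  let sw : (Fin m →₀ ℕ) → (Fin m →₀ ℕ) := fun M =>
    Finsupp.equivFunOnFinite.symm (M ∘ Equiv.swap a b)
  have swa : ∀ M, sw M a = M b := fun M => by simp [sw]
  have swb : ∀ M, sw M b = M a := fun M => by simp [sw]
  have swo : ∀ M i, i ≠ a → i ≠ b → sw M i = M i := fun M i hi hi' => by
    simp [sw, Equiv.swap_apply_of_ne_of_ne hi hi']
  have hsw : ∀ M, coeff (sw M) B = - coeff M B := fun M => by
    rw [hB.coeff_comp_perm, Equiv.Perm.sign_swap hne]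
    simp
  have hext : ∀ M N : Fin m →₀ ℕ, M a = N a → M b = N b →
      (∀ i, i ≠ a → i ≠ b → M i = N i) → M = N := by
    intro M N h2 h3 h4
    ext i
    by_cases hia : i = a
    · rw [hia, h2]
    · by_cases hib : i = b
      · rw [hib, h3]
      · exact h4 i hia hib
  let r : Fin m → Fin m := fun i => if i = b then a else i
  let c : Fin m → K := fun i => if i = b then RatFunc.X else 1
  have hmap : ∀ M N : Fin m →₀ ℕ, M.mapDomain r = N.mapDomain r ↔
      M a + M b = N a + N b ∧ ∀ i, i ≠ a → i ≠ b → M i = N i := by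
    have happ : ∀ (M : Fin m →₀ ℕ) i, M.mapDomain r i = ∑ l with r l = i, M l := by
      intro M i
      rw [Finsupp.mapDomain, Finsupp.sum_fintype _ _ (by simp), Finsupp.finsetSum_apply,
        Finset.sum_filter]
      simp [Finsupp.single_apply]
    have hra : ({l | r l = a} : Finset (Fin m)) = {a, b} := by
      ext l
      simp only [r, Finset.mem_filter, Finset.mem_univ, true_and, Finset.mem_insert,
        Finset.mem_singleton]
      split_ifs with h <;> simp [h]
    have hrb : ({l | r l = b} : Finset (Fin m)) = ∅ := by
      ext l
      simp only [r, Finset.mem_filter, Finset.mem_univ, true_and, Finset.notMem_empty, iff_false]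
      split_ifs with h
      · exact hne
      · exact h
    have hro : ∀ i, i ≠ a → i ≠ b → ({l | r l = i} : Finset (Fin m)) = {i} := by
      intro i hi hi'
      ext l
      simp only [r, Finset.mem_filter, Finset.mem_univ, true_and, Finset.mem_singleton]
      split_ifs with h
      · exact ⟨fun hh => absurd hh.symm hi, fun hh => absurd (hh.symm.trans h) hi'⟩
      · rfl
    intro M N
    constructor
    · intro h
      refine ⟨?_, fun i hi hi' => ?_⟩
      · have := DFunLike.congr_fun h a
        rwa [happ, happ, hra, Finset.sum_pair hne, Finset.sum_pair hne] at this
      · have := DFunLike.congr_fun h i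
        rwa [happ, happ, hro i hi hi', Finset.sum_singleton, Finset.sum_singleton] at this
    · rintro ⟨h2, h3⟩
      ext i
      rw [happ, happ]
      by_cases hia : i = a
      · rw [hia, hra, Finset.sum_pair hne, Finset.sum_pair hne, h2]
      · by_cases hib : i = b
        · rw [hib, hrb, Finset.sum_empty, Finset.sum_empty]
        · rw [hro i hia hib, Finset.sum_singleton, Finset.sum_singleton, h3 i hia hib]
  have hprod : ∀ M : Fin m →₀ ℕ, ∏ i, c i ^ M i = RatFunc.X ^ M b := by
    intro M
    rw [Finset.prod_eq_single b]
    · simp [c]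
    · intro i _ hi
      simp [c, hi]
    · simp
  -- entries at `a` and `b` of exponents with the same image as `F`
  have hge : ∀ M ∈ B.support, M a + M b = F a + F b → (∀ i, i ≠ a → i ≠ b → M i = F i) →
      j ≤ M a := by
    intro M hM _ ho
    have h2 := hlead.2 M hM a
    have hlt : ∀ i ∈ Iio a, M i = F i := by
      intro i hi
      have hi' := Finset.mem_Iio.1 hi
      exact ho i hi'.ne fun h => by rw [Fin.lt_def, h] at hi'; omega
    rw [partialSum_eq, partialSum_eq, Finset.sum_congr rfl hlt, ha] at h2
    exact Nat.le_of_add_le_add_left h2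
  have hfilter : ({M ∈ B.support | M.mapDomain r = F.mapDomain r} : Finset _) = {F, sw F} := by
    ext M
    rw [Finset.mem_filter, hmap, Finset.mem_insert, Finset.mem_singleton]
    constructor
    · rintro ⟨hM, hs, ho⟩
      have h2 := hge M hM hs ho
      have h3 : j ≤ M b := by
        rw [← swa M]
        refine hge (sw M) ?_ ?_ fun i hi hi' => (swo M i hi hi').trans (ho i hi hi')
        · rw [mem_support_iff, hsw, neg_ne_zero]
          exact mem_support_iff.1 hM
        · rw [swa, swb, add_comm, hs]
      obtain h4 | h4 | h4 | h4 : M a = j ∨ M a = j + 1 ∨ M a = j + 2 ∨ M a = j + 3 := by omega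
      · exact Or.inl (hext _ _ (by omega) (by omega) ho)
      · refine absurd hzero ?_
        rw [← hext M F1 (by omega) (by omega) fun i hi hi' => (ho i hi hi').trans (h1 i hi hi').symm]
        exact mem_support_iff.1 hM
      · refine absurd hzero (neg_ne_zero.1 ?_)
        rw [← hsw, ← hext M (sw F1) (by rw [swa]; omega) (by rw [swb]; omega)
          fun i hi hi' => (ho i hi hi').trans ((swo F1 i hi hi').trans (h1 i hi hi')).symm]
        exact mem_support_iff.1 hM
      · exact Or.inr (hext _ _ (by rw [swa]; omega) (by rw [swb]; omega)
          fun i hi hi' => (ho i hi hi').trans (swo F i hi hi').symm)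
    · rintro (rfl | rfl)
      · exact ⟨mem_support_iff.2 hlead.1, rfl, fun _ _ _ => rfl⟩
      · refine ⟨?_, by rw [swa, swb, add_comm], fun i hi hi' => swo F i hi hi'⟩
        rw [mem_support_iff, hsw, neg_ne_zero]
        exact hlead.1
  have hvan : aeval (fun i => C (c i) * (X (r i) : MvPolynomial (Fin m) K)) B = 0 := by
    rw [map_mul, map_deltaPoly_eq_zero _ hne, zero_mul]
    simp [c, r, hne]
  have hcoeff := coeff_aeval_C_mul_X c r B (F.mapDomain r)
  have hFsw : F ≠ sw F := fun h => by
    have := DFunLike.congr_fun h a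
    rw [swa] at this
    omega
  rw [hvan, hfilter, Finset.sum_pair hFsw, hprod, hprod, hsw, swb, ha, hb, coeff_zero, neg_mul,
    ← sub_eq_add_neg, ← mul_sub] at hcoeff
  rcases mul_eq_zero.1 hcoeff.symm with h | h
  · exact hlead.1 h
  · have := ratFunc_X_pow_injective (sub_eq_zero.1 h)
    omega

end Removal

section Existence

lemma gaps_of_consecutive {g : ℕ → ℕ} {N : ℕ} (h : ∀ i, i + 1 < N → g i + 3 ≤ g (i + 1))
    {i j : ℕ} (hij : i < j) (hj : j < N) : g i + 3 ≤ g j := by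
  induction j with
  | zero => omega
  | succ j ih =>
    have h1 := h j hj
    rcases Nat.lt_succ_iff_lt_or_eq.1 hij with h2 | rfl
    · have := ih h2 (by omega)
      omega
    · exact h1

/-- The exponent given by the first `N` values of a sequence. -/
noncomputable def expOf (N : ℕ) (e : ℕ → ℕ) : Fin N →₀ ℕ :=
  Finsupp.equivFunOnFinite.symm fun i => e i

@[simp] lemma expOf_apply (N : ℕ) (e : ℕ → ℕ) (i : Fin N) : expOf N e i = e i := rfl

lemma removeAt_expOf {m : ℕ} (e : ℕ → ℕ) (q : Fin (m + 1)) (i : Fin m) :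
    removeAt (expOf (m + 1) e) q i = if (i : ℕ) < q then e i else e (i + 1) := by
  split_ifs with h
  · rw [removeAt_of_lt _ h]; simp
  · rw [removeAt_of_le _ (not_lt.1 h)]; simp

lemma exists_isLeading_of_consecutive {k : ℕ} {e : ℕ → ℕ} (hE : StrictMono (expOf (k + 4) e))
    {q : ℕ} (hq : q + 2 < k + 4) (h1 : e (q + 1) = e q + 1) (h2 : e (q + 2) = e q + 2)
    (hlow : ∀ i < q, e i + 3 ≤ e (i + 1))
    (hhigh : ∀ i, q + 3 ≤ i → i + 1 < k + 4 → e i + 3 ≤ e (i + 1))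
    (hnext : q + 3 < k + 4 → e q + 6 ≤ e (q + 3)) :
    ∃ a, IsLeading k a (expOf (k + 4) e) := by
  set g : ℕ → ℕ := fun i => if i ≤ q then e i else if i = q + 1 then e q + 3 else e (i + 1) with hg
  have hgap : ∀ i, i + 1 < k + 3 → g i + 3 ≤ g (i + 1) := by
    intro i hi
    rcases lt_trichotomy i q with h | rfl | h
    · have := hlow i h
      simp only [hg]
      rw [if_pos (by omega), if_pos (by omega)]
      exact this
    · simp [hg]
    · rcases Nat.eq_or_lt_of_le h with rfl | h
      · have := hnext (by omega)
        have h3 : e (q + 1 + 1 + 1) = e (q + 3) := rfl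
        simp only [hg, Nat.succ_eq_add_one]
        split_ifs <;> omega
      · have := hhigh (i + 1) (by omega) (by omega)
        simp only [hg]
        rw [if_neg (by omega), if_neg (by omega), if_neg (by omega), if_neg (by omega)]
        exact this
  set F := expOf (k + 3) g with hF
  set E := expOf (k + 4) e
  obtain ⟨Q, hB, hdeg, hlead⟩ := exists_domLead_block F fun i j hij =>
    gaps_of_consecutive hgap hij j.isLt
  set q0 : Fin (k + 4) := ⟨q, by omega⟩
  set a : Fin (k + 3) := ⟨q, by omega⟩ with ha
  set b : Fin (k + 3) := ⟨q + 1, by omega⟩ with hb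
  set F1 := removeAt E q0
  have hFa : F a = e q := by simp [hF, hg, ha]
  have hFb : F b = e q + 3 := by simp [hF, hg, hb]
  have hF1a : F1 a = e q + 1 := (removeAt_expOf e q0 a).trans (by simp [ha, q0, h1])
  have hF1b : F1 b = e q + 2 := (removeAt_expOf e q0 b).trans (by simp [hb, q0, h2])
  have hF1 : ∀ i, i ≠ a → i ≠ b → F1 i = F i := by
    intro i hia hib
    have hia' : (i : ℕ) ≠ q := fun h => hia (Fin.ext h)
    have hib' : (i : ℕ) ≠ q + 1 := fun h => hib (Fin.ext h)
    refine (removeAt_expOf e q0 i).trans ?_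
    simp only [hF, hg, expOf_apply, q0]
    split_ifs <;> first | rfl | omega
  have hsum : F1 + Finsupp.single b 1 = F + Finsupp.single a 1 := by
    have hne : a ≠ b := by simp [ha, hb]
    ext i
    simp only [Finsupp.add_apply]
    by_cases hia : i = a
    · rw [hia, hF1a, hFa]; simp [hne]
    · by_cases hib : i = b
      · rw [hib, hF1b, hFb]; simp [hne]
      · simp [hF1 i hia hib, hia, hib]
  have hpartial : ∀ p, b ≤ p → partialSum F1 p = partialSum F p := by
    intro p hp
    have hap : a ≤ p := le_trans (by simp [ha, hb, Fin.le_def]) hp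
    have h := congrArg (partialSum · p) hsum
    simp only [partialSum_add] at h
    have hs : ∀ l ≤ p, partialSum (Finsupp.single l 1) p = 1 := by
      intro l hl
      simp [partialSum, Finsupp.single_apply, hl]
    rw [hs b hp, hs a hap] at h
    omega
  refine ⟨wedge (E q0) (deltaPoly (k + 3) * Q), isAlternating_altize _,
    pairSubst_wedge_deltaPoly_mul _ _ _, ?_, coeff_wedge_ne_zero hB hE.injective
      (coeff_ne_zero_of_domLead hB hlead (by simp [ha, hb]) hFa hFb hF1a hF1b hF1), ?_⟩
  · have h3 : F.degree = F1.degree := by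
      have h := congrArg Finsupp.degree hsum
      simp only [map_add, Finsupp.degree_single] at h
      omega
    rw [← degree_removeAt E q0, ← h3]
    exact isHomogeneous_wedge hdeg _
  · intro E' hE' hlt
    obtain ⟨p, hp, hlt⟩ := Finsupp.Lex.lt_iff.1 hlt
    refine coeff_wedge_eq_zero hB fun q' hq' => ?_
    obtain ⟨r, hr, hr'⟩ := removeAt_lex hE hE' hp hlt hq'
    change ∀ i < r, _ = F1 i at hr
    change _ < F1 r at hr'
    have hEq : E q0 = e q := rfl
    rcases lt_trichotomy (r : ℕ) q with h | h | h
    · have hlow' : ∀ i ≤ r, F1 i = F i := by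
        intro i hi
        rw [Fin.le_def] at hi
        refine hF1 i (fun hh => ?_) (fun hh => ?_) <;> simp [hh, ha, hb] at hi <;> omega
      exact hlead.coeff_eq_zero (partialSum_lt_of_lex
        (fun i hi => (hr i hi).trans (hlow' i hi.le)) (hr'.trans_eq (hlow' r le_rfl)))
    · obtain rfl : r = a := Fin.ext h
      have hne : removeAt E' q' a ≠ e q := fun hh =>
        Fin.succAbove_ne q' a (hE'.injective (hh.trans (hq'.trans hEq).symm))
      refine hlead.coeff_eq_zero (partialSum_lt_of_lex (j := a)
        (fun i hi => (hr i hi).trans (hF1 i hi.ne fun hh => ?_)) (by omega))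
      rw [Fin.lt_def, hh] at hi
      simp [ha, hb] at hi
    · rcases Nat.eq_or_lt_of_le h with h | h
      · obtain rfl : r = b := Fin.ext h.symm
        have hab : a < b := by simp [ha, hb, Fin.lt_def]
        have h3 := hr a hab
        have h4 := strictMono_removeAt hE' q' hab
        omega
      · have hbr : b ≤ r := Fin.le_def.2 h.le
        exact hlead.coeff_eq_zero ((partialSum_lt_of_lex hr hr').trans_eq (hpartial r hbr))

lemma exists_isLeading {k : ℕ} {e : ℕ → ℕ} (he : ∀ i, i + 1 < k + 4 → e i < e (i + 1))
    (h1 : ∀ i j, i + 2 ≤ j → j + 1 < k + 4 → e (i + 1) ≤ e i + 2 → e j + 3 ≤ e (j + 1))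
    (h2 : ∀ i, i + 3 < k + 4 → e (i + 1) = e i + 1 → e (i + 2) = e i + 2 → e (i + 3) ≠ e i + 5) :
    ∃ a, IsLeading k a (expOf (k + 4) e) := by
  have hE : StrictMono (expOf (k + 4) e) :=
    Fin.strictMono_iff_lt_succ.2 fun i => by simpa using he i (by omega)
  have hremove : ∀ q, q < k + 4 →
      (∀ i, i + 1 < k + 3 → (if i < q then e i else e (i + 1)) + 3 ≤
        if i + 1 < q then e (i + 1) else e (i + 1 + 1)) → ∃ a, IsLeading k a (expOf (k + 4) e) := by
    intro q hq h
    refine exists_isLeading_of_gaps hE ⟨q, hq⟩ fun i j hij => ?_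
    rw [removeAt_expOf, removeAt_expOf]
    exact gaps_of_consecutive (g := fun i => if i < q then e i else e (i + 1)) h hij j.isLt
  by_cases hgood : ∃ i, i + 1 < k + 4 ∧ e (i + 1) ≤ e i + 2
  · classical
    obtain ⟨hi, hi'⟩ := Nat.find_spec hgood
    have hmin : ∀ j < Nat.find hgood, e j + 3 ≤ e (j + 1) := by
      intro j hj
      have := Nat.find_min hgood hj
      by_contra hc
      exact this ⟨by omega, by omega⟩
    generalize Nat.find hgood = i at hi hi' hmin
    by_cases hs : i + 2 < k + 4 ∧ e (i + 2) < e i + 3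
    · have g1 := he i hi
      have g2 := he (i + 1) (by omega)
      have g3 : e (i + 1 + 1) = e (i + 2) := rfl
      refine exists_isLeading_of_consecutive hE hs.1 (by omega) (by omega) hmin
        (fun j hj hj' => h1 i j (by omega) hj' hi') fun h3 => ?_
      have g4 := h1 i (i + 2) le_rfl (by omega) hi'
      have g5 := h2 i h3 (by omega) (by omega)
      have g6 : e (i + 2 + 1) = e (i + 3) := rfl
      omega
    · refine hremove (i + 1) (by omega) fun j hj => ?_
      rcases lt_trichotomy j i with h | rfl | h
      · rw [if_pos (by omega), if_pos (by omega)]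
        exact hmin j h
      · rw [if_pos (by omega), if_neg (by omega)]
        by_contra hc
        have h3 : e (j + 1 + 1) = e (j + 2) := rfl
        exact hs ⟨by omega, by omega⟩
      · rw [if_neg (by omega), if_neg (by omega)]
        exact h1 i (j + 1) (by omega) (by omega) hi'
  · refine hremove 0 (by omega) fun i hi => ?_
    rw [if_neg (by omega), if_neg (by omega)]
    by_contra hc
    exact hgood ⟨i + 1, by omega, by omega⟩

lemma map_le_map_range {l : ℕ → ℕ} {N : ℕ} {s : Finset ℕ} (hs : ∀ i ∈ s, i < N) :
    s.val.map l ≤ (Finset.range N).val.map l :=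
  Multiset.map_le_map (Finset.val_le_iff.2 fun i hi => Finset.mem_range.2 (hs i hi))

lemma Admissible.exists_isLeading {k : ℕ} {l : ℕ → ℕ} (hl : PartitionN (k + 4) l)
    (hadm : Admissible (k + 4) l) :
    ∃ a, IsLeading k a (expOf (k + 4) fun i => l (k + 3 - i) + i) := by
  have hanti : ∀ i, l (i + 1) ≤ l i := fun i => hl.1 (Nat.le_succ i)
  have hpair : ∀ i, l i ≤ l (i + 1) + 1 → GoodPair {l (i + 1), l i} := by
    intro i hi
    have := hanti i
    obtain h | h : l i = l (i + 1) ∨ l i = l (i + 1) + 1 := by omega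
    · exact ⟨l (i + 1), Or.inl (by rw [h])⟩
    · exact ⟨l (i + 1), Or.inr (by rw [h])⟩
  refine _root_.exists_isLeading (fun i hi => ?_) (fun i j hij hj hgood => ?_)
    fun i hi g1 g2 g3 => ?_
  · have h : k + 3 - i = (k + 3 - (i + 1)) + 1 := by omega
    have := hanti (k + 3 - (i + 1))
    rw [h]
    omega
  · by_contra hc
    obtain ⟨a, ha⟩ : ∃ a, k + 3 - (i + 1) = a := ⟨_, rfl⟩
    obtain ⟨b, hb⟩ : ∃ b, k + 3 - (j + 1) = b := ⟨_, rfl⟩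
    have ha' : k + 3 - i = a + 1 := by omega
    have hb' : k + 3 - j = b + 1 := by omega
    simp only [ha, hb, ha', hb'] at hgood hc
    refine hadm (Or.inl ⟨_, _, hpair a (by omega), hpair b (by omega), ?_⟩)
    have h := map_le_map_range (l := l) (N := k + 4) (s := {a + 1, a, b + 1, b}) (by
      simp only [Finset.mem_insert, Finset.mem_singleton]; omega)
    rwa [Finset.insert_val_of_notMem (by simp; omega), Finset.insert_val_of_notMem (by simp; omega),
      Finset.insert_val_of_notMem (by simp), Finset.singleton_val] at h
  · obtain ⟨a, ha⟩ : ∃ a, k + 3 - (i + 3) = a := ⟨_, rfl⟩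
    have ha2 : k + 3 - (i + 2) = a + 1 := by omega
    have ha1 : k + 3 - (i + 1) = a + 2 := by omega
    have ha0 : k + 3 - i = a + 3 := by omega
    simp only [ha, ha0, ha1, ha2] at g1 g2 g3
    refine hadm (Or.inr ⟨l (a + 3), ?_⟩)
    have h := map_le_map_range (l := l) (N := k + 4) (s := {a + 3, a + 2, a + 1, a}) (by
      simp only [Finset.mem_insert, Finset.mem_singleton]; omega)
    rw [Finset.insert_val_of_notMem (by simp), Finset.insert_val_of_notMem (by simp),
      Finset.insert_val_of_notMem (by simp), Finset.singleton_val] at h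
    have e2 : l (a + 2) = l (a + 3) := by omega
    have e1 : l (a + 1) = l (a + 3) := by omega
    have e0 : l a = l (a + 3) + 2 := by omega
    simp only [Multiset.map_cons, Multiset.map_singleton, e2, e1, e0] at h
    exact h

end Existence

section Dimension

lemma expOf_reverse_strictMono {l : ℕ → ℕ} (hl : Antitone l) (k : ℕ) :
    StrictMono (expOf (k + 4) fun i => l (k + 3 - i) + i) := by
  intro i j hij
  have h1 : l (k + 3 - i) ≤ l (k + 3 - j) := hl (by omega)
  have h2 : (i : ℕ) < j := hij
  simp only [expOf_apply]
  omega

lemma degree_expOf_reverse (l : ℕ → ℕ) (k : ℕ) :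
    (expOf (k + 4) fun i => l (k + 3 - i) + i).degree =
      ∑ j ∈ range (k + 4), l j + ∑ i : Fin (k + 4), (i : ℕ) := by
  rw [Finsupp.degree_eq_sum]
  simp only [expOf_apply, Finset.sum_add_distrib]
  congr 1
  rw [← Finset.sum_range_reflect, ← Fin.sum_univ_eq_sum_range (fun j => l (k + 4 - 1 - j))]
  rfl

lemma PartitionN.eq_of_expOf_reverse_eq {k : ℕ} {l l' : ℕ → ℕ} (hl : PartitionN (k + 4) l)
    (hl' : PartitionN (k + 4) l')
    (h : (expOf (k + 4) fun i => l (k + 3 - i) + i) = expOf (k + 4) fun i => l' (k + 3 - i) + i) :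
    l = l' := by
  funext j
  by_cases hj : j < k + 4
  · have := DFunLike.congr_fun h ⟨k + 3 - j, by omega⟩
    simp only [expOf_apply, add_left_inj] at this
    rwa [Nat.sub_sub_self (by omega)] at this
  · rw [hl.2 j (by omega), hl'.2 j (by omega)]

lemma finite_partitionN (n d : ℕ) :
    {l : ℕ → ℕ | PartitionN n l ∧ ∑ j ∈ range n, l j = d}.Finite := by
  refine Set.Finite.of_finite_image
    (f := fun l (i : Fin n) => l i) ((Set.finite_Iic (fun _ : Fin n => d)).subset ?_) ?_
  · rintro _ ⟨l, ⟨-, hl⟩, rfl⟩ i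
    rw [← hl]
    exact Finset.single_le_sum (fun _ _ => Nat.zero_le _) (Finset.mem_range.2 i.isLt)
  · rintro l ⟨hl, -⟩ l' ⟨hl', -⟩ h
    funext j
    by_cases hj : j < n
    · exact congrFun h ⟨j, hj⟩
    · rw [hl.2 j (by omega), hl'.2 j (by omega)]

/-- The admissible partitions of `d` with `n` parts. -/
def admissiblePartitions (n d : ℕ) : Set (ℕ → ℕ) :=
  {l | PartitionN n l ∧ (∑ j ∈ Finset.range n, l j) = d ∧ Admissible n l}

lemma finite_admissiblePartitions (n d : ℕ) : (admissiblePartitions n d).Finite :=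
  (finite_partitionN n d).subset fun _ h => ⟨h.1, h.2.1⟩

/-- The coefficients at the admissible partitions. -/
noncomputable def admissibleCoeff (k : ℕ) (hn : 4 ≤ k + 4) (d : ℕ) :
    JComponent (k + 4) hn d →ₗ[K] (admissiblePartitions (k + 4) d → K) :=
  (LinearMap.pi fun l => MvPolynomial.lcoeff K
    (Finsupp.equivFunOnFinite.symm fun i : Fin (k + 4) => l.1 i)) ∘ₗ Submodule.subtype _

lemma admissibleCoeff_injective (k : ℕ) (hn : 4 ≤ k + 4) (d : ℕ) :
    Function.Injective (admissibleCoeff k hn d) := by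
  refine (injective_iff_map_eq_zero _).2 fun f hf => ?_
  obtain ⟨h1, h2, h3⟩ := mem_JComponent_iff.1 f.2
  exact Subtype.ext (eq_zero_of_coeff_admissible h1 h2 h3 fun l hl hd hadm =>
    congrFun hf ⟨l, hl, hd, hadm⟩)

lemma exists_linearIndependent_JComponent (k : ℕ) (hn : 4 ≤ k + 4) (d : ℕ) :
    ∃ f : admissiblePartitions (k + 4) d → JComponent (k + 4) hn d, LinearIndependent K f := by
  set E : admissiblePartitions (k + 4) d → Fin (k + 4) →₀ ℕ := fun l =>
    expOf (k + 4) fun i => l.1 (k + 3 - i) + i with hE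
  have hEinj : Function.Injective E := fun l l' h =>
    Subtype.ext (l.2.1.eq_of_expOf_reverse_eq l'.2.1 h)
  have hex : ∀ l, ∃ f : JComponent (k + 4) hn d,
      IsLeading k (f.1 * vandermondePoly (k + 4) K) (E l) := by
    intro l
    obtain ⟨a, ha⟩ := l.2.2.2.exists_isLeading l.2.1
    have hdeg := ha.2.2.1
    rw [degree_expOf_reverse, l.2.2.1] at hdeg
    obtain ⟨f, hf, rfl⟩ := ha.1.exists_mem_JComponent hn ha.2.1 hdeg
    exact ⟨⟨f, hf⟩, ha⟩
  choose f hf using hex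
  refine ⟨f, linearIndependent_iff'.2 fun s g hg => ?_⟩
  by_contra! hne
  obtain ⟨l0, hl0, hgl0⟩ := hne
  classical
  obtain ⟨l, hl, hmin⟩ := (s.filter fun l => g l ≠ 0).exists_min_image (fun l => toLex (E l))
    ⟨l0, Finset.mem_filter.2 ⟨hl0, hgl0⟩⟩
  rw [Finset.mem_filter] at hl
  have hsum : ∑ i ∈ s, g i • ((f i).1 * vandermondePoly (k + 4) K) = 0 := by
    have h := congrArg (fun p : JComponent (k + 4) hn d => p.1 * vandermondePoly (k + 4) K) hg
    simpa [Finset.sum_mul, smul_mul_assoc] using h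
  have hcoeff := congrArg (coeff (E l)) hsum
  rw [coeff_sum, Finset.sum_eq_single l] at hcoeff
  · rw [coeff_smul, smul_eq_mul, coeff_zero] at hcoeff
    exact (mul_ne_zero hl.2 (hf l).2.2.2.1) hcoeff
  · intro l' hl' hne
    rw [coeff_smul, smul_eq_mul]
    by_cases hg0 : g l' = 0
    · rw [hg0, zero_mul]
    · have h := hmin l' (Finset.mem_filter.2 ⟨hl', hg0⟩)
      have hlt : toLex (E l) < toLex (E l') :=
        lt_of_le_of_ne h fun hh => hne (hEinj (toLex.injective hh)).symm
      rw [(hf l').2.2.2.2 _ (expOf_reverse_strictMono l.2.1.1 k) hlt, mul_zero]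
  · exact fun h => absurd hl.1 h

end Dimension

theorem dim_Jn_eq_admissible_count (n : ℕ) (hn : 4 ≤ n) (d : ℕ) :
    Module.finrank K (JComponent n hn d) = admCount n d := by
  obtain ⟨k, rfl⟩ : ∃ k, n = k + 4 := ⟨n - 4, by omega⟩
  have : Fintype (admissiblePartitions (k + 4) d) := (finite_admissiblePartitions _ _).fintype
  have hcard : admCount (k + 4) d = Fintype.card (admissiblePartitions (k + 4) d) :=
    (Nat.card_coe_set_eq (admissiblePartitions (k + 4) d)).symm.trans Nat.card_eq_fintype_card
  have hinj := admissibleCoeff_injective k hn d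
  have : Module.Finite K (JComponent (k + 4) hn d) := Module.Finite.of_injective _ hinj
  obtain ⟨f, hf⟩ := exists_linearIndependent_JComponent k hn d
  rw [hcard]
  refine le_antisymm ?_ hf.fintype_card_le_finrank
  have := LinearMap.finrank_le_finrank_of_injective hinj
  rwa [Module.finrank_fintype_fun_eq_card] at this
end

section
/- For every integer n ≥ 4, the generating function of admissible partitions with n parts satisfies Σ_{d=0}^∞ #{admissible λ ∈ π_{n,d}} q^d = q^{(n-1)(n-3)}/((q)_1 (q)_{n-3}) + q^{(n-2)(n-1)}/((q)_1 (q)_{n-2}) + q^{n(n-1)}/(q)_n, as an identity of formal power series in q over ℚ, where (q)_s = ∏_{j=1}^s (1 − q^j) and division by (q)_s means multiplication by its inverse in the formal power series ring. -/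
open Finset

/-- `(q)_s = ∏_{j=1}^s (1 - q^j)` as a formal power series over `ℚ`. -/
noncomputable def qPoch (s : ℕ) : PowerSeries ℚ :=
  ∏ j ∈ Finset.range s, (1 - (PowerSeries.X : PowerSeries ℚ) ^ (j + 1))

/-- The sequences supported on `{0, …, m - 1}` that satisfy `P`. -/
def supportedSeqs (m : ℕ) (P : (ℕ → ℕ) → Prop) : Set (ℕ → ℕ) :=
  {f | (∀ j, m ≤ j → f j = 0) ∧ P f}

/-- The weight of a sequence of differences: the size of the partition it comes from. -/
def diffWeight (m : ℕ) (f : ℕ → ℕ) : ℕ := ∑ j ∈ range m, (j + 1) * f j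

/-- The generating function of a set of sequences with respect to a weight. -/
noncomputable def weightGF (S : Set (ℕ → ℕ)) (w : (ℕ → ℕ) → ℕ) : PowerSeries ℚ :=
  PowerSeries.mk fun d => ((Set.ncard {f | f ∈ S ∧ w f = d} : ℕ) : ℚ)

/-- The generating function of the difference sequences of length `m` satisfying `P`. -/
noncomputable def diffGF (m : ℕ) (P : (ℕ → ℕ) → Prop) : PowerSeries ℚ :=
  weightGF (supportedSeqs m P) (diffWeight m)

/-- `P` depends only on the first `m` terms of a sequence. -/
def DependsOnFirst (m : ℕ) (P : (ℕ → ℕ) → Prop) : Prop :=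
  ∀ f g : ℕ → ℕ, (∀ j, j < m → f j = g j) → P f → P g

/-- All of the first `m` terms are at least two. -/
def AllLarge (m : ℕ) (f : ℕ → ℕ) : Prop := ∀ j, j < m → 2 ≤ f j

/-- The condition that admissibility imposes on consecutive differences. -/
def AdmissibleDiffs (m : ℕ) (f : ℕ → ℕ) : Prop :=
  (∀ j k, j + 2 ≤ k → k < m → f j ≤ 1 → 2 ≤ f k) ∧
  (∀ j, j + 2 < m → f j = 2 → f (j + 1) = 0 → f (j + 2) ≠ 0)

theorem weightGF_of_bijOn {S T : Set (ℕ → ℕ)} {w w' : (ℕ → ℕ) → ℕ} {c : ℕ}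
    (e : (ℕ → ℕ) → (ℕ → ℕ)) (he : Set.BijOn e S T) (hw : ∀ f ∈ S, w' (e f) = w f + c) :
    weightGF T w' = PowerSeries.X ^ c * weightGF S w := by
  ext d
  rw [PowerSeries.coeff_X_pow_mul']
  simp only [weightGF, PowerSeries.coeff_mk]
  split_ifs with h
  · have himg : {f | f ∈ T ∧ w' f = d} = e '' {f | f ∈ S ∧ w f = d - c} := by
      ext g
      constructor
      · rintro ⟨hg, hd⟩
        obtain ⟨f, hf, rfl⟩ := he.surjOn hg
        exact ⟨f, ⟨hf, by have := hw f hf; omega⟩, rfl⟩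
      · rintro ⟨f, ⟨hf, hd⟩, rfl⟩
        exact ⟨he.mapsTo hf, by have := hw f hf; omega⟩
    rw [himg, (he.injOn.mono fun f hf => hf.1).ncard_image]
  · have hempty : {f | f ∈ T ∧ w' f = d} = ∅ := by
      ext g
      simp only [Set.mem_ofPred_eq, Set.mem_empty_iff_false, iff_false, not_and]
      intro hg hd
      obtain ⟨f, hf, rfl⟩ := he.surjOn hg
      have := hw f hf
      omega
    simp [hempty]

theorem finite_diffWeight_eq (m d : ℕ) (P : (ℕ → ℕ) → Prop) :
    {f | f ∈ supportedSeqs m P ∧ diffWeight m f = d}.Finite := by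
  refine Set.Finite.of_injOn (f := fun f (i : Fin m) => f i)
    (t := Set.Iic (fun _ : Fin m => d)) ?_ ?_ (Set.finite_Iic _)
  · rintro f ⟨-, rfl⟩ i
    have := Finset.single_le_sum (f := fun j => (j + 1) * f j) (fun _ _ => Nat.zero_le _)
      (Finset.mem_range.2 i.2)
    exact (Nat.le_mul_of_pos_left (f i) (Nat.succ_pos i)).trans this
  · rintro f ⟨⟨hf, -⟩, -⟩ g ⟨⟨hg, -⟩, -⟩ hfg
    funext j
    by_cases hj : j < m
    · exact congrFun hfg ⟨j, hj⟩
    · rw [hf j (by omega), hg j (by omega)]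

theorem diffGF_or {m : ℕ} {P Q R : (ℕ → ℕ) → Prop} (h : ∀ f, P f ↔ Q f ∨ R f)
    (hdisj : ∀ f, Q f → ¬ R f) : diffGF m P = diffGF m Q + diffGF m R := by
  ext d
  simp only [diffGF, weightGF, PowerSeries.coeff_mk, map_add]
  rw [← Nat.cast_add, ← Set.ncard_union_eq _ (finite_diffWeight_eq m d Q)
    (finite_diffWeight_eq m d R)]
  · congr 2
    ext f
    simp only [supportedSeqs, Set.mem_ofPred_eq, Set.mem_union, h f]
    tauto
  · rw [Set.disjoint_left]
    rintro f ⟨⟨-, hQ⟩, -⟩ ⟨⟨-, hR⟩, -⟩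
    exact hdisj f hQ hR

theorem diffGF_congr {m : ℕ} {P Q : (ℕ → ℕ) → Prop} (h : ∀ f, P f ↔ Q f) :
    diffGF m P = diffGF m Q := by
  rw [show P = Q from funext fun f => propext (h f)]

theorem diffWeight_congr {m : ℕ} {f g : ℕ → ℕ} (h : ∀ j, j < m → f j = g j) :
    diffWeight m f = diffWeight m g :=
  Finset.sum_congr rfl fun j hj => by rw [h j (Finset.mem_range.1 hj)]

theorem diffWeight_succ (m : ℕ) (f : ℕ → ℕ) :
    diffWeight (m + 1) f = diffWeight m f + (m + 1) * f m :=
  Finset.sum_range_succ _ _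

theorem diffGF_last_eq {m : ℕ} {P : (ℕ → ℕ) → Prop} (hP : DependsOnFirst m P) (a : ℕ) :
    diffGF (m + 1) (fun f => P f ∧ f m = a) = PowerSeries.X ^ ((m + 1) * a) * diffGF m P := by
  refine weightGF_of_bijOn (fun f => Function.update f m a) ⟨?_, ?_, ?_⟩ ?_
  · rintro f ⟨hf, hPf⟩
    dsimp only
    refine ⟨fun j hj => ?_, hP f _ (fun j hj => ?_) hPf, by simp⟩
    · rw [Function.update_of_ne (by omega), hf j (by omega)]
    · rw [Function.update_of_ne (by omega)]
  · rintro f ⟨hf, -⟩ g ⟨hg, -⟩ hfg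
    funext j
    by_cases hj : j = m
    · rw [hf j (by omega), hg j (by omega)]
    · simpa [Function.update_of_ne hj] using congrFun hfg j
  · rintro g ⟨hg, hPg, hgm⟩
    refine ⟨Function.update g m 0, ⟨fun j hj => ?_, hP g _ (fun j hj => ?_) hPg⟩, ?_⟩
    · by_cases hjm : j = m
      · simp [hjm]
      · rw [Function.update_of_ne hjm, hg j (by omega)]
    · rw [Function.update_of_ne (by omega)]
    · simp [← hgm]
  · rintro f -
    rw [diffWeight_succ, Function.update_self,
      diffWeight_congr (g := f) fun j hj => Function.update_of_ne (by omega) _ _]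

theorem diffGF_last_ge_succ {m : ℕ} {P : (ℕ → ℕ) → Prop} (hP : DependsOnFirst m P) (a : ℕ) :
    diffGF (m + 1) (fun f => P f ∧ a + 1 ≤ f m) =
      PowerSeries.X ^ (m + 1) * diffGF (m + 1) (fun f => P f ∧ a ≤ f m) := by
  refine weightGF_of_bijOn (fun f => Function.update f m (f m + 1)) ⟨?_, ?_, ?_⟩ ?_
  · rintro f ⟨hf, hPf, ha⟩
    dsimp only
    refine ⟨fun j hj => ?_, hP f _ (fun j hj => ?_) hPf, by simpa using ha⟩
    · rw [Function.update_of_ne (by omega), hf j (by omega)]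
    · rw [Function.update_of_ne (by omega)]
  · rintro f - g - hfg
    funext j
    have h := congrFun hfg j
    by_cases hj : j = m
    · subst hj
      simpa using h
    · simpa [Function.update_of_ne hj] using h
  · rintro g ⟨hg, hPg, hgm⟩
    refine ⟨Function.update g m (g m - 1), ⟨fun j hj => ?_, hP g _ (fun j hj => ?_) hPg, ?_⟩, ?_⟩
    · rw [Function.update_of_ne (by omega), hg j (by omega)]
    · rw [Function.update_of_ne (by omega)]
    · rw [Function.update_self]
      omega
    · simp [Nat.sub_add_cancel (show 1 ≤ g m by omega)]
  · rintro f -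
    rw [diffWeight_succ, diffWeight_succ, Function.update_self,
      diffWeight_congr (g := f) fun j hj => Function.update_of_ne (by omega) _ _]
    ring

theorem diffGF_last_ge {m : ℕ} {P : (ℕ → ℕ) → Prop} (hP : DependsOnFirst m P) (a : ℕ) :
    diffGF (m + 1) (fun f => P f ∧ a ≤ f m) * (1 - PowerSeries.X ^ (m + 1)) =
      PowerSeries.X ^ ((m + 1) * a) * diffGF m P := by
  have h : diffGF (m + 1) (fun f => P f ∧ a ≤ f m) =
      diffGF (m + 1) (fun f => P f ∧ f m = a) + diffGF (m + 1) (fun f => P f ∧ a + 1 ≤ f m) := by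
    apply diffGF_or
    · intro f
      rw [← and_or_left, and_congr_right_iff]
      omega
    · rintro f ⟨-, h⟩ ⟨-, h'⟩
      omega
  rw [diffGF_last_eq hP, diffGF_last_ge_succ hP] at h
  linear_combination h

theorem AllLarge.dependsOnFirst (m : ℕ) : DependsOnFirst m (AllLarge m) :=
  fun _ _ hfg hf j hj => hfg j hj ▸ hf j hj

theorem AdmissibleDiffs.dependsOnFirst (m : ℕ) : DependsOnFirst m (AdmissibleDiffs m) := by
  rintro f g hfg ⟨h₁, h₂⟩
  refine ⟨fun j k hjk hk hj => ?_, fun j hj => ?_⟩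
  · rw [← hfg k hk]
    exact h₁ j k hjk hk (by rwa [hfg j (by omega)])
  · rw [← hfg j (by omega), ← hfg (j + 1) (by omega), ← hfg (j + 2) hj]
    exact h₂ j hj

theorem DependsOnFirst.and_last {m : ℕ} {P : (ℕ → ℕ) → Prop} (hP : DependsOnFirst m P)
    (Q : ℕ → Prop) : DependsOnFirst (m + 1) (fun f => P f ∧ Q (f m)) :=
  fun _ _ hfg ⟨hPf, hQ⟩ =>
    ⟨hP _ _ (fun j hj => hfg j (by omega)) hPf, hfg m (Nat.lt_succ_self m) ▸ hQ⟩

theorem diffGF_zero {P : (ℕ → ℕ) → Prop} (hP : P 0) : diffGF 0 P = 1 := by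
  ext d
  simp only [diffGF, weightGF, PowerSeries.coeff_mk, PowerSeries.coeff_one, diffWeight,
    Finset.range_zero, Finset.sum_empty, supportedSeqs, Set.mem_ofPred_eq, Nat.zero_le, true_implies]
  split_ifs with h
  · have : {f : ℕ → ℕ | ((∀ j, f j = 0) ∧ P f) ∧ 0 = d} = {0} := by
      ext f
      simp only [Set.mem_ofPred_eq, Set.mem_singleton_iff]
      constructor
      · exact fun hf => funext hf.1.1
      · rintro rfl
        exact ⟨⟨fun _ => rfl, hP⟩, h.symm⟩
    simp [this]
  · simp [Ne.symm h]

theorem qPoch_succ (s : ℕ) : qPoch (s + 1) = qPoch s * (1 - PowerSeries.X ^ (s + 1)) :=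
  Finset.prod_range_succ _ _

theorem qPoch_zero : qPoch 0 = 1 := Finset.prod_range_zero _

theorem allLarge_succ (m : ℕ) (f : ℕ → ℕ) :
    AllLarge (m + 1) f ↔ AllLarge m f ∧ 2 ≤ f m := by
  refine ⟨fun h => ⟨fun j hj => h j (by omega), h m (by omega)⟩, fun h j hj => ?_⟩
  rcases Nat.lt_succ_iff_lt_or_eq.1 hj with hj | rfl
  exacts [h.1 j hj, h.2]

theorem diffGF_allLarge (m : ℕ) :
    diffGF m (AllLarge m) * qPoch m = PowerSeries.X ^ (m * (m + 1)) := by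
  induction m with
  | zero =>
    rw [diffGF_zero (fun j hj => absurd hj (Nat.not_lt_zero j)), qPoch_zero]
    simp
  | succ m ih =>
    have h := diffGF_last_ge (AllLarge.dependsOnFirst m) 2
    rw [diffGF_congr (Q := AllLarge (m + 1))] at h
    · rw [qPoch_succ]
      have hX : (PowerSeries.X : PowerSeries ℚ) ^ ((m + 1) * (m + 1 + 1)) =
          PowerSeries.X ^ ((m + 1) * 2) * PowerSeries.X ^ (m * (m + 1)) := by
        rw [← pow_add]
        congr 1
        ring
      rw [hX]
      linear_combination qPoch m * h + PowerSeries.X ^ ((m + 1) * 2) * ih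
    · exact fun f => (allLarge_succ m f).symm

/-- Sequences of large terms whose last term, if there is one, is at least three. -/
def AllLargeLastThree (m : ℕ) (f : ℕ → ℕ) : Prop :=
  AllLarge m f ∧ ∀ j, j + 1 = m → 3 ≤ f j

theorem AllLargeLastThree.dependsOnFirst (m : ℕ) : DependsOnFirst m (AllLargeLastThree m) :=
  fun _ _ hfg hf => ⟨AllLarge.dependsOnFirst m _ _ hfg hf.1,
    fun j hj => hfg j (by omega) ▸ hf.2 j hj⟩

theorem diffGF_allLargeLastThree (m : ℕ) :
    diffGF m (AllLargeLastThree m) = PowerSeries.X ^ m * diffGF m (AllLarge m) := by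
  cases m with
  | zero =>
    rw [diffGF_zero ⟨fun j hj => absurd hj (Nat.not_lt_zero j), fun j hj => absurd hj (by omega)⟩,
      diffGF_zero (fun j hj => absurd hj (Nat.not_lt_zero j))]
    simp
  | succ m =>
    have h := diffGF_last_ge_succ (AllLarge.dependsOnFirst m) 2
    rw [diffGF_congr (Q := AllLarge (m + 1)) (P := fun f => AllLarge m f ∧ 2 ≤ f m),
      diffGF_congr (Q := AllLargeLastThree (m + 1))] at h
    · exact h
    · intro f
      constructor
      · refine fun h => ⟨(allLarge_succ m f).2 ⟨h.1, (Nat.le_succ 2).trans h.2⟩, fun j hj => ?_⟩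
        obtain rfl : j = m := by omega
        exact h.2
      · exact fun h => ⟨fun j hj => h.1 j (by omega), h.2 m rfl⟩
    · exact fun f => (allLarge_succ m f).symm

theorem AllLarge.admissibleDiffs {m : ℕ} {f : ℕ → ℕ} (h : AllLarge m f) :
    AdmissibleDiffs (m + 1) f := by
  refine ⟨fun j k hjk hk hj => ?_, fun j hj _ h1 => ?_⟩
  · have := h j (by omega)
    omega
  · have := h (j + 1) (by omega)
    omega

theorem admissibleDiffs_succ_succ (k : ℕ) (f : ℕ → ℕ) :
    AdmissibleDiffs (k + 2) f ↔
      (AdmissibleDiffs (k + 1) f ∧ 2 ≤ f (k + 1)) ∨ (AllLarge (k + 1) f ∧ f (k + 1) ≤ 1) ∨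
      ((AllLarge k f ∧ (f k = 0 ∧ f (k + 1) = 1 ∨ f k = 1 ∧ f (k + 1) ≤ 1)) ∨
        (AllLargeLastThree k f ∧ f k = 0) ∧ f (k + 1) = 0) := by
  constructor
  · rintro ⟨h₁, h₂⟩
    by_cases hl : 2 ≤ f (k + 1)
    · exact Or.inl ⟨⟨fun j i hji hi => h₁ j i hji (by omega), fun j hj => h₂ j (by omega)⟩, hl⟩
    have hlarge : AllLarge k f := by
      intro j hj
      by_contra hlt
      exact hl (h₁ j (k + 1) (by omega) (by omega) (by omega))
    by_cases hk : 2 ≤ f k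
    · exact Or.inr (Or.inl ⟨(allLarge_succ k f).2 ⟨hlarge, hk⟩, by omega⟩)
    refine Or.inr (Or.inr ?_)
    by_cases h0 : f k = 0 ∧ f (k + 1) = 0
    · refine Or.inr ⟨⟨⟨hlarge, fun j hj => ?_⟩, h0.1⟩, h0.2⟩
      subst hj
      have := hlarge j (by omega)
      by_contra hlt
      exact h₂ j (by omega) (by omega) h0.1 h0.2
    · exact Or.inl ⟨hlarge, by omega⟩
  · rintro (⟨⟨h₁, h₂⟩, hl⟩ | ⟨h, -⟩ | ⟨h, hs⟩ | ⟨⟨⟨h, h3⟩, -⟩, -⟩)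
    · refine ⟨fun j i hji hi hj => ?_, fun j hj ha hb hc => ?_⟩
      · by_cases hik : i = k + 1
        · exact hik ▸ hl
        · exact h₁ j i hji (by omega) hj
      · by_cases hjk : j + 2 = k + 1
        · rw [hjk] at hc
          omega
        · exact h₂ j (by omega) ha hb hc
    · exact h.admissibleDiffs
    · refine ⟨fun j i hji hi hj => ?_, fun j hj ha hb hc => ?_⟩
      · have := h j (by omega)
        omega
      · by_cases hjk : j + 1 = k
        · subst hjk
          simp only [add_assoc, Nat.reduceAdd] at hs
          omega
        · have := h (j + 1) (by omega)
          omega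
    · refine ⟨fun j i hji hi hj => ?_, fun j hj ha hb hc => ?_⟩
      · have := h j (by omega)
        omega
      · by_cases hjk : j + 1 = k
        · have := h3 j hjk
          omega
        · have := h (j + 1) (by omega)
          omega

theorem diffGF_last_le_one {m : ℕ} {P : (ℕ → ℕ) → Prop} (hP : DependsOnFirst m P) :
    diffGF (m + 1) (fun f => P f ∧ f m ≤ 1) = (1 + PowerSeries.X ^ (m + 1)) * diffGF m P := by
  rw [diffGF_or (Q := fun f => P f ∧ f m = 0) (R := fun f => P f ∧ f m = 1), diffGF_last_eq hP,
    diffGF_last_eq hP]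
  · simp [add_mul]
  · intro f
    rw [← and_or_left, and_congr_right_iff]
    omega
  · rintro f ⟨-, h⟩ ⟨-, h'⟩
    omega

theorem diffGF_admissibleDiffs_succ_succ (k : ℕ) :
    diffGF (k + 2) (AdmissibleDiffs (k + 2)) =
      diffGF (k + 2) (fun f => AdmissibleDiffs (k + 1) f ∧ 2 ≤ f (k + 1)) +
      ((1 + PowerSeries.X ^ (k + 2)) * diffGF (k + 1) (AllLarge (k + 1)) +
      (PowerSeries.X ^ k + PowerSeries.X ^ (k + 1) * (1 + PowerSeries.X ^ (k + 2))
        + PowerSeries.X ^ (k + 2)) * diffGF k (AllLarge k)) := by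
  have hA := AllLarge.dependsOnFirst k
  rw [diffGF_or (admissibleDiffs_succ_succ k),
    diffGF_or (Q := fun f => AllLarge (k + 1) f ∧ f (k + 1) ≤ 1) (fun f => Iff.rfl),
    diffGF_last_le_one (AllLarge.dependsOnFirst (k + 1)),
    diffGF_or (R := fun f => (AllLargeLastThree k f ∧ f k = 0) ∧ f (k + 1) = 0)
      (fun f => Iff.rfl),
    diffGF_last_eq ((AllLargeLastThree.dependsOnFirst k).and_last (· = 0)),
    diffGF_last_eq (AllLargeLastThree.dependsOnFirst k), diffGF_allLargeLastThree,
    diffGF_or (P := fun f => AllLarge k f ∧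
        (f k = 0 ∧ f (k + 1) = 1 ∨ f k = 1 ∧ f (k + 1) ≤ 1))
      (Q := fun f => (AllLarge k f ∧ f k = 0) ∧ f (k + 1) = 1)
      (R := fun f => (AllLarge k f ∧ f k = 1) ∧ f (k + 1) ≤ 1),
    diffGF_last_eq (hA.and_last (· = 0)), diffGF_last_eq hA,
    diffGF_last_le_one (hA.and_last (· = 1)), diffGF_last_eq hA]
  · ring
  · intro f
    tauto
  · rintro f ⟨⟨-, h⟩, -⟩ ⟨⟨-, h'⟩, -⟩
    omega
  · rintro f ⟨-, h⟩ ⟨⟨-, h'⟩, h''⟩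
    omega
  · rintro f ⟨h, -⟩ h'
    have := h k (by omega)
    omega
  · rintro f ⟨-, h⟩ h'
    omega

theorem diffGF_admissibleDiffs (k : ℕ) :
    (PowerSeries.X : PowerSeries ℚ) ^ (3 * (k + 1)) *
      (diffGF (k + 1) (AdmissibleDiffs (k + 1)) * (1 - PowerSeries.X) * qPoch (k + 1)) =
    PowerSeries.X ^ ((k + 1) * (k + 2)) *
      ((1 - PowerSeries.X ^ k) * (1 - PowerSeries.X ^ (k + 1)) * (1 - PowerSeries.X ^ (k + 2)) +
        PowerSeries.X ^ (k + 1) * (1 - PowerSeries.X ^ (k + 1)) * (1 - PowerSeries.X ^ (k + 2)) +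
        PowerSeries.X ^ (3 * (k + 1)) * (1 - PowerSeries.X)) := by
  induction k with
  | zero =>
    have hA : DependsOnFirst 0 (fun _ => True) := fun _ _ _ h => h
    have h := diffGF_last_ge hA 0
    rw [diffGF_zero trivial, diffGF_congr (Q := AdmissibleDiffs (0 + 1))] at h
    · simp only [qPoch_succ, qPoch_zero]
      simp only [zero_add, mul_zero, pow_zero, pow_one, mul_one, one_mul] at h ⊢
      linear_combination PowerSeries.X ^ 3 * (1 - PowerSeries.X) * h
    · intro f
      simp only [Nat.zero_le, and_self, true_iff]
      exact AllLarge.admissibleDiffs fun j hj => absurd hj (Nat.not_lt_zero j)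
  | succ k ih =>
    have hrec := diffGF_admissibleDiffs_succ_succ k
    have hge := diffGF_last_ge (AdmissibleDiffs.dependsOnFirst (k + 1)) 2
    have h₁ := diffGF_allLarge (k + 1)
    have h₀ := diffGF_allLarge k
    rw [qPoch_succ] at h₁ ih ⊢
    rw [qPoch_succ]
    have hX : (PowerSeries.X : PowerSeries ℚ) ^ ((k + 1) * (k + 2)) =
        PowerSeries.X ^ ((k + 1) * 2) * PowerSeries.X ^ (k * (k + 1)) := by
      rw [← pow_add]
      congr 1
      ring
    have hX' : (PowerSeries.X : PowerSeries ℚ) ^ ((k + 1 + 1) * (k + 1 + 2)) =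
        PowerSeries.X ^ (4 * k + 6) * PowerSeries.X ^ (k * (k + 1)) := by
      rw [← pow_add]
      congr 1
      ring
    rw [show (k + 1) * (k + 1 + 1) = (k + 1) * (k + 2) from rfl, hX] at h₁
    rw [hX] at ih
    rw [hX', show k + 1 + 1 = k + 2 from rfl, hrec]
    rw [show k + 1 + 1 = k + 2 from rfl] at hge
    generalize diffGF (k + 2) (fun f => AdmissibleDiffs (k + 1) f ∧ 2 ≤ f (k + 1)) = G at *
    generalize diffGF (k + 1) (AdmissibleDiffs (k + 1)) = C at *
    generalize diffGF (k + 1) (AllLarge (k + 1)) = E₁ at *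
    generalize diffGF k (AllLarge k) = E₀ at *
    generalize (PowerSeries.X : PowerSeries ℚ) ^ (k * (k + 1)) = Z at *
    generalize qPoch k = p at *
    clear hrec hX hX'
    simp only [pow_add, pow_mul', mul_add] at *
    generalize (PowerSeries.X : PowerSeries ℚ) = x at *
    linear_combination (x ^ k) ^ 3 * x ^ 6 * (1 - x) * p * (1 - x ^ k * x) * hge +
      x ^ 7 * (x ^ k) ^ 2 * ih +
      (x ^ k) ^ 3 * x ^ 6 * (1 + x ^ k * x ^ 2) * (1 - x) * (1 - x ^ k * x ^ 2) * h₁ +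
      (x ^ k) ^ 3 * x ^ 6 * (x ^ k + x ^ k * x * (1 + x ^ k * x ^ 2) + x ^ k * x ^ 2) * (1 - x) *
        (1 - x ^ k * x) * (1 - x ^ k * x ^ 2) * h₀

theorem exists_le_of_le_map {l : ℕ → ℕ} {s : Multiset ℕ} :
    ∀ {P : Multiset ℕ}, P ≤ s.map l → ∃ t ≤ s, t.map l = P := by
  induction s using Multiset.induction_on with
  | empty =>
    intro P h
    exact ⟨0, le_rfl, (Multiset.le_zero.1 h).symm⟩
  | cons a s ih =>
    intro P h
    rw [Multiset.map_cons] at h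
    by_cases ha : l a ∈ P
    · obtain ⟨Q, rfl⟩ := Multiset.exists_cons_of_mem ha
      obtain ⟨t, ht, rfl⟩ := ih ((Multiset.cons_le_cons_iff _).1 h)
      exact ⟨a ::ₘ t, Multiset.cons_le_cons a ht, Multiset.map_cons l a t⟩
    · obtain ⟨t, ht, rfl⟩ := ih ((Multiset.le_cons_of_notMem ha).1 h)
      exact ⟨t, ht.trans (Multiset.le_cons_self s a), rfl⟩

/-- A submultiset of size four of the values of `l` comes from four distinct indices. -/
theorem four_le_map_range_iff {n : ℕ} {l : ℕ → ℕ} {w x y z : ℕ} :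
    ({w, x, y, z} : Multiset ℕ) ≤ (Finset.range n).val.map l ↔
      ∃ a b c d, [a, b, c, d].Nodup ∧ (∀ i ∈ [a, b, c, d], i < n) ∧
        l a = w ∧ l b = x ∧ l c = y ∧ l d = z := by
  constructor
  · intro h
    obtain ⟨t, ht, htl⟩ := exists_le_of_le_map h
    have hnodup := Multiset.nodup_of_le ht (Finset.range n).nodup
    have hlt : ∀ i ∈ t, i < n := fun i hi => Finset.mem_range.1 (Multiset.mem_of_le ht hi)
    obtain ⟨a, ha, haw, h1⟩ := (Multiset.map_eq_cons l t {x, y, z} w).2 htl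
    obtain ⟨b, hb, hbx, h2⟩ := (Multiset.map_eq_cons l _ {y, z} x).2 h1
    obtain ⟨c, hc, hcy, h3⟩ := (Multiset.map_eq_cons l _ {z} y).2 h2
    obtain ⟨d, hd, hdz⟩ := Multiset.map_eq_singleton.1 h3
    have ht' : t = ([a, b, c, d] : List ℕ) := by
      rw [← Multiset.cons_erase ha, ← Multiset.cons_erase hb, ← Multiset.cons_erase hc, hd]
      rfl
    subst ht'
    exact ⟨a, b, c, d, hnodup, hlt, haw, hbx, hcy, hdz⟩
  · rintro ⟨a, b, c, d, hnodup, hlt, rfl, rfl, rfl, rfl⟩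
    refine Multiset.map_le_map (f := l) (s := ([a, b, c, d] : List ℕ)) ?_
    refine (Multiset.le_iff_subset (Multiset.coe_nodup.2 hnodup)).2 fun i hi => ?_
    exact Finset.mem_range.2 (hlt i hi)

theorem GoodPair.exists_eq_pair {P : Multiset ℕ} (h : GoodPair P) :
    ∃ w x, P = {w, x} ∧ w ≤ x ∧ x ≤ w + 1 := by
  obtain ⟨i, rfl | rfl⟩ := h
  exacts [⟨i, i, rfl, le_rfl, Nat.le_succ i⟩, ⟨i, i + 1, rfl, Nat.le_succ i, le_rfl⟩]

theorem goodPair_of_close {w x : ℕ} (h : w ≤ x) (h' : x ≤ w + 1) : GoodPair {x, w} := by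
  refine ⟨w, ?_⟩
  obtain rfl | rfl : x = w ∨ x = w + 1 := by omega
  · exact Or.inl rfl
  · exact Or.inr (Multiset.pair_comm _ _)

theorem Antitone.step_le_sub {l : ℕ → ℕ} (hl : Antitone l) {j a b : ℕ} (haj : a ≤ j) (hjb : j < b) :
    l j - l (j + 1) ≤ l a - l b := by
  have := hl haj
  have : l b ≤ l (j + 1) := hl hjb
  omega

theorem exists_separated_steps_of_lt {l : ℕ → ℕ} (hl : Antitone l) {a b c d n : ℕ} (hab : a < b)
    (hcd : c < d) (hac : a < c) (hbc : b ≠ c) (hbd : b ≠ d) (hb : b < n) (hd : d < n)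
    (h : l a - l b ≤ 1) (h' : l c - l d ≤ 1) :
    ∃ j k, j + 2 ≤ k ∧ k < n - 1 ∧ l j - l (j + 1) ≤ 1 ∧ l k - l (k + 1) ≤ 1 := by
  by_cases hda : a + 3 ≤ d
  · exact ⟨a, d - 1, by omega, by omega, (hl.step_le_sub le_rfl hab).trans h,
      (hl.step_le_sub (by omega) (by omega)).trans h'⟩
  · exact ⟨a, b - 1, by omega, by omega, (hl.step_le_sub le_rfl hab).trans h,
      (hl.step_le_sub (by omega) (by omega)).trans h⟩

theorem exists_separated_steps {l : ℕ → ℕ} (hl : Antitone l) {a b c d n : ℕ} (hab : a < b)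
    (hcd : c < d) (hac : a ≠ c) (had : a ≠ d) (hbc : b ≠ c) (hbd : b ≠ d) (hb : b < n)
    (hd : d < n) (h : l a - l b ≤ 1) (h' : l c - l d ≤ 1) :
    ∃ j k, j + 2 ≤ k ∧ k < n - 1 ∧ l j - l (j + 1) ≤ 1 ∧ l k - l (k + 1) ≤ 1 := by
  rcases hac.lt_or_gt with hac | hac
  · exact exists_separated_steps_of_lt hl hab hcd hac hbc hbd hb hd h h'
  · exact exists_separated_steps_of_lt hl hcd hab hac had.symm hbd.symm hd hb h' h

theorem exists_ordered_pair {l : ℕ → ℕ} {a b : ℕ} (hne : a ≠ b)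
    (h : l a ≤ l b) (h' : l b ≤ l a + 1) :
    ∃ a' b', a' < b' ∧ l a' - l b' ≤ 1 ∧ (a' = a ∧ b' = b ∨ a' = b ∧ b' = a) := by
  rcases hne.lt_or_gt with hlt | hlt
  · exact ⟨a, b, hlt, by omega, Or.inl ⟨rfl, rfl⟩⟩
  · exact ⟨b, a, hlt, by omega, Or.inr ⟨rfl, rfl⟩⟩

theorem not_admissibleDiffs_of_triple {l : ℕ → ℕ} (hl : Antitone l) {n a b c x : ℕ} (hab : a < b)
    (hbc : b < c) (hc : c < n) (hla : l a = l c) (hx : l x = l a + 2) :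
    ¬ AdmissibleDiffs (n - 1) (fun j => l j - l (j + 1)) := by
  rintro ⟨h₁, h₂⟩
  dsimp only at h₁ h₂
  have hxa : x < a := by
    by_contra hle
    have := hl (not_lt.1 hle)
    omega
  have h0 := hl.step_le_sub (le_refl a) (show a < c by omega)
  have h0' := hl.step_le_sub (show a ≤ a + 1 by omega) (show a + 1 < c by omega)
  have hprev := hl.step_le_sub (show x ≤ a - 1 by omega) (show a - 1 < a by omega)
  have h2 : 2 ≤ l (a - 1) - l (a - 1 + 1) := by
    by_contra hlt
    have := h₁ (a - 1) (a + 1) (by omega) (by omega) (by omega)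
    omega
  obtain ⟨p, rfl⟩ : ∃ p, a = p + 1 := ⟨a - 1, by omega⟩
  rw [Nat.add_sub_cancel] at hprev h2
  refine h₂ p (by omega) (by omega) (by omega) ?_
  simp only [add_assoc, Nat.reduceAdd] at *
  omega

theorem not_admissibleDiffs_of_distinct {l : ℕ → ℕ} (hl : Antitone l) {n i a b c x : ℕ}
    (hab : a ≠ b) (hac : a ≠ c) (hbc : b ≠ c) (ha : a < n) (hb : b < n) (hc : c < n)
    (hla : l a = i) (hlb : l b = i) (hlc : l c = i) (hx : l x = i + 2) :
    ¬ AdmissibleDiffs (n - 1) (fun j => l j - l (j + 1)) := by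
  rcases hab.lt_or_gt with hab | hab <;> rcases hac.lt_or_gt with hac | hac <;>
    rcases hbc.lt_or_gt with hbc | hbc
  · exact not_admissibleDiffs_of_triple hl hab hbc hc (by omega) (x := x) (by omega)
  · exact not_admissibleDiffs_of_triple hl hac hbc hb (by omega) (x := x) (by omega)
  · omega
  · exact not_admissibleDiffs_of_triple hl hac hab hb (by omega) (x := x) (by omega)
  · exact not_admissibleDiffs_of_triple hl hab hac hc (by omega) (x := x) (by omega)
  · omega
  · exact not_admissibleDiffs_of_triple hl hbc hac ha (by omega) (x := x) (by omega)
  · exact not_admissibleDiffs_of_triple hl hbc hab ha (by omega) (x := x) (by omega)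

theorem admissible_iff {l : ℕ → ℕ} (hl : Antitone l) (n : ℕ) :
    Admissible n l ↔ AdmissibleDiffs (n - 1) (fun j => l j - l (j + 1)) := by
  have hstep : ∀ j, l (j + 1) ≤ l j := fun j => hl (Nat.le_succ j)
  constructor
  · intro hadm
    refine ⟨fun j k hjk hk hj => ?_, fun j hj h2 h0 h0' => ?_⟩
    · dsimp only at hj ⊢
      by_contra hlt
      refine hadm (Or.inl ⟨{l j, l (j + 1)}, {l k, l (k + 1)},
        goodPair_of_close (hstep j) (by omega), goodPair_of_close (hstep k) (by omega), ?_⟩)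
      refine four_le_map_range_iff.2 ⟨j, j + 1, k, k + 1, ?_, ?_, rfl, rfl, rfl, rfl⟩
      · simp
        omega
      · simp
        omega
    · refine hadm (Or.inr ⟨l (j + 1), four_le_map_range_iff.2
        ⟨j + 1, j + 2, j + 3, j, ?_, ?_, rfl, ?_, ?_, ?_⟩⟩)
      · simp
      · simp
        omega
      all_goals
        have := hstep j
        have := hstep (j + 1)
        have := hstep (j + 2)
        simp only [add_assoc, Nat.reduceAdd] at *
        omega
  · rintro hdiff (⟨P, Q, hP, hQ, hle⟩ | ⟨i, hle⟩)
    · obtain ⟨w, x, rfl, hwx, hxw⟩ := hP.exists_eq_pair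
      obtain ⟨y, z, rfl, hyz, hzy⟩ := hQ.exists_eq_pair
      obtain ⟨a, b, c, d, hnodup, hlt, rfl, rfl, rfl, rfl⟩ := four_le_map_range_iff.1 hle
      simp only [List.nodup_cons, List.mem_cons, List.not_mem_nil, or_false, not_or,
        List.nodup_nil, not_false_eq_true, and_true, forall_eq_or_imp, forall_eq] at hnodup hlt
      obtain ⟨a', b', hab, hab1, hab'⟩ := exists_ordered_pair hnodup.1.1 hwx hxw
      obtain ⟨c', d', hcd, hcd1, hcd'⟩ := exists_ordered_pair hnodup.2.2 hyz hzy
      obtain ⟨j, k, hjk, hk, hj1, hk1⟩ := exists_separated_steps (n := n) hl hab hcd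
        (by omega) (by omega) (by omega) (by omega) (by omega) (by omega) hab1 hcd1
      have : 2 ≤ l k - l (k + 1) := hdiff.1 j k hjk hk hj1
      omega
    · obtain ⟨a, b, c, d, hnodup, hlt, ha, hb, hc, hd⟩ := four_le_map_range_iff.1 hle
      simp only [List.nodup_cons, List.mem_cons, List.not_mem_nil, or_false, not_or,
        List.nodup_nil, not_false_eq_true, and_true, forall_eq_or_imp, forall_eq] at hnodup hlt
      exact not_admissibleDiffs_of_distinct hl hnodup.1.1 hnodup.1.2.1 hnodup.2.1.1
        hlt.1 hlt.2.1 hlt.2.2.1 ha hb hc hd hdiff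

theorem diffWeight_sub_add {l : ℕ → ℕ} (hl : Antitone l) (n : ℕ) :
    diffWeight n (fun j => l j - l (j + 1)) + n * l n = ∑ j ∈ range n, l j := by
  induction n with
  | zero => simp [diffWeight]
  | succ n ih =>
    rw [diffWeight_succ, Finset.sum_range_succ, ← ih]
    obtain ⟨c, hc⟩ := Nat.exists_eq_add_of_le (hl (Nat.le_succ n))
    rw [hc, Nat.succ_eq_add_one, Nat.add_sub_cancel_left]
    ring

theorem bijOn_differences (n : ℕ) :
    Set.BijOn (fun (l : ℕ → ℕ) j => l j - l (j + 1))
      {l | PartitionN n l ∧ Admissible n l} (supportedSeqs n (AdmissibleDiffs (n - 1))) := by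
  refine ⟨?_, ?_, ?_⟩
  · rintro l ⟨⟨hl, h0⟩, hadm⟩
    refine ⟨fun j hj => ?_, (admissible_iff hl n).1 hadm⟩
    simp [h0 j hj]
  · rintro l ⟨⟨hl, hl0⟩, -⟩ m ⟨⟨hm, hm0⟩, -⟩ hlm
    funext j
    by_cases hj : n ≤ j
    · rw [hl0 j hj, hm0 j hj]
    · refine Nat.decreasingInduction' (P := fun j => l j = m j) (n := n) (m := j)
        (fun i _ _ hi => ?_) (by omega) (by rw [hl0 n le_rfl, hm0 n le_rfl])
      have h : l i - l (i + 1) = m i - m (i + 1) := congrFun hlm i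
      have := hl (Nat.le_succ i)
      have := hm (Nat.le_succ i)
      simp only [Nat.succ_eq_add_one] at *
      omega
  · rintro f ⟨hf, hadm⟩
    have hanti : Antitone fun j => ∑ i ∈ Finset.Ico j n, f i := fun a b hab =>
      Finset.sum_le_sum_of_subset (Finset.Ico_subset_Ico_left hab)
    have hdiff : (fun j => ∑ i ∈ Finset.Ico j n, f i - ∑ i ∈ Finset.Ico (j + 1) n, f i) = f := by
      funext j
      by_cases hj : j < n
      · rw [Finset.sum_eq_sum_Ico_succ_bot hj, Nat.add_sub_cancel]
      · rw [Finset.Ico_eq_empty_of_le (by omega), hf j (by omega), Finset.sum_empty, Nat.zero_sub]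
    refine ⟨fun j => ∑ i ∈ Finset.Ico j n, f i, ⟨⟨hanti, fun j hj => ?_⟩, ?_⟩, hdiff⟩
    · simp [hj]
    · rw [admissible_iff hanti, hdiff]
      exact hadm

theorem mk_admCount (n : ℕ) :
    PowerSeries.mk (fun d => (admCount n d : ℚ)) = diffGF n (AdmissibleDiffs (n - 1)) := by
  rw [diffGF, weightGF_of_bijOn (c := 0) (w := fun l => ∑ j ∈ range n, l j) _ (bijOn_differences n)]
  · rw [pow_zero, one_mul, weightGF]
    congr 1
    funext d
    rw [admCount]
    congr 2
    ext l
    simp only [Set.mem_ofPred_eq]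
    tauto
  · rintro l ⟨⟨hl, h0⟩, -⟩
    rw [← diffWeight_sub_add hl n, h0 n le_rfl]
    simp

theorem constantCoeff_qPoch (s : ℕ) : PowerSeries.constantCoeff (qPoch s) = 1 := by
  simp [qPoch, map_prod]

theorem admissible_generating_function (n : ℕ) (hn : 4 ≤ n) :
    PowerSeries.mk (fun d => (admCount n d : ℚ)) =
      PowerSeries.X ^ ((n - 1) * (n - 3)) * (qPoch 1 * qPoch (n - 3))⁻¹
      + PowerSeries.X ^ ((n - 2) * (n - 1)) * (qPoch 1 * qPoch (n - 2))⁻¹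
      + PowerSeries.X ^ (n * (n - 1)) * (qPoch n)⁻¹ := by
  obtain ⟨r, rfl⟩ : ∃ r, n = r + 3 := ⟨n - 3, by omega⟩
  have hinv : ∀ s, qPoch 1 * qPoch s * (qPoch 1 * qPoch s)⁻¹ = 1 := fun s =>
    PowerSeries.mul_inv_cancel _ (by simp [constantCoeff_qPoch])
  have hU := hinv r
  have hV := hinv (r + 1)
  have hW := PowerSeries.mul_inv_cancel (qPoch (r + 3)) (by simp [constantCoeff_qPoch])
  have hG := diffGF_last_ge (AdmissibleDiffs.dependsOnFirst (r + 2)) 0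
  have hC := diffGF_admissibleDiffs (r + 1)
  rw [mk_admCount]
  simp only [Nat.zero_le, and_true, mul_zero, pow_zero, one_mul] at hG
  simp only [Nat.add_sub_cancel, show r + 3 - 1 = r + 2 by omega, show r + 3 - 2 = r + 1 by omega,
    add_assoc, Nat.reduceAdd] at hG hC ⊢
  have hne : (PowerSeries.X : PowerSeries ℚ) ^ (3 * (r + 2)) * (qPoch 1 * qPoch (r + 3)) ≠ 0 := by
    have hq : ∀ s, qPoch s ≠ 0 := fun s hs => by simpa [hs] using constantCoeff_qPoch s
    exact mul_ne_zero (pow_ne_zero _ PowerSeries.X_ne_zero) (mul_ne_zero (hq 1) (hq _))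
  have hq1 : qPoch 1 = 1 - PowerSeries.X := by simp [qPoch]
  apply mul_right_cancel₀ hne
  have hX : (PowerSeries.X : PowerSeries ℚ) ^ ((r + 2) * (r + 3)) =
      PowerSeries.X ^ (3 * (r + 2)) * PowerSeries.X ^ ((r + 2) * r) := by
    rw [← pow_add]
    congr 1
    ring
  have hX' : (PowerSeries.X : PowerSeries ℚ) ^ ((r + 1) * (r + 2)) =
      PowerSeries.X ^ (r + 2) * PowerSeries.X ^ ((r + 2) * r) := by
    rw [← pow_add]
    congr 1
    ring
  have h₁ := qPoch_succ r
  have h₂ := qPoch_succ (r + 1)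
  have h₃ := qPoch_succ (r + 2)
  simp only [add_assoc, Nat.reduceAdd] at h₁ h₂ h₃
  rw [mul_comm (r + 3), hX', hX]
  rw [hX] at hC
  generalize (qPoch 1 * qPoch r)⁻¹ = U at *
  generalize (qPoch 1 * qPoch (r + 1))⁻¹ = V at *
  generalize (qPoch (r + 3))⁻¹ = W at *
  rw [h₂, h₁] at hC
  rw [hq1, h₁] at hV
  rw [hq1] at hU
  rw [h₃, h₂, h₁] at hW
  rw [hq1, h₃, h₂, h₁]
  clear hne h₁ h₂ h₃ hq1 hinv hX hX'
  generalize qPoch r = p at *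
  generalize (PowerSeries.X : PowerSeries ℚ) ^ ((r + 2) * r) = Z at *
  generalize (PowerSeries.X : PowerSeries ℚ) = x at *
  linear_combination
    x ^ (3 * (r + 2)) * (1 - x) * p * (1 - x ^ (r + 1)) * (1 - x ^ (r + 2)) * hG + hC -
    Z * x ^ (3 * (r + 2)) * (1 - x ^ (r + 1)) * (1 - x ^ (r + 2)) * (1 - x ^ (r + 3)) * hU -
    x ^ (r + 2) * Z * x ^ (3 * (r + 2)) * (1 - x ^ (r + 2)) * (1 - x ^ (r + 3)) * hV -
    x ^ (3 * (r + 2)) * Z * x ^ (3 * (r + 2)) * (1 - x) * hW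
end

section
/- For every integer n ≥ 4 and every d ≥ 0, the dimension over ℂ of the space I_{n,d} is at most the number of admissible partitions λ ∈ π_{n,d}. -/
open MvPolynomial Finset

/-- The ideal `I_n` (degree-`d` component): symmetric polynomials in `n` variables over `ℂ`
vanishing under the substitution `x₂ := x₁`, `x₄ := x₃`, homogeneous of degree `d`. -/
noncomputable def IComponent (n : ℕ) (hn : 4 ≤ n) (d : ℕ) :
    Submodule ℂ (MvPolynomial (Fin n) ℂ) :=
  (Subalgebra.toSubmodule (MvPolynomial.symmetricSubalgebra (Fin n) ℂ) :
      Submodule ℂ (MvPolynomial (Fin n) ℂ)) ⊓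
  LinearMap.ker (MvPolynomial.aeval (R := ℂ)
      (fun i : Fin n => if (i : ℕ) = 1 then X (⟨0, by omega⟩ : Fin n)
        else if (i : ℕ) = 3 then X (⟨2, by omega⟩ : Fin n)
        else (X i : MvPolynomial (Fin n) ℂ))).toLinearMap ⊓
  MvPolynomial.homogeneousSubmodule (Fin n) ℂ d

/-- The multiset of exponents of a monomial. -/
def exponents {σ : Type*} [Fintype σ] (u : σ → ℕ) : Multiset ℕ := Finset.univ.val.map u

lemma exponents_comp_perm {σ : Type*} [Fintype σ] (u : σ → ℕ) (e : Equiv.Perm σ) :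
    exponents (u ∘ e) = exponents u := by
  unfold exponents
  rw [← Multiset.map_map, Multiset.map_univ_val_equiv]

lemma exists_perm_of_exponents_eq {n : ℕ} {u v : Fin n → ℕ} (h : exponents u = exponents v) :
    ∃ e : Equiv.Perm (Fin n), u = v ∘ e := by
  have h' : exponents (u ∘ Tuple.sort u) = exponents (v ∘ Tuple.sort v) := by
    simpa only [exponents_comp_perm] using h
  have hs : u ∘ Tuple.sort u = v ∘ Tuple.sort v := by
    unfold exponents at h'
    rw [Fin.univ_val_map, Fin.univ_val_map, Multiset.coe_eq_coe] at h'
    exact List.ofFn_injective (h'.eq_of_pairwise' (r := (· ≤ ·))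
      (Tuple.monotone_sort u).sortedLE_ofFn.pairwise
      (Tuple.monotone_sort v).sortedLE_ofFn.pairwise)
  refine ⟨(Tuple.sort u).symm.trans (Tuple.sort v), ?_⟩
  funext i
  simpa using congrFun hs ((Tuple.sort u).symm i)

lemma exists_exponents_eq {n : ℕ} {s : Multiset ℕ} (h : s.card = n) :
    ∃ u : Fin n → ℕ, exponents u = s := by
  subst h
  induction s using Quotient.inductionOn with
  | h L => exact ⟨L.get, (Fin.univ_val_map L.get).trans (congrArg _ (List.ofFn_get L))⟩

lemma coeff_eq_of_exponents_eq {n : ℕ} {f : MvPolynomial (Fin n) ℂ} (hf : f.IsSymmetric)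
    {u v : Fin n →₀ ℕ} (h : exponents u = exponents v) : f.coeff u = f.coeff v := by
  obtain ⟨e, he⟩ := exists_perm_of_exponents_eq h
  have hv : u.mapDomain e = v := by
    ext i
    rw [Finsupp.mapDomain_equiv_apply, he]
    simp
  rw [← hv, ← coeff_rename_mapDomain e e.injective f u, hf e]

lemma coeff_eq_zero_of_rename_eq_zero {σ τ : Type*} {f : MvPolynomial σ ℂ} {g : σ → τ}
    (hg : rename g f = 0) (v : σ →₀ ℕ)
    (h : ∀ u : σ →₀ ℕ, u.mapDomain g = v.mapDomain g → f.coeff u ≠ 0 → f.coeff u = f.coeff v) :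
    f.coeff v = 0 := by
  classical
  by_contra hv
  have hsum : (rename g f).coeff (v.mapDomain g) =
      ∑ u ∈ f.support with u.mapDomain g = v.mapDomain g, f.coeff u := by
    conv_lhs => rw [f.as_sum, map_sum, coeff_sum]
    simp only [rename_monomial, coeff_monomial, Finset.sum_filter]
  rw [hg, coeff_zero, Finset.sum_congr rfl (g := fun _ => f.coeff v)
    (fun u hu => h u (Finset.mem_filter.1 hu).2 (mem_support_iff.1 (Finset.mem_filter.1 hu).1)),
    Finset.sum_const, nsmul_eq_mul, eq_comm, mul_eq_zero, Nat.cast_eq_zero,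
    Finset.card_eq_zero] at hsum
  have : v ∈ ({u ∈ f.support | u.mapDomain g = v.mapDomain g} : Finset _) := by
    simpa using hv
  rcases hsum with h0 | h0
  · simp [h0] at this
  · exact hv h0

/-- The index map of the substitution `x₂ := x₁`, `x₄ := x₃`. -/
def doubleRootMap (m : ℕ) (i : Fin (m + 4)) : Fin (m + 4) :=
  if i = 1 then 0 else if i = 3 then 2 else i

lemma exponents_add_four {m : ℕ} (u : Fin (m + 4) → ℕ) :
    exponents u = {u 0, u 1, u 2, u 3} + exponents fun i : Fin m => u (i.addNat 4) := by
  unfold exponents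
  simp only [Fin.univ_val_map]
  rw [List.ofFn_succ, List.ofFn_succ, List.ofFn_succ, List.ofFn_succ]
  simp only [← Multiset.cons_coe, Multiset.insert_eq_cons, ← Multiset.singleton_add, add_assoc]
  rfl

lemma mapDomain_apply_eq_sum_filter {σ τ : Type*} [Fintype σ] [DecidableEq τ] (g : σ → τ)
    (u : σ →₀ ℕ) (j : τ) : u.mapDomain g j = ∑ i with g i = j, u i := by
  rw [Finsupp.mapDomain, Finsupp.sum_fintype _ _ (by simp), Finsupp.finsetSum_apply,
    Finset.sum_filter]
  simp [Finsupp.single_apply]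

lemma mapDomain_doubleRootMap {m : ℕ} {u v : Fin (m + 4) →₀ ℕ}
    (h : u.mapDomain (doubleRootMap m) = v.mapDomain (doubleRootMap m)) :
    u 0 + u 1 = v 0 + v 1 ∧ u 2 + u 3 = v 2 + v 3 ∧
      ∀ i : Fin m, u (i.addNat 4) = v (i.addNat 4) := by
  have e0 : ((0 : Fin (m + 4)) : ℕ) = 0 := rfl
  have e1 : ((1 : Fin (m + 4)) : ℕ) = 1 := rfl
  have e2 : ((2 : Fin (m + 4)) : ℕ) = 2 := rfl
  have e3 : ((3 : Fin (m + 4)) : ℕ) = 3 := rfl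
  have h01 : ((univ : Finset (Fin (m + 4))).filter fun i => doubleRootMap m i = 0) = {0, 1} := by
    ext i
    simp only [Finset.mem_filter_univ, Finset.mem_insert, Finset.mem_singleton]
    unfold doubleRootMap
    split_ifs <;> simp only [Fin.ext_iff, e0, e1, e2, e3] at * <;> grind
  have h23 : ((univ : Finset (Fin (m + 4))).filter fun i => doubleRootMap m i = 2) = {2, 3} := by
    ext i
    simp only [Finset.mem_filter_univ, Finset.mem_insert, Finset.mem_singleton]
    unfold doubleRootMap
    split_ifs <;> simp only [Fin.ext_iff, e0, e1, e2, e3] at * <;> grind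
  have hi (i : Fin m) : ((univ : Finset (Fin (m + 4))).filter fun k => doubleRootMap m k =
      i.addNat 4) = {i.addNat 4} := by
    ext k
    simp only [Finset.mem_filter_univ, Finset.mem_singleton]
    unfold doubleRootMap
    split_ifs <;> simp only [Fin.ext_iff, e0, e1, e2, e3, Fin.val_addNat] at * <;> omega
  have key := fun j => DFunLike.congr_fun h j
  simp only [mapDomain_apply_eq_sum_filter] at key
  refine ⟨?_, ?_, fun i => ?_⟩
  · have := key 0
    rwa [h01, Finset.sum_pair (by simp), Finset.sum_pair (by simp)] at this
  · have := key 2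
    have h2 : (2 : Fin (m + 4)) ≠ 3 := by simp only [ne_eq, Fin.ext_iff, e2, e3]; omega
    rwa [h23, Finset.sum_pair h2, Finset.sum_pair h2] at this
  · simpa only [hi, Finset.sum_singleton] using key (i.addNat 4)

/-- The relation among the coefficients of a symmetric polynomial with two double roots,
solved for a coefficient that dominates all others in the relation. -/
lemma coeff_eq_zero_of_relation {m : ℕ} {f : MvPolynomial (Fin (m + 4)) ℂ} (hf : f.IsSymmetric)
    (hg : rename (doubleRootMap m) f = 0) {a a' b b' : ℕ} {R : Multiset ℕ}
    {v : Fin (m + 4) →₀ ℕ} (hv : exponents v = {a, a', b, b'} + R)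
    (h : ∀ (p p' q q' : ℕ) (u : Fin (m + 4) →₀ ℕ), p + p' = a + a' → q + q' = b + b' →
      exponents u = {p, p', q, q'} + R → f.coeff u ≠ 0 → f.coeff u = f.coeff v) :
    f.coeff v = 0 := by
  have hcard : R.card = m := by
    have := congrArg Multiset.card hv
    simp [exponents] at this
    omega
  obtain ⟨r, rfl⟩ := exists_exponents_eq hcard
  let w : Fin (m + 4) →₀ ℕ := Finsupp.equivFunOnFinite.symm
    (Fin.cons a (Fin.cons a' (Fin.cons b (Fin.cons b' r))))
  have w0 : w 0 = a := rfl
  have w1 : w 1 = a' := rfl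
  have w2 : w 2 = b := rfl
  have w3 : w 3 = b' := rfl
  have wr : (fun i : Fin m => w (i.addNat 4)) = r := by
    funext i
    rfl
  have hw : exponents w = exponents v := by
    rw [hv, exponents_add_four, w0, w1, w2, w3, wr]
  have hc := coeff_eq_of_exponents_eq hf hw
  rw [← hc]
  refine coeff_eq_zero_of_rename_eq_zero hg w fun u hu hne => ?_
  obtain ⟨h01, h23, hr⟩ := mapDomain_doubleRootMap hu
  rw [hc]
  refine h (u 0) (u 1) (u 2) (u 3) u h01 h23 ?_ hne
  rw [exponents_add_four, ← wr]
  congr 2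
  funext i
  exact hr i

/-- An exponential weight; monomials of larger weight are smaller in the elimination order. -/
def expWeight (d : ℕ) (s : Multiset ℕ) : ℕ := (s.map fun i => 5 ^ (d - i)).sum

lemma expWeight_four_add (d a b c e : ℕ) (R : Multiset ℕ) :
    expWeight d ({a, b, c, e} + R) =
      5 ^ (d - a) + 5 ^ (d - b) + 5 ^ (d - c) + 5 ^ (d - e) + expWeight d R := by
  simp [expWeight]
  ring

lemma five_mul_pow_le {d p a : ℕ} (hp : p ≤ d) (h : p < a) : 5 * 5 ^ (d - a) ≤ 5 ^ (d - p) ∨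
    d < a := by
  by_cases hd : d < a
  · exact Or.inr hd
  · left
    rw [← pow_succ']
    exact Nat.pow_le_pow_right (by norm_num) (by omega)

lemma balanced_pair {d p p' a a' : ℕ} (hp : p ≤ d) (hp' : p' ≤ d) (ha : a' = a ∨ a' = a + 1)
    (h : p + p' = a + a') :
    (p = a ∧ p' = a') ∨ (p = a' ∧ p' = a) ∨
      5 ^ (d - a) + 5 ^ (d - a') < 5 ^ (d - p) + 5 ^ (d - p') := by
  have hle : 5 ^ (d - a') ≤ 5 ^ (d - a) := Nat.pow_le_pow_right (by norm_num) (by omega)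
  have hpos (x : ℕ) : 0 < 5 ^ (d - x) := by positivity
  have hpa := hpos a
  have hpp := hpos p
  have hpp' := hpos p'
  rcases lt_or_ge p a with h1 | h1
  · have := five_mul_pow_le hp h1
    omega
  · rcases lt_or_ge p' a with h2 | h2
    · have := five_mul_pow_le hp' h2
      omega
    · omega

lemma sum_eq_of_coeff_ne_zero {n d : ℕ} {f : MvPolynomial (Fin n) ℂ} (hd : f.IsHomogeneous d)
    {u : Fin n →₀ ℕ} (hu : f.coeff u ≠ 0) : ∑ i, u i = d := by
  rw [← Finsupp.degree_eq_sum, Finsupp.degree_eq_weight_one]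
  exact hd hu

lemma le_of_mem_exponents {n d : ℕ} {f : MvPolynomial (Fin n) ℂ} (hd : f.IsHomogeneous d)
    {u : Fin n →₀ ℕ} (hu : f.coeff u ≠ 0) {i : ℕ} (hi : i ∈ exponents u) : i ≤ d := by
  obtain ⟨k, -, rfl⟩ := Multiset.mem_map.1 hi
  rw [← sum_eq_of_coeff_ne_zero hd hu]
  exact Finset.single_le_sum (fun _ _ => Nat.zero_le _) (Finset.mem_univ k)

lemma coeff_eq_zero_of_goodPair {m d : ℕ} {f : MvPolynomial (Fin (m + 4)) ℂ}
    (hf : f.IsSymmetric) (hg : rename (doubleRootMap m) f = 0) (hd : f.IsHomogeneous d)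
    {v : Fin (m + 4) →₀ ℕ}
    (hmax : ∀ u, f.coeff u ≠ 0 → expWeight d (exponents u) ≤ expWeight d (exponents v))
    {P Q : Multiset ℕ} (hP : GoodPair P) (hQ : GoodPair Q)
    (h : P + Q ≤ exponents v) : f.coeff v = 0 := by
  obtain ⟨R, hR⟩ := Multiset.le_iff_exists_add.1 h
  obtain ⟨a, a', rfl, ha⟩ : ∃ a a', P = {a, a'} ∧ (a' = a ∨ a' = a + 1) := by
    obtain ⟨i, h | h⟩ := hP
    exacts [⟨i, i, h, by simp⟩, ⟨i, i + 1, h, by simp⟩]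
  obtain ⟨b, b', rfl, hb⟩ : ∃ a a', Q = {a, a'} ∧ (a' = a ∨ a' = a + 1) := by
    obtain ⟨i, h | h⟩ := hQ
    exacts [⟨i, i, h, by simp⟩, ⟨i, i + 1, h, by simp⟩]
  have hv : exponents v = {a, a', b, b'} + R := by
    rw [hR]
    simp [← Multiset.singleton_add, add_assoc]
  refine coeff_eq_zero_of_relation hf hg hv fun p p' q q' u hp hq hu hne => ?_
  have hw := hmax u hne
  have hle : ∀ i ∈ exponents u, i ≤ d := fun i => le_of_mem_exponents hd hne
  rw [hu] at hle
  rw [hu, hv, expWeight_four_add, expWeight_four_add] at hw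
  have hbp := balanced_pair (hle p (by simp)) (hle p' (by simp)) ha hp
  have hbq := balanced_pair (hle q (by simp)) (hle q' (by simp)) hb hq
  refine coeff_eq_of_exponents_eq hf ?_
  rw [hu, hv]
  congr 1
  have key : ({p, p'} : Multiset ℕ) = {a, a'} ∧ ({q, q'} : Multiset ℕ) = {b, b'} := by
    have e1 : (p = a ∧ p' = a') ∨ (p = a' ∧ p' = a) := by
      rcases hbp with h | h | h
      · exact Or.inl h
      · exact Or.inr h
      · rcases hbq with ⟨rfl, rfl⟩ | ⟨rfl, rfl⟩ | h' <;> omega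
    have e2 : (q = b ∧ q' = b') ∨ (q = b' ∧ q' = b) := by
      rcases hbq with h | h | h
      · exact Or.inl h
      · exact Or.inr h
      · rcases e1 with ⟨rfl, rfl⟩ | ⟨rfl, rfl⟩ <;> omega
    constructor
    · rcases e1 with ⟨rfl, rfl⟩ | ⟨rfl, rfl⟩
      exacts [rfl, Multiset.pair_comm _ _]
    · rcases e2 with ⟨rfl, rfl⟩ | ⟨rfl, rfl⟩
      exacts [rfl, Multiset.pair_comm _ _]
  have split (x y z t : ℕ) : ({x, y, z, t} : Multiset ℕ) = {x, y} + {z, t} := by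
    simp [← Multiset.singleton_add, add_assoc]
  rw [split, split, key.1, key.2]

lemma coeff_eq_zero_of_cube {m d : ℕ} {f : MvPolynomial (Fin (m + 4)) ℂ}
    (hf : f.IsSymmetric) (hg : rename (doubleRootMap m) f = 0) (hd : f.IsHomogeneous d)
    {v : Fin (m + 4) →₀ ℕ}
    (hmax : ∀ u, f.coeff u ≠ 0 → expWeight d (exponents u) ≤ expWeight d (exponents v))
    {i : ℕ} (h : ({i, i, i, i + 2} : Multiset ℕ) ≤ exponents v) :
    f.coeff v = 0 := by
  obtain ⟨R, hv⟩ := Multiset.le_iff_exists_add.1 h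
  have hbound {p p' q q' : ℕ} {u : Fin (m + 4) →₀ ℕ} (hu : exponents u = {p, p', q, q'} + R)
      (hs : p + p' + q + q' = 4 * i + 2) (hne : f.coeff u ≠ 0) :
      i ≤ p ∧ i ≤ p' ∧ i ≤ q ∧ i ≤ q' := by
    have hw := hmax u hne
    have hle : ∀ j ∈ exponents u, j ≤ d := fun j => le_of_mem_exponents hd hne
    rw [hu] at hle
    rw [hu, hv, expWeight_four_add, expWeight_four_add] at hw
    have hp := hle p (by simp)
    have hp' := hle p' (by simp)
    have hq := hle q (by simp)
    have hq' := hle q' (by simp)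
    have h2 : 5 ^ (d - (i + 2)) ≤ 5 ^ (d - i) := Nat.pow_le_pow_right (by norm_num) (by omega)
    have hpos (x : ℕ) : 0 < 5 ^ (d - x) := by positivity
    have hi := hpos i
    have h3 := hpos p
    have h4 := hpos p'
    have h5 := hpos q
    have h6 := hpos q'
    have low {x : ℕ} (hx : x ≤ d) (hlt : x < i) := five_mul_pow_le hx hlt
    refine ⟨?_, ?_, ?_, ?_⟩ <;> by_contra! hlt
    · have := low hp hlt; omega
    · have := low hp' hlt; omega
    · have := low hq hlt; omega
    · have := low hq' hlt; omega
  refine coeff_eq_zero_of_relation hf hg hv fun p p' q q' u hp hq hu hne => ?_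
  obtain ⟨b1, b2, b3, b4⟩ := hbound hu (by omega) hne
  obtain rfl : p = i := by omega
  obtain rfl : p' = p := by omega
  have hcases : (q = p' ∧ q' = p' + 2) ∨ (q = p' + 2 ∧ q' = p') ∨ (q = p' + 1 ∧ q' = p' + 1) := by
    omega
  rcases hcases with ⟨rfl, rfl⟩ | ⟨rfl, rfl⟩ | ⟨rfl, rfl⟩
  · exact coeff_eq_of_exponents_eq hf (hu.trans hv.symm)
  · refine coeff_eq_of_exponents_eq hf ?_
    rw [hu, hv, Multiset.pair_comm (q' + 2)]
  · refine absurd ?_ hne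
    have hu' : exponents u = {p', p' + 1, p', p' + 1} + R := by
      rw [hu]
      congr 1
      exact congrArg _ (Multiset.cons_swap _ _ _)
    refine coeff_eq_zero_of_relation hf hg hu' fun x x' y y' t hx hy ht htne => ?_
    have := hbound ht (by omega) htne
    refine coeff_eq_of_exponents_eq hf ?_
    rw [ht, hu']
    congr 1
    have split (x y z t : ℕ) : ({x, y, z, t} : Multiset ℕ) = {x, y} + {z, t} := by
      simp [← Multiset.singleton_add, add_assoc]
    rw [split, split]
    congr 1
    · obtain ⟨rfl, rfl⟩ | ⟨rfl, rfl⟩ : (x = p' ∧ x' = p' + 1) ∨ (x = p' + 1 ∧ x' = p') := by omega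
      exacts [rfl, Multiset.pair_comm _ _]
    · obtain ⟨rfl, rfl⟩ | ⟨rfl, rfl⟩ : (y = p' ∧ y' = p' + 1) ∨ (y = p' + 1 ∧ y' = p') := by omega
      exacts [rfl, Multiset.pair_comm _ _]

/-- The monomial with exponent `l i` at the variable `i`. -/
noncomputable def partitionMonomial (n : ℕ) (l : ℕ → ℕ) : Fin n →₀ ℕ :=
  Finsupp.equivFunOnFinite.symm fun i => l i

lemma exponents_partitionMonomial (n : ℕ) (l : ℕ → ℕ) :
    exponents (partitionMonomial n l) = (Finset.range n).val.map l := by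
  simp only [exponents, partitionMonomial, Finsupp.equivFunOnFinite_symm_apply_apply]
  rw [Fin.univ_val_map, Finset.range_val, ← Multiset.coe_range, Multiset.map_coe, List.ofFn_eq_map,
    ← List.map_coe_finRange_eq_range, List.map_map]
  rfl

lemma exists_partitionN {n : ℕ} (v : Fin n → ℕ) :
    ∃ l, PartitionN n l ∧ (Finset.range n).val.map l = exponents v := by
  let l : ℕ → ℕ := fun j => if h : j < n then v (Tuple.sort v (Fin.rev ⟨j, h⟩)) else 0
  refine ⟨l, ⟨fun j k hjk => ?_, fun j hj => dif_neg (by omega)⟩, ?_⟩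
  · by_cases hk : k < n
    · simp only [l, dif_pos hk, dif_pos (hjk.trans_lt hk)]
      exact Tuple.monotone_sort v (Fin.rev_le_rev.2 hjk)
    · simp [l, hk]
  · rw [← exponents_partitionMonomial, ← exponents_comp_perm v (Tuple.sort v),
      ← exponents_comp_perm _ Fin.revPerm]
    congr 1
    funext i
    simp [partitionMonomial, l]

lemma finite_admissible (n d : ℕ) :
    {l : ℕ → ℕ | PartitionN n l ∧ (∑ j ∈ Finset.range n, l j) = d ∧ Admissible n l}.Finite := by
  refine Set.Finite.of_injOn (f := fun l (i : Fin n) => l i)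
    (t := Set.Iic fun _ => d) (fun l hl => ?_) (fun l hl l' hl' h => ?_) (Set.finite_Iic _)
  · intro i
    dsimp only
    rw [← hl.2.1]
    exact Finset.single_le_sum (fun _ _ => Nat.zero_le _) (Finset.mem_range.2 i.2)
  · funext j
    by_cases hj : j < n
    · exact congrFun h ⟨j, hj⟩
    · rw [hl.1.2 j (by omega), hl'.1.2 j (by omega)]

lemma eq_zero_of_admissible_coeff_eq_zero {m d : ℕ} {f : MvPolynomial (Fin (m + 4)) ℂ}
    (hf : f.IsSymmetric) (hg : rename (doubleRootMap m) f = 0) (hd : f.IsHomogeneous d)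
    (h : ∀ l, PartitionN (m + 4) l → (∑ j ∈ Finset.range (m + 4), l j) = d →
      Admissible (m + 4) l → f.coeff (partitionMonomial (m + 4) l) = 0) : f = 0 := by
  by_contra hne
  obtain ⟨v, hv, hmax⟩ := f.support.exists_max_image (fun u => expWeight d (exponents u))
    (support_nonempty.2 hne)
  rw [mem_support_iff] at hv
  have hmax' : ∀ u, f.coeff u ≠ 0 → expWeight d (exponents u) ≤ expWeight d (exponents v) :=
    fun u hu => hmax u (mem_support_iff.2 hu)
  obtain ⟨l, hl, hlv⟩ := exists_partitionN v
  by_cases hadm : Admissible (m + 4) l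
  · refine hv ?_
    rw [← coeff_eq_of_exponents_eq hf ((exponents_partitionMonomial _ l).trans hlv)]
    refine h l hl ?_ hadm
    exact (congrArg Multiset.sum hlv).trans (sum_eq_of_coeff_ne_zero hd hv)
  · rcases not_not.1 hadm with ⟨P, Q, hP, hQ, hle⟩ | ⟨i, hle⟩
    · exact hv (coeff_eq_zero_of_goodPair hf hg hd hmax' hP hQ (hlv ▸ hle))
    · exact hv (coeff_eq_zero_of_cube hf hg hd hmax' (hlv ▸ hle))

theorem dim_In_le_admissible_count (n : ℕ) (hn : 4 ≤ n) (d : ℕ) :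
    Module.finrank ℂ (IComponent n hn d) ≤ admCount n d := by
  obtain ⟨m, rfl⟩ := Nat.exists_eq_add_of_le' hn
  set A := {l : ℕ → ℕ | PartitionN (m + 4) l ∧ (∑ j ∈ Finset.range (m + 4), l j) = d ∧
    Admissible (m + 4) l} with hA
  have : Fintype A := (finite_admissible (m + 4) d).fintype
  let φ : IComponent (m + 4) hn d →ₗ[ℂ] A → ℂ :=
    LinearMap.pi (fun l => lcoeff ℂ (partitionMonomial (m + 4) l.1)) ∘ₗ Submodule.subtype _
  have hφ : Function.Injective φ := by
    rw [injective_iff_map_eq_zero]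
    rintro ⟨f, ⟨hf, hker⟩, hd⟩ h0
    refine Subtype.ext (eq_zero_of_admissible_coeff_eq_zero hf ?_ hd fun l h1 h2 h3 =>
      congrFun h0 ⟨l, h1, h2, h3⟩)
    have hker' := LinearMap.mem_ker.1 hker
    rw [AlgHom.toLinearMap_apply] at hker'
    rw [← hker', rename_eq_aeval]
    congr 2
    funext i
    simp only [Function.comp_apply, doubleRootMap, apply_ite X, Fin.ext_iff]
    rfl
  calc Module.finrank ℂ (IComponent (m + 4) hn d) ≤ Module.finrank ℂ (A → ℂ) :=
        LinearMap.finrank_le_finrank_of_injective hφ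
    _ = admCount (m + 4) d := by
        rw [Module.finrank_fintype_fun_eq_card, admCount, ← hA, ← Nat.card_coe_set_eq,
          Nat.card_eq_fintype_card]
end

section
/- Let n ≥ 4 and let λ be a partition of Case A with n parts, with distinguished index i (so λ_i = λ_{i+1} = λ_{i+2} = λ_{i+3} + 2). Then there exist exactly two partitions μ ≠ λ with n parts such that the multisets {j + 2λ_j : 1 ≤ j ≤ n} and {j + 2μ_j : 1 ≤ j ≤ n} coincide; namely, μ agrees with λ in all entries except (μ_i, μ_{i+1}, μ_{i+2}, μ_{i+3}) = (λ_i+1, λ_i−1, λ_i−1, λ_i−1) or (μ_i, μ_{i+1}, μ_{i+2}, μ_{i+3}) = (λ_i+1, λ_i, λ_i−1, λ_i−2). -/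
open Finset

/-- `λ` is of Case A with (0-based) distinguished index `i`:
`λ_i = λ_{i+1} = λ_{i+2} = λ_{i+3} + 2`; `λ_{i-1} - λ_i > 2` whenever `i ≥ 1` (0-based);
and `λ_j - λ_{j+1} ≥ 2` for all `j ≤ i-2` or `j ≥ i+3` (0-based). -/
def CaseA (n : ℕ) (l : ℕ → ℕ) (i : ℕ) : Prop :=
  i + 4 ≤ n ∧
  l i = l (i + 1) ∧ l (i + 1) = l (i + 2) ∧ l (i + 2) = l (i + 3) + 2 ∧
  (1 ≤ i → l i + 2 < l (i - 1)) ∧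
  (∀ j, j + 1 < n → (j + 2 ≤ i ∨ i + 3 ≤ j) → l (j + 1) + 2 ≤ l j)

/-- The multiset `{j + 2 λ_j : 1 ≤ j ≤ n}` (with 1-based index `j`, i.e. the 0-based entry
`l j` contributes `(j+1) + 2 l j`). -/
def msInv (n : ℕ) (l : ℕ → ℕ) : Multiset ℕ :=
  (Finset.range n).val.map (fun j => j + 1 + 2 * l j)

theorem msInv_eq_of_perm {n : ℕ} {l m : ℕ → ℕ} (σ : Equiv.Perm ℕ)
    (hσ : ∀ j, σ j ≠ j → j < n) (h : ∀ j < n, j + 1 + 2 * m j = σ j + 1 + 2 * l (σ j)) :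
    msInv n m = msInv n l := by
  have hs : (range n).map σ.toEmbedding = range n :=
    Finset.map_perm fun j hj => by simpa using hσ j hj
  unfold msInv
  conv_rhs => rw [← hs, Finset.map_val, Multiset.map_map]
  exact Multiset.map_congr rfl fun j hj => h j (by simpa using hj)

theorem exists_eq_of_msInv_eq {n : ℕ} {l m : ℕ → ℕ} (h : msInv n m = msInv n l)
    {j : ℕ} (hj : j < n) : ∃ k < n, k + 1 + 2 * m k = j + 1 + 2 * l j := by
  have hmem : j + 1 + 2 * l j ∈ msInv n m := by
    rw [h]
    exact Multiset.mem_map_of_mem _ (by simpa using hj)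
  obtain ⟨k, hk, e⟩ := Multiset.mem_map.1 hmem
  exact ⟨k, by simpa using hk, e⟩

/-- If `t` is not one of the numbers `j + 1 + 2 * m j`, the indices at which these numbers
exceed `t` form an initial segment. -/
theorem filter_lt_eq_range {n t : ℕ} {m : ℕ → ℕ} (hm : Antitone m)
    (ht : ∀ j < n, j + 1 + 2 * m j ≠ t) :
    (range n).filter (fun j => t < j + 1 + 2 * m j) =
      range ((range n).filter (fun j => t < j + 1 + 2 * m j)).card := by
  set s := (range n).filter (fun j => t < j + 1 + 2 * m j) with hs
  have hpred : ∀ j, j + 1 ∈ s → j ∈ s := fun j hj => by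
    simp only [hs, mem_filter, mem_range] at hj ⊢
    have := ht j (by lia)
    have := hm (Nat.le_succ j)
    lia
  have hdown : ∀ k j, j ≤ k → k ∈ s → j ∈ s := fun k j hjk => by
    induction k, hjk using Nat.le_induction with
    | base => exact id
    | succ k _ ih => exact fun hk => ih (hpred k hk)
  have hsub : s ⊆ range s.card := fun k hk => by
    have : range (k + 1) ⊆ s := fun j hj => hdown k j (by simpa [Nat.lt_succ_iff] using hj) hk
    simpa using card_le_card this
  exact eq_of_subset_of_card_le hsub (by simp)

theorem lt_iff_of_msInv_eq {n t : ℕ} {l m : ℕ → ℕ} (hl : Antitone l) (hm : Antitone m)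
    (h : msInv n m = msInv n l) (ht : ∀ j < n, j + 1 + 2 * l j ≠ t) {j : ℕ} (hj : j < n) :
    t < j + 1 + 2 * m j ↔ t < j + 1 + 2 * l j := by
  have htm : ∀ j < n, j + 1 + 2 * m j ≠ t := fun j hj e => by
    obtain ⟨k, hk, e'⟩ := exists_eq_of_msInv_eq h.symm hj
    exact ht k hk (e'.trans e)
  have hcard : ((range n).filter (fun j => t < j + 1 + 2 * m j)).card =
      ((range n).filter (fun j => t < j + 1 + 2 * l j)).card := by
    have := congrArg (Multiset.countP (fun x => t < x)) h
    simpa only [msInv, Multiset.countP_map, ← Finset.filter_val, Finset.card_val] using this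
  have hset := filter_lt_eq_range hm htm
  rw [hcard, ← filter_lt_eq_range hl ht] at hset
  simpa [hj] using Finset.ext_iff.1 hset j

/-- Gaps in `j + 1 + 2 * l j` away from the four consecutive indices starting at `i`. -/
theorem CaseA.add_three_le {n i : ℕ} {l : ℕ → ℕ} (hA : CaseA n l i)
    {j k : ℕ} (hjk : j < k) (hk : k < n) (h : j < i ∨ i + 4 ≤ k) :
    k + 1 + 2 * l k + 3 ≤ j + 1 + 2 * l j := by
  obtain ⟨h4, h01, h12, h23, hprev, hgap⟩ := hA
  have low : ∀ b a, a ≤ b → b < i → l b + 2 * (b - a) ≤ l a := fun b a hab => by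
    induction b, hab using Nat.le_induction with
    | base => lia
    | succ b _ ih =>
      intro hb
      have := hgap b (by lia) (by lia)
      have := ih (by lia)
      lia
  have high : ∀ b a, a ≤ b → i + 3 ≤ a → b < n → l b + 2 * (b - a) ≤ l a := fun b a hab => by
    induction b, hab using Nat.le_induction with
    | base => lia
    | succ b _ ih =>
      intro ha hb
      have := hgap b (by lia) (by lia)
      have := ih ha (by lia)
      lia
  have hfar : i + 4 ≤ k → l k + 2 * (k - (i + 3)) ≤ l (i + 3) := fun h' =>
    high k (i + 3) (by lia) le_rfl hk
  have hmid : ∀ a, i ≤ a → a < i + 4 → a = i ∨ a = i + 1 ∨ a = i + 2 ∨ a = i + 3 := by lia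
  rcases lt_or_ge j i with hj | hj
  · have hji := low (i - 1) j (by lia) (by lia)
    have := hprev (by lia)
    rcases lt_or_ge k i with hki | hki
    · have := low k j hjk.le hki
      lia
    · rcases lt_or_ge k (i + 4) with hk4 | hk4
      · rcases hmid k hki hk4 with rfl | rfl | rfl | rfl <;> lia
      · have := hfar hk4
        lia
  · have hk4 : i + 4 ≤ k := by lia
    have := hfar hk4
    rcases lt_or_ge j (i + 4) with hj4 | hj4
    · rcases hmid j hj hj4 with rfl | rfl | rfl | rfl <;> lia
    · have := high k j hjk.le (by lia) hk
      lia

/-- A partition with the same invariant as a Case A partition agrees with it outside the four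
distinguished indices. -/
theorem CaseA.eq_of_msInv_eq {n i : ℕ} {l m : ℕ → ℕ} (hl : Antitone l) (hm : Antitone m)
    (hA : CaseA n l i) (h : msInv n m = msInv n l) {j : ℕ} (hj : j < n)
    (hij : j < i ∨ i + 4 ≤ j) : m j = l j := by
  have hsep : ∀ k < n, k ≠ j → k + 1 + 2 * l k + 3 ≤ j + 1 + 2 * l j ∨
      j + 1 + 2 * l j + 3 ≤ k + 1 + 2 * l k := fun k hk hkj => by
    rcases lt_or_gt_of_ne hkj with hlt | hlt
    · exact Or.inr (hA.add_three_le hlt hj (by lia))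
    · exact Or.inl (hA.add_three_le hlt hk (by lia))
  have hlow := lt_iff_of_msInv_eq (t := j + 2 * l j) hl hm h (fun k hk => by
    rcases eq_or_ne k j with rfl | hkj
    · lia
    · have := hsep k hk hkj
      lia) hj
  have hup := lt_iff_of_msInv_eq (t := j + 2 + 2 * l j) hl hm h (fun k hk => by
    rcases eq_or_ne k j with rfl | hkj
    · lia
    · have := hsep k hk hkj
      lia) hj
  lia

theorem CaseA.eq_or_eq_or_eq {n i : ℕ} {l m : ℕ → ℕ} (hl : Antitone l) (hm : Antitone m)
    (hA : CaseA n l i) (h : msInv n m = msInv n l) :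
    (m i = l i ∧ m (i + 1) = l i ∧ m (i + 2) = l i ∧ m (i + 3) + 2 = l i) ∨
    (m i = l i + 1 ∧ m (i + 1) + 1 = l i ∧ m (i + 2) + 1 = l i ∧ m (i + 3) + 1 = l i) ∨
    (m i = l i + 1 ∧ m (i + 1) = l i ∧ m (i + 2) + 1 = l i ∧ m (i + 3) + 2 = l i) := by
  have hA' := hA
  obtain ⟨h4, h01, h12, h23, -, -⟩ := hA'
  have hmid : ∀ a, i ≤ a → a < i + 4 → a = i ∨ a = i + 1 ∨ a = i + 2 ∨ a = i + 3 := by lia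
  have hout : ∀ k < n, k < i ∨ i + 4 ≤ k → k + 1 + 2 * l k + 3 ≤ i + 2 * l i ∨
      i + 6 + 2 * l i ≤ k + 1 + 2 * l k := fun k hk hik => by
    rcases hik with hki | hki
    · have := hA.add_three_le (j := k) (k := i + 2) (by lia) (by lia) (Or.inl hki)
      lia
    · have := hA.add_three_le (j := i + 3) (k := k) (by lia) hk (Or.inr hki)
      lia
  have hin : ∀ k, i ≤ k → k < i + 4 → i + 2 * l i ≤ k + 1 + 2 * l k ∧
      k + 1 + 2 * l k ≤ i + 3 + 2 * l i := fun k hk hk4 => by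
    rcases hmid k hk hk4 with rfl | rfl | rfl | rfl <;> lia
  have hbound : ∀ k, i ≤ k → k < i + 4 → i + 2 * l i ≤ k + 1 + 2 * m k ∧
      k + 1 + 2 * m k ≤ i + 4 + 2 * l i := fun k hk hk4 => by
    have hpos := lt_iff_of_msInv_eq (t := i + 2 * l i - 1) hl hm h (fun j hj => by
      by_cases hji : j < i ∨ i + 4 ≤ j
      · have := hout j hj hji
        lia
      · have := hin j (by lia) (by lia)
        lia) (j := k) (by lia)
    have hup := lt_iff_of_msInv_eq (t := i + 4 + 2 * l i) hl hm h (fun j hj => by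
      by_cases hji : j < i ∨ i + 4 ≤ j
      · have := hout j hj hji
        lia
      · have := hin j (by lia) (by lia)
        lia) (j := k) (by lia)
    have := hin k hk hk4
    lia
  have hattain : ∀ p, i ≤ p → p < i + 4 → ∃ k, (k = i ∨ k = i + 1 ∨ k = i + 2 ∨ k = i + 3) ∧
      k + 1 + 2 * m k = p + 1 + 2 * l p := fun p hp hp4 => by
    obtain ⟨k, hk, e⟩ := exists_eq_of_msInv_eq h (j := p) (by lia)
    by_cases hki : k < i ∨ i + 4 ≤ k
    · have := hA.eq_of_msInv_eq hl hm h hk hki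
      have := hout k hk hki
      have := hin p hp hp4
      lia
    · exact ⟨k, hmid k (by lia) (by lia), e⟩
  have b0 := hbound i (by lia) (by lia)
  have b1 := hbound (i + 1) (by lia) (by lia)
  have b2 := hbound (i + 2) (by lia) (by lia)
  have b3 := hbound (i + 3) (by lia) (by lia)
  have m01 : m (i + 1) ≤ m i := hm (by lia)
  have m12 : m (i + 2) ≤ m (i + 1) := hm (by lia)
  have m23 : m (i + 3) ≤ m (i + 2) := hm (by lia)
  obtain ⟨k0, c0, e0⟩ := hattain i (by lia) (by lia)
  obtain ⟨k1, c1, e1⟩ := hattain (i + 1) (by lia) (by lia)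
  obtain ⟨k2, c2, e2⟩ := hattain (i + 2) (by lia) (by lia)
  obtain ⟨k3, c3, e3⟩ := hattain (i + 3) (by lia) (by lia)
  have a0 : m i = l i ∨ m (i + 2) + 1 = l i := by
    rcases c0 with rfl | rfl | rfl | rfl <;> lia
  have a1 : m (i + 1) = l i ∨ m (i + 3) + 1 = l i := by
    rcases c1 with rfl | rfl | rfl | rfl <;> lia
  have a2 : m i = l i + 1 ∨ m (i + 2) = l i := by
    rcases c2 with rfl | rfl | rfl | rfl <;> lia
  have a3 : m (i + 1) + 1 = l i ∨ m (i + 3) + 2 = l i := by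
    rcases c3 with rfl | rfl | rfl | rfl <;> lia
  lia

/-- For a Case A partition `λ` there are exactly two partitions `μ ≠ λ` with the same
multiset `{j + 2λ_j}`, namely the two explicitly given ones. -/
theorem caseA_exactly_two (n : ℕ) (hn : 4 ≤ n) (l : ℕ → ℕ) (hl : PartitionN n l)
    (i : ℕ) (hA : CaseA n l i) :
    let μA : ℕ → ℕ := fun j => if j = i then l i + 1 else
      if j = i + 1 ∨ j = i + 2 ∨ j = i + 3 then l i - 1 else l j
    let μB : ℕ → ℕ := fun j => if j = i then l i + 1 else if j = i + 1 then l i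
      else if j = i + 2 then l i - 1 else if j = i + 3 then l i - 2 else l j
    μA ≠ μB ∧
    {μ : ℕ → ℕ | PartitionN n μ ∧ μ ≠ l ∧ msInv n μ = msInv n l} = {μA, μB} := by
  intro μA μB
  have hA' := hA
  obtain ⟨h4, h01, h12, h23, hprev, hgap⟩ := hA'
  obtain ⟨hanti, hzero⟩ := hl
  have hnext : l (i + 4) + 2 ≤ l (i + 3) ∨ l (i + 4) = 0 := by
    rcases lt_or_ge (i + 4) n with h | h
    · exact Or.inl (hgap (i + 3) h (by lia))
    · exact Or.inr (hzero _ h)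
  have A0 : μA i = l i + 1 := by simp [μA]
  have A1 : μA (i + 1) = l i - 1 := by simp [μA]
  have A2 : μA (i + 2) = l i - 1 := by simp [μA]
  have A3 : μA (i + 3) = l i - 1 := by simp [μA]
  have Aout : ∀ j, j < i ∨ i + 4 ≤ j → μA j = l j := fun j hj => by
    simp only [μA]
    rw [if_neg (by lia), if_neg (by lia)]
  have B0 : μB i = l i + 1 := by simp [μB]
  have B1 : μB (i + 1) = l i := by simp [μB]
  have B2 : μB (i + 2) = l i - 1 := by simp [μB]
  have B3 : μB (i + 3) = l i - 2 := by simp [μB]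
  have Bout : ∀ j, j < i ∨ i + 4 ≤ j → μB j = l j := fun j hj => by
    simp only [μB]
    rw [if_neg (by lia), if_neg (by lia), if_neg (by lia), if_neg (by lia)]
  have hcases : ∀ j, j + 1 < i ∨ j + 1 = i ∨ j = i ∨ j = i + 1 ∨ j = i + 2 ∨ j = i + 3 ∨
      i + 4 ≤ j := by lia
  have hpart : ∀ m : ℕ → ℕ, (∀ j, j < i ∨ i + 4 ≤ j → m j = l j) → m i = l i + 1 →
      m (i + 1) ≤ m i → m (i + 2) ≤ m (i + 1) → m (i + 3) ≤ m (i + 2) →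
      l (i + 3) ≤ m (i + 3) → PartitionN n m := fun m hout h0 h1 h2 h3 h3' => by
    refine ⟨antitone_nat_of_succ_le fun j => ?_, fun j hj => ?_⟩
    · have := hanti (Nat.le_succ j)
      rcases hcases j with h | h | rfl | rfl | rfl | rfl | h
      · rw [hout j (by lia), hout (j + 1) (by lia)]
        exact this
      · subst h
        have := hprev (by lia)
        rw [hout j (by lia), h0]
        simp only [Nat.add_sub_cancel] at this
        lia
      · exact h1
      · exact h2
      · exact h3
      · rw [hout (i + 3 + 1) (by lia)]
        exact this.trans h3'
      · rw [hout j (by lia), hout (j + 1) (by lia)]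
        exact this
    · rw [hout j (by lia)]
      exact hzero j hj
  have hB : msInv n μB = msInv n l := by
    refine msInv_eq_of_perm (Equiv.swap i (i + 2)) (fun j hj => ?_) fun j hj => ?_
    · by_contra hjn
      exact hj (Equiv.swap_apply_of_ne_of_ne (by lia) (by lia))
    · by_cases hj' : j < i ∨ i + 4 ≤ j
      · rw [Equiv.swap_apply_of_ne_of_ne (by lia) (by lia), Bout j hj']
      · obtain rfl | rfl | rfl | rfl : j = i ∨ j = i + 1 ∨ j = i + 2 ∨ j = i + 3 := by lia
        · rw [Equiv.swap_apply_left]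
          lia
        · rw [Equiv.swap_apply_of_ne_of_ne (by lia) (by lia)]
          lia
        · rw [Equiv.swap_apply_right]
          lia
        · rw [Equiv.swap_apply_of_ne_of_ne (by lia) (by lia)]
          lia
  have hAB : msInv n μA = msInv n μB := by
    refine msInv_eq_of_perm (Equiv.swap (i + 1) (i + 3)) (fun j hj => ?_) fun j hj => ?_
    · by_contra hjn
      exact hj (Equiv.swap_apply_of_ne_of_ne (by lia) (by lia))
    · by_cases hj' : j < i ∨ i + 4 ≤ j
      · rw [Equiv.swap_apply_of_ne_of_ne (by lia) (by lia), Aout j hj', Bout j hj']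
      · obtain rfl | rfl | rfl | rfl : j = i ∨ j = i + 1 ∨ j = i + 2 ∨ j = i + 3 := by lia
        · rw [Equiv.swap_apply_of_ne_of_ne (by lia) (by lia)]
          lia
        · rw [Equiv.swap_apply_left]
          lia
        · rw [Equiv.swap_apply_of_ne_of_ne (by lia) (by lia)]
          lia
        · rw [Equiv.swap_apply_right]
          lia
  have hext : ∀ m m' : ℕ → ℕ, (∀ j, j < i ∨ i + 4 ≤ j → m j = m' j) → m i = m' i →
      m (i + 1) = m' (i + 1) → m (i + 2) = m' (i + 2) → m (i + 3) = m' (i + 3) → m = m' :=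
    fun m m' hout h0 h1 h2 h3 => funext fun j => by
      by_cases hj : j < i ∨ i + 4 ≤ j
      · exact hout j hj
      · obtain rfl | rfl | rfl | rfl : j = i ∨ j = i + 1 ∨ j = i + 2 ∨ j = i + 3 := by lia
        all_goals assumption
  refine ⟨fun e => ?_, Set.ext fun m => ⟨?_, ?_⟩⟩
  · have := congrFun e (i + 1)
    lia
  · rintro ⟨⟨hm, hm0⟩, hne, hinv⟩
    have hout : ∀ j, j < i ∨ i + 4 ≤ j → m j = l j := fun j hj => by
      rcases lt_or_ge j n with hjn | hjn
      · exact hA.eq_of_msInv_eq hanti hm hinv hjn hj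
      · rw [hm0 j hjn, hzero j hjn]
    rcases hA.eq_or_eq_or_eq hanti hm hinv with h | h | h
    · exact absurd (hext m l hout (by lia) (by lia) (by lia) (by lia)) hne
    · exact Or.inl (hext m μA (fun j hj => (hout j hj).trans (Aout j hj).symm)
        (by lia) (by lia) (by lia) (by lia))
    · exact Or.inr (hext m μB (fun j hj => (hout j hj).trans (Bout j hj).symm)
        (by lia) (by lia) (by lia) (by lia))
  · rintro (rfl | rfl)
    · refine ⟨hpart μA Aout A0 (by lia) (by lia) (by lia) (by lia), fun e => ?_, hAB.trans hB⟩
      have := congrFun e i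
      lia
    · refine ⟨hpart μB Bout B0 (by lia) (by lia) (by lia) (by lia), fun e => ?_, hB⟩
      have := congrFun e i
      lia
end

section
/- Let n ≥ 4 and let λ be a partition of Case A with n parts. Then there is no partition μ with n parts such that μ ≠ λ, μ is strictly smaller than λ in the dominance order (i.e. |μ| = |λ| and Σ_{j≤k} μ_j ≤ Σ_{j≤k} λ_j for all k), and the multisets {j + 2λ_j : 1 ≤ j ≤ n} and {j + 2μ_j : 1 ≤ j ≤ n} coincide. -/
open Finset

/-- A sequence dropping by at least `2` at each step between `s` and `t`. -/
lemma add_two_mul_le_of_steps (l : ℕ → ℕ) {s t : ℕ} (hst : s ≤ t)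
    (h : ∀ j, s ≤ j → j < t → l (j + 1) + 2 ≤ l j) : l t + 2 * (t - s) ≤ l s := by
  induction t, hst using Nat.le_induction with
  | base => simp
  | succ t hst ih =>
    have h1 := ih fun j hj hjt => h j hj (by omega)
    have h2 := h t hst (by omega)
    omega

/-- A sequence whose upward steps are at most `1` attains `v - 1` before it first reaches `v`. -/
lemma exists_add_one_eq_of_lt_of_le (b : ℕ → ℕ) (hb : ∀ j, b (j + 1) ≤ b j + 1) {k m v : ℕ}
    (hkm : k ≤ m) (hk : b k < v) (hm : v ≤ b m) : ∃ r, k ≤ r ∧ r < m ∧ b r + 1 = v := by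
  induction m, hkm using Nat.le_induction with
  | base => omega
  | succ m hkm ih =>
    by_cases hv : v ≤ b m
    · obtain ⟨r, h1, h2, h3⟩ := ih hv
      exact ⟨r, h1, by omega, h3⟩
    · have := hb m
      exact ⟨m, hkm, by omega, by omega⟩

/-- Positions of entries of `j ↦ j + 1 + 2 λ_j` relative to each other in Case A. -/
lemma CaseA.separation {n i : ℕ} {l : ℕ → ℕ} (hA : CaseA n l i) {p q : ℕ} (hpq : p < q)
    (hq : q < n) :
    q + 3 + 2 * l q ≤ p + 2 * l p ∨
      (i ≤ p ∧ q ≤ i + 2 ∧ l q = l p) ∨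
      (i ≤ p ∧ p ≤ i + 2 ∧ q = i + 3 ∧ l p = l q + 2) := by
  obtain ⟨hn, h0, h1, h2, h3, h4⟩ := hA
  have up : ∀ s t, s ≤ t → t ≤ i → l t + 2 * (t - s) ≤ l s := fun s t hst ht =>
    add_two_mul_le_of_steps l hst fun j _ hj => by
      by_cases hji : j + 1 = i
      · subst hji
        have := h3 (by omega)
        simp only [Nat.add_sub_cancel] at this
        omega
      · exact h4 j (by omega) (by omega)
  have down : ∀ s t, s ≤ t → i + 3 ≤ s → t < n → l t + 2 * (t - s) ≤ l s := fun s t hst hs ht =>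
    add_two_mul_le_of_steps l hst fun j _ hj => h4 j (by omega) (by omega)
  have before : p < i → l i + 2 * (i - p) + 1 ≤ l p := fun hp => by
    have := h3 (by omega)
    have := up p (i - 1) (by omega) (by omega)
    omega
  have mid : ∀ j, i ≤ j → j ≤ i + 2 → l j = l i := fun j hj hj2 => by
    obtain rfl | rfl | rfl : j = i ∨ j = i + 1 ∨ j = i + 2 := by omega
    all_goals omega
  by_cases hp : p < i
  · have := before hp
    by_cases hqi : q ≤ i
    · have := up p q hpq.le hqi
      omega
    · by_cases hq2 : q ≤ i + 2
      · have := mid q (by omega) hq2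
        omega
      · have := down (i + 3) q (by omega) le_rfl hq
        omega
  · by_cases hp2 : p ≤ i + 2
    · have := mid p (by omega) hp2
      by_cases hq2 : q ≤ i + 2
      · have := mid q (by omega) hq2
        omega
      · have := down (i + 3) q (by omega) le_rfl hq
        by_cases hq3 : q = i + 3
        · subst hq3
          omega
        · omega
    · have := down p q hpq.le (by omega) hq
      omega

/-- For a Case A partition `λ` there is no partition `μ ≠ λ`, strictly smaller than `λ` in the
dominance order, with the same multiset `{j + 2λ_j}`. -/
theorem caseA_no_dominated (n : ℕ) (hn : 4 ≤ n) (l : ℕ → ℕ) (hl : PartitionN n l)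
    (i : ℕ) (hA : CaseA n l i) :
    ¬ ∃ μ : ℕ → ℕ, PartitionN n μ ∧ μ ≠ l ∧
      (∑ j ∈ Finset.range n, μ j = ∑ j ∈ Finset.range n, l j) ∧
      (∀ k, k ≤ n → ∑ j ∈ Finset.range k, μ j ≤ ∑ j ∈ Finset.range k, l j) ∧
      msInv n μ = msInv n l := by
  rintro ⟨μ, ⟨hμ, hμ0⟩, hne, -, hdom, hms⟩
  have hmem : ∀ v, (∃ j < n, j + 1 + 2 * μ j = v) ↔ ∃ j < n, j + 1 + 2 * l j = v := fun v => by
    have := congrArg (v ∈ ·) hms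
    simpa [msInv] using this
  have hinjl : Set.InjOn (fun j => j + 1 + 2 * l j) (Finset.range n) := by
    intro p hp q hq hpq
    simp only [Finset.coe_range, Set.mem_Iio] at hp hq hpq
    rcases lt_trichotomy p q with h | h | h
    · have := hA.separation h hq
      omega
    · exact h
    · have := hA.separation h hp
      omega
  have hinj : Set.InjOn (fun j => j + 1 + 2 * μ j) (Finset.range n) := by
    have hnd : (msInv n l).Nodup := (Finset.nodup_map_iff_injOn).2 hinjl
    rw [← hms] at hnd
    exact (Finset.nodup_map_iff_injOn).1 hnd
  have hstep : ∀ j, (j + 1) + 1 + 2 * μ (j + 1) ≤ j + 1 + 2 * μ j + 1 := fun j => by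
    have := hμ (Nat.le_succ j)
    simp only [Nat.succ_eq_add_one] at this
    omega
  have key : ∀ k, k < n → μ k = l k := by
    intro k
    induction k using Nat.strong_induction_on with
    | _ k ih =>
    intro hk
    have hle : μ k ≤ l k := by
      have h := hdom (k + 1) hk
      have hs : ∑ j ∈ Finset.range k, μ j = ∑ j ∈ Finset.range k, l j :=
        Finset.sum_congr rfl fun j hj => ih j (Finset.mem_range.1 hj)
          ((Finset.mem_range.1 hj).trans hk)
      rw [Finset.sum_range_succ, Finset.sum_range_succ] at h
      omega
    by_contra hneq
    have late : ∀ p, k ≤ p → p < n → ∃ m, k ≤ m ∧ m < n ∧ m + 1 + 2 * μ m = p + 1 + 2 * l p := by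
      intro p hp hpn
      obtain ⟨m, hm, hmv⟩ := (hmem _).2 ⟨p, hpn, rfl⟩
      refine ⟨m, ?_, hm, hmv⟩
      by_contra hlt
      have h := ih m (by omega) hm
      have := hinjl (x₁ := m) (x₂ := p) (by simpa using hm) (by simpa using hpn)
        (by simp only; omega)
      omega
    have early : ∀ p, k ≤ p → p < n → k + 1 + 2 * μ k < p + 1 + 2 * l p →
        ∃ q, k ≤ q ∧ q < n ∧ q + 1 + 2 * l q + 1 = p + 1 + 2 * l p := by
      intro p hp hpn hlt
      obtain ⟨m, hkm, hm, hmv⟩ := late p hp hpn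
      obtain ⟨r, hkr, hrm, hr⟩ := exists_add_one_eq_of_lt_of_le (fun j => j + 1 + 2 * μ j) hstep
        hkm (v := p + 1 + 2 * l p) hlt hmv.ge
      obtain ⟨q, hq, hqv⟩ := (hmem _).1 ⟨r, hrm.trans hm, rfl⟩
      refine ⟨q, ?_, hq, by omega⟩
      by_contra hlt
      have h := ih q (by omega) hq
      have := hinj (x₁ := q) (x₂ := r) (by simpa using hq) (by simpa using hrm.trans hm)
        (by simp only; omega)
      omega
    obtain ⟨q, hkq, hq, hqv⟩ := early k le_rfl hk (by omega)
    have hkq' : k < q := by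
      rcases hkq.eq_or_lt with rfl | h
      · omega
      · exact h
    have hsep := hA.separation hkq' hq
    obtain ⟨r, hkr, hr, hrv⟩ := early q hkq hq (by omega)
    rcases lt_trichotomy r q with h | rfl | h
    · have := hA.separation h hq
      omega
    · omega
    · have := hA.separation h hr
      omega
  refine hne (funext fun j => ?_)
  rcases lt_or_ge j n with h | h
  · exact key j h
  · rw [hμ0 j h, hl.2 j h]
end
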